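/- Let (X,ρ,μ) be a quasi-metric measure space in which μ is Borel regular and Q-doubling for some Q ∈ (0,∞). Fix s,p ∈ (0,∞) and q ∈ (0,∞] with s ⪯_q ind(X,ρ) and additionally p > Q/(Q+s) and q > Q/(Q+s). If Ω ⊂ X is a nonempty μ-measurable set satisfying the measure density condition, then there exists a bounded LINEAR operator 𝓔 : M^s_{p,q}(Ω,ρ,μ) → M^s_{p,q}(X,ρ,μ) such that (𝓔u)|_Ω = u μ-almost everywhere on Ω for every u ∈ M^s_{p,q}(Ω,ρ,μ). -/

import Mathlib

open MeasureTheory ENNReal Set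

noncomputable section

namespace HajlaszPaper

variable {X : Type*}

/-- The `ρ`-ball centered at `x` with radius `r`. -/
def qball (ρ : X → X → ℝ) (x : X) (r : ℝ) : Set X := {y | ρ x y < r}

/-- `ρ` is a quasi-metric on `X`. -/
def IsQuasiDist (ρ : X → X → ℝ) : Prop :=
  (∀ x y, 0 ≤ ρ x y) ∧ (∀ x y, ρ x y = 0 ↔ x = y) ∧
    (∃ C₀ : ℝ, 1 ≤ C₀ ∧ ∀ x y, ρ y x ≤ C₀ * ρ x y) ∧
    (∃ C₁ : ℝ, 1 ≤ C₁ ∧ ∀ x y z, ρ x y ≤ C₁ * max (ρ x z) (ρ z y))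

/-- The least admissible quasi-triangle constant `C_ρ`. -/
def Crho (ρ : X → X → ℝ) : ℝ :=
  sInf {C : ℝ | 1 ≤ C ∧ ∀ x y z : X, ρ x y ≤ C * max (ρ x z) (ρ z y)}

/-- The least admissible quasi-symmetry constant `C̃_ρ`. -/
def CrhoTilde (ρ : X → X → ℝ) : ℝ :=
  sInf {C : ℝ | 1 ≤ C ∧ ∀ x y : X, ρ y x ≤ C * ρ x y}

/-- Two quasi-metrics are (bi-Lipschitz, i.e. pointwise) equivalent. -/
def EquivQM (ρ ϱ : X → X → ℝ) : Prop :=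
  ∃ c : ℝ, 1 ≤ c ∧ ∀ x y, c⁻¹ * ϱ x y ≤ ρ x y ∧ ρ x y ≤ c * ϱ x y

variable [MeasurableSpace X]

/-- `(X, ρ, μ)` is a quasi-metric measure space. -/
structure IsQMMS (ρ : X → X → ℝ) (μ : Measure X) : Prop where
  nontrivial : ∃ x y : X, x ≠ y
  quasi : IsQuasiDist ρ
  measurableSet_ball : ∀ (x : X) (r : ℝ), 0 < r → MeasurableSet (qball ρ x r)
  ball_pos : ∀ (x : X) (r : ℝ), 0 < r → 0 < μ (qball ρ x r)
  ball_lt_top : ∀ (x : X) (r : ℝ), 0 < r → μ (qball ρ x r) < ∞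

/-- Every `μ`-measurable set is contained in a Borel (measurable) set of equal measure. -/
def BorelRegular (μ : Measure X) : Prop :=
  ∀ A : Set X, ∃ B : Set X, A ⊆ B ∧ MeasurableSet B ∧ μ A = μ B

/-- `μ` is `Q`-doubling. -/
def QDoubling (ρ : X → X → ℝ) (μ : Measure X) (Q : ℝ) : Prop :=
  ∃ κ : ℝ, 0 < κ ∧ ∀ (x y : X) (r R : ℝ), 0 < r → r ≤ R →
    qball ρ x r ⊆ qball ρ y R →
    ENNReal.ofReal (κ * (r / R) ^ Q) * μ (qball ρ y R) ≤ μ (qball ρ x r)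

/-- `μ` is doubling. -/
def DoublingMeas (ρ : X → X → ℝ) (μ : Measure X) : Prop :=
  ∃ Cd : ℝ, 0 < Cd ∧ ∀ (x : X) (r : ℝ), 0 < r →
    μ (qball ρ x (2 * r)) ≤ ENNReal.ofReal Cd * μ (qball ρ x r)

/-- The measure density condition for `Ω`. -/
def MeasDensity (ρ : X → X → ℝ) (μ : Measure X) (Ω : Set X) : Prop :=
  ∃ c : ℝ, 0 < c ∧ ∀ x ∈ Ω, ∀ r : ℝ, 0 < r → r ≤ 1 →
    μ (qball ρ x r) ≤ ENNReal.ofReal c * μ (qball ρ x r ∩ Ω)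

/-- `Ω` is locally uniformly perfect with constant `lam ∈ (0,1)`. -/
def LocUnifPerfect (ρ : X → X → ℝ) (Ω : Set X) (lam : ℝ) : Prop :=
  ∀ x ∈ Ω, ∀ r : ℝ, 0 < r → r ≤ 1 → (Ω \ qball ρ x r).Nonempty →
    ((qball ρ x r ∩ Ω) \ qball ρ x (lam * r)).Nonempty

/-- The critical radius `φ^x_{Ω,ρ}(r)`. -/
def phiRad (ρ : X → X → ℝ) (μ : Measure X) (Ω : Set X) (x : X) (r : ℝ) : ℝ :=
  sSup {t : ℝ | 0 ≤ t ∧ t ≤ r ∧ μ (qball ρ x t ∩ Ω) ≤ μ (qball ρ x r ∩ Ω) / 2}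

/-- The collection `𝔻^s_ρ(u)` of fractional `s`-gradients of `u` on `Ω`. -/
def fracGrad (ρ : X → X → ℝ) (μ : Measure X) (Ω : Set X) (s : ℝ) (u : X → ℝ) :
    Set (ℤ → X → ℝ) :=
  {g | (∀ k x, 0 ≤ g k x) ∧ (∀ k, AEMeasurable (g k) (μ.restrict Ω)) ∧
    ∃ E : Set X, μ E = 0 ∧ ∀ k : ℤ, ∀ x ∈ Ω \ E, ∀ y ∈ Ω \ E,
      (2 : ℝ) ^ (-k - 1) ≤ ρ x y → ρ x y < (2 : ℝ) ^ (-k) →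
      |u x - u y| ≤ ρ x y ^ s * (g k x + g k y)}

/-- `g` is an `s`-gradient of `u` on `S`. -/
def IsSGradOn (ρ : X → X → ℝ) (μ : Measure X) (S : Set X) (s : ℝ) (u g : X → ℝ) : Prop :=
  (∀ x, 0 ≤ g x) ∧ AEMeasurable g (μ.restrict S) ∧
    ∃ E : Set X, μ E = 0 ∧ ∀ x ∈ S \ E, ∀ y ∈ S \ E,
      |u x - u y| ≤ ρ x y ^ s * (g x + g y)

/-- The `ℓ^q` norm (`0 < q ≤ ∞`) of a `ℤ`-indexed sequence in `[0,∞]`. -/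
def lqN (q : ℝ≥0∞) (a : ℤ → ℝ≥0∞) : ℝ≥0∞ :=
  if q = ∞ then ⨆ k, a k else (∑' k, a k ^ q.toReal) ^ (1 / q.toReal)

/-- The `L^p` "norm" (`0 < p < ∞`) of a `[0,∞]`-valued function. -/
def lpN (μ : Measure X) (p : ℝ) (f : X → ℝ≥0∞) : ℝ≥0∞ :=
  (∫⁻ x, f x ^ p ∂μ) ^ (1 / p)

/-- The `L^p` norm of `u : X → ℝ` over the set `Ω`. -/
def lpOn (μ : Measure X) (Ω : Set X) (p : ℝ) (u : X → ℝ) : ℝ≥0∞ :=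
  lpN (μ.restrict Ω) p fun x => ENNReal.ofReal |u x|

/-- The homogeneous Hajłasz–Triebel–Lizorkin quasi-norm `‖u‖_{Ṁ^s_{p,q}(Ω,ρ,μ)}`. -/
def MdotNorm (ρ : X → X → ℝ) (μ : Measure X) (Ω : Set X) (s p : ℝ) (q : ℝ≥0∞)
    (u : X → ℝ) : ℝ≥0∞ :=
  ⨅ g ∈ fracGrad ρ μ Ω s u,
    lpN (μ.restrict Ω) p fun x => lqN q fun k => ENNReal.ofReal (g k x)

/-- The homogeneous Hajłasz–Besov quasi-norm `‖u‖_{Ṅ^s_{p,q}(Ω,ρ,μ)}`. -/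
def NdotNorm (ρ : X → X → ℝ) (μ : Measure X) (Ω : Set X) (s p : ℝ) (q : ℝ≥0∞)
    (u : X → ℝ) : ℝ≥0∞ :=
  ⨅ g ∈ fracGrad ρ μ Ω s u,
    lqN q fun k => lpN (μ.restrict Ω) p fun x => ENNReal.ofReal (g k x)

/-- Membership in `M^s_{p,q}(Ω,ρ,μ)`. -/
def MemMspq (ρ : X → X → ℝ) (μ : Measure X) (Ω : Set X) (s p : ℝ) (q : ℝ≥0∞)
    (u : X → ℝ) : Prop :=
  AEMeasurable u (μ.restrict Ω) ∧ lpOn μ Ω p u ≠ ∞ ∧ MdotNorm ρ μ Ω s p q u ≠ ∞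

/-- Membership in `N^s_{p,q}(Ω,ρ,μ)`. -/
def MemNspq (ρ : X → X → ℝ) (μ : Measure X) (Ω : Set X) (s p : ℝ) (q : ℝ≥0∞)
    (u : X → ℝ) : Prop :=
  AEMeasurable u (μ.restrict Ω) ∧ lpOn μ Ω p u ≠ ∞ ∧ NdotNorm ρ μ Ω s p q u ≠ ∞

/-- The quasi-norm of `M^s_{p,q}(Ω,ρ,μ)`. -/
def MNorm (ρ : X → X → ℝ) (μ : Measure X) (Ω : Set X) (s p : ℝ) (q : ℝ≥0∞)
    (u : X → ℝ) : ℝ≥0∞ :=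
  MdotNorm ρ μ Ω s p q u + lpOn μ Ω p u

/-- The quasi-norm of `N^s_{p,q}(Ω,ρ,μ)`. -/
def NNorm (ρ : X → X → ℝ) (μ : Measure X) (Ω : Set X) (s p : ℝ) (q : ℝ≥0∞)
    (u : X → ℝ) : ℝ≥0∞ :=
  NdotNorm ρ μ Ω s p q u + lpOn μ Ω p u

/-- `s ⪯_q ind(X,ρ)` : there is a quasi-metric `ϱ ≈ ρ` with `s ≤ (log₂ C_ϱ)⁻¹`
(equivalently `C_ϱ ^ s ≤ 2`), where equality is permitted only when `q = ∞`. -/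
def SPrecIndex (ρ : X → X → ℝ) (s : ℝ) (q : ℝ≥0∞) : Prop :=
  ∃ ϱ : X → X → ℝ, IsQuasiDist ϱ ∧ EquivQM ρ ϱ ∧
    (Crho ϱ ^ s < 2 ∨ (q = ∞ ∧ Crho ϱ ^ s ≤ 2))

/-- `s < ind(X,ρ)` : there is a quasi-metric `ϱ ≈ ρ` with `s < (log₂ C_ϱ)⁻¹`
(equivalently `C_ϱ ^ s < 2`). -/
def SLtIndex (ρ : X → X → ℝ) (s : ℝ) : Prop :=
  ∃ ϱ : X → X → ℝ, IsQuasiDist ϱ ∧ EquivQM ρ ϱ ∧ Crho ϱ ^ s < 2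

/-- The median value `m_u(E)`. -/
def medianVal (μ : Measure X) (E : Set X) (u : X → ℝ) : ℝ :=
  sSup {θ : ℝ | μ {x ∈ E | u x < θ} ≤ μ E / 2}

/-- `f` belongs to the homogeneous Hölder space `Ċ^α(X,ρ)`. -/
def MemHolder (ρ : X → X → ℝ) (α : ℝ) (f : X → ℝ) : Prop :=
  ∃ H : ℝ, 0 ≤ H ∧ ∀ x y : X, |f x - f y| ≤ H * ρ x y ^ α

/-- The Hölder seminorm `‖f‖_{Ċ^α(X,ρ)}`. -/
def holderNorm (ρ : X → X → ℝ) (α : ℝ) (f : X → ℝ) : ℝ :=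
  sInf {H : ℝ | 0 ≤ H ∧ ∀ x y : X, |f x - f y| ≤ H * ρ x y ^ α}

/-- The sup norm of `f`. -/
def supNorm (f : X → ℝ) : ℝ := sSup (Set.range fun x => |f x|)

/-- `ρ` is a genuine metric. -/
def IsMetricDist (ρ : X → X → ℝ) : Prop :=
  (∀ x y, 0 ≤ ρ x y) ∧ (∀ x y, ρ x y = 0 ↔ x = y) ∧ (∀ x y, ρ x y = ρ y x) ∧
    (∀ x y z, ρ x y ≤ ρ x z + ρ z y)

/-- The homogeneous Hajłasz–Sobolev quasi-norm `‖u‖_{Ṁ^{1,p}(Ω,ρ,μ)}`. -/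
def M1pDotNorm (ρ : X → X → ℝ) (μ : Measure X) (Ω : Set X) (p : ℝ) (u : X → ℝ) : ℝ≥0∞ :=
  ⨅ g ∈ {g : X → ℝ | IsSGradOn ρ μ Ω 1 u g},
    lpN (μ.restrict Ω) p fun x => ENNReal.ofReal (g x)

/-- Membership in the Hajłasz–Sobolev space `M^{1,p}(Ω,ρ,μ)`. -/
def MemM1p (ρ : X → X → ℝ) (μ : Measure X) (Ω : Set X) (p : ℝ) (u : X → ℝ) : Prop :=
  AEMeasurable u (μ.restrict Ω) ∧ lpOn μ Ω p u ≠ ∞ ∧ M1pDotNorm ρ μ Ω p u ≠ ∞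

/-- The quasi-norm of `M^{1,p}(Ω,ρ,μ)`. -/
def M1pNorm (ρ : X → X → ℝ) (μ : Measure X) (Ω : Set X) (p : ℝ) (u : X → ℝ) : ℝ≥0∞ :=
  lpOn μ Ω p u + M1pDotNorm ρ μ Ω p u

set_option linter.unusedSectionVars false

section SequenceNorms

theorem ennreal_add_rpow_le (a b : ℝ≥0∞) {r : ℝ} (hr : 0 ≤ r) :
    (a + b) ^ r ≤ 2 ^ r * (a ^ r + b ^ r) := by
  rcases le_total a b with h | h
  · calc (a + b) ^ r ≤ (2 * b) ^ r := by
          refine ENNReal.rpow_le_rpow ?_ hr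
          rw [two_mul]; gcongr
      _ = 2 ^ r * b ^ r := ENNReal.mul_rpow_of_nonneg _ _ hr
      _ ≤ _ := by gcongr; exact le_add_self
  · calc (a + b) ^ r ≤ (2 * a) ^ r := by
          refine ENNReal.rpow_le_rpow ?_ hr
          rw [two_mul]; gcongr
      _ = 2 ^ r * a ^ r := ENNReal.mul_rpow_of_nonneg _ _ hr
      _ ≤ _ := by gcongr; exact le_self_add

variable {q : ℝ≥0∞}

theorem lqN_mono {a b : ℤ → ℝ≥0∞} (h : ∀ k, a k ≤ b k) : lqN q a ≤ lqN q b := by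
  unfold lqN
  split_ifs
  · exact iSup_mono h
  · have : 0 ≤ q.toReal := ENNReal.toReal_nonneg
    gcongr with k
    exact h k

theorem lqN_const_mul (hq : 0 < q) (c : ℝ≥0∞) (a : ℤ → ℝ≥0∞) :
    lqN q (fun k => c * a k) = c * lqN q a := by
  unfold lqN
  split_ifs with h
  · rw [ENNReal.mul_iSup]
  · have hr : 0 < q.toReal := ENNReal.toReal_pos hq.ne' h
    simp_rw [ENNReal.mul_rpow_of_nonneg _ _ hr.le, ENNReal.tsum_mul_left]
    rw [ENNReal.mul_rpow_of_nonneg _ _ (by positivity), ← ENNReal.rpow_mul,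
      mul_one_div_cancel hr.ne', ENNReal.rpow_one]

theorem le_lqN (hq : 0 < q) (a : ℤ → ℝ≥0∞) (k : ℤ) : a k ≤ lqN q a := by
  unfold lqN
  split_ifs with h
  · exact le_iSup a k
  · have hr : 0 < q.toReal := ENNReal.toReal_pos hq.ne' h
    calc a k = (a k ^ q.toReal) ^ (1 / q.toReal) := by
          rw [← ENNReal.rpow_mul, mul_one_div_cancel hr.ne', ENNReal.rpow_one]
      _ ≤ _ := by
          gcongr
          exact ENNReal.le_tsum (f := fun k => a k ^ q.toReal) k

theorem lqN_rpow {t : ℝ} (ht : 0 < t) (a : ℤ → ℝ≥0∞) :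
    lqN (q / ENNReal.ofReal t) (fun k => a k ^ t) = lqN q a ^ t := by
  have ht' : ENNReal.ofReal t ≠ 0 := by simpa using ht
  by_cases h : q = ∞
  · subst h
    have : (∞ : ℝ≥0∞) / ENNReal.ofReal t = ∞ := ENNReal.top_div_of_ne_top ENNReal.ofReal_ne_top
    simp only [lqN, this, if_true]
    exact ((ENNReal.orderIsoRpow t ht).map_iSup a).symm
  · have h2 : q / ENNReal.ofReal t ≠ ∞ := ENNReal.div_ne_top h ht'
    simp only [lqN, h, h2, if_false, ENNReal.toReal_div, ENNReal.toReal_ofReal ht.le]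
    rw [← ENNReal.rpow_mul]
    congr 1
    · congr 1
      ext k
      rw [← ENNReal.rpow_mul]
      congr 1
      field_simp
    · rw [one_div_div]; ring

theorem lqN_add_le (hq : 0 < q) : ∃ C : ℝ≥0∞, C ≠ ∞ ∧ ∀ a b : ℤ → ℝ≥0∞,
    lqN q (fun k => a k + b k) ≤ C * (lqN q a + lqN q b) := by
  by_cases h : q = ∞
  · subst h
    refine ⟨1, by simp, fun a b => ?_⟩
    simp only [lqN, if_true, one_mul]
    exact iSup_le fun k => add_le_add (le_iSup a k) (le_iSup b k)
  · have hr : 0 < q.toReal := ENNReal.toReal_pos hq.ne' h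
    refine ⟨2 * 2 ^ (1 / q.toReal), ENNReal.mul_ne_top (by simp)
      (ENNReal.rpow_ne_top_of_nonneg (by positivity) (by simp)), fun a b => ?_⟩
    simp only [lqN, h, if_false]
    set r := q.toReal
    calc (∑' k, (a k + b k) ^ r) ^ (1 / r)
        ≤ (∑' k, 2 ^ r * (a k ^ r + b k ^ r)) ^ (1 / r) := by
          gcongr with k; exact ennreal_add_rpow_le _ _ hr.le
      _ = 2 * (∑' k, a k ^ r + ∑' k, b k ^ r) ^ (1 / r) := by
          rw [ENNReal.tsum_mul_left, ENNReal.tsum_add,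
            ENNReal.mul_rpow_of_nonneg _ _ (by positivity), ← ENNReal.rpow_mul,
            mul_one_div_cancel hr.ne', ENNReal.rpow_one]
      _ ≤ 2 * (2 ^ (1 / r) * ((∑' k, a k ^ r) ^ (1 / r) + (∑' k, b k ^ r) ^ (1 / r))) := by
          gcongr; exact ennreal_add_rpow_le _ _ (by positivity)
      _ = _ := by ring

theorem lqN_shift (a : ℤ → ℝ≥0∞) (m : ℤ) : lqN q (fun k => a (k + m)) = lqN q a := by
  unfold lqN
  split_ifs
  · exact (Equiv.addRight m).iSup_comp (g := a)
  · rw [(Equiv.addRight m).tsum_eq (fun k => a k ^ q.toReal) |>.symm]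
    rfl

theorem lqN_single (hq : 0 < q) (m : ℤ) (c : ℝ≥0∞) :
    lqN q (Pi.single m c) = c := by
  unfold lqN
  split_ifs with h
  · apply le_antisymm
    · refine iSup_le fun k => ?_
      by_cases hk : k = m
      · subst hk; simp
      · simp [hk]
    · exact le_iSup_of_le m (by simp)
  · have hr : 0 < q.toReal := ENNReal.toReal_pos hq.ne' h
    rw [tsum_eq_single m]
    · rw [Pi.single_eq_same, ← ENNReal.rpow_mul, mul_one_div_cancel hr.ne', ENNReal.rpow_one]
    · intro k hk
      simp [hk, hr]

theorem tsum_geometric_ne_top {η : ℝ≥0∞} (h : η < 1) : ∑' i : ℕ, η ^ i ≠ ∞ := by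
  rw [ENNReal.tsum_geometric]
  exact ENNReal.inv_ne_top.2 (tsub_pos_of_lt h).ne'

theorem tsum_geometric_mul_rpow_le {η : ℝ≥0∞} (hη : η < 1) {r : ℝ} (hr : 0 < r) :
    ∃ (C ζ : ℝ≥0∞), C ≠ ∞ ∧ ζ < 1 ∧ ∀ b : ℕ → ℝ≥0∞,
      (∑' i, η ^ i * b i) ^ r ≤ C * ∑' i, ζ ^ i * b i ^ r := by
  obtain ⟨ξ, hξ1, rfl⟩ : ∃ ξ : ℝ≥0∞, ξ < 1 ∧ η = ξ * ξ := by
    refine ⟨η ^ (1 / 2 : ℝ), ENNReal.rpow_lt_one hη (by norm_num), ?_⟩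
    rw [← ENNReal.rpow_add_of_nonneg _ _ (by norm_num) (by norm_num)]; norm_num
  refine ⟨(∑' i : ℕ, ξ ^ i) ^ r, ξ ^ r,
    ENNReal.rpow_ne_top_of_nonneg hr.le (tsum_geometric_ne_top hξ1),
    ENNReal.rpow_lt_one hξ1 hr, fun b => ?_⟩
  have h1 : ∑' i, (ξ * ξ) ^ i * b i ≤ (∑' i : ℕ, ξ ^ i) * ⨆ i, ξ ^ i * b i := by
    rw [← ENNReal.tsum_mul_right]
    refine ENNReal.tsum_le_tsum fun i => ?_
    rw [mul_pow, mul_assoc]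
    gcongr
    exact le_iSup (fun i => ξ ^ i * b i) i
  have h2 : (⨆ i, ξ ^ i * b i) ^ r ≤ ∑' i, (ξ ^ r) ^ i * b i ^ r := by
    rw [show (⨆ i, ξ ^ i * b i) ^ r = ⨆ i, (ξ ^ i * b i) ^ r from
      (ENNReal.orderIsoRpow r hr).map_iSup _]
    refine iSup_le fun i => ?_
    have : (ξ ^ i * b i) ^ r = (ξ ^ r) ^ i * b i ^ r := by
      rw [ENNReal.mul_rpow_of_nonneg _ _ hr.le, ← ENNReal.rpow_natCast, ← ENNReal.rpow_natCast,
        ← ENNReal.rpow_mul, ← ENNReal.rpow_mul, mul_comm r]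
    rw [this]
    exact ENNReal.le_tsum (f := fun i => (ξ ^ r) ^ i * b i ^ r) i
  calc (∑' i, (ξ * ξ) ^ i * b i) ^ r ≤ ((∑' i : ℕ, ξ ^ i) * ⨆ i, ξ ^ i * b i) ^ r := by gcongr
    _ = (∑' i : ℕ, ξ ^ i) ^ r * (⨆ i, ξ ^ i * b i) ^ r := ENNReal.mul_rpow_of_nonneg _ _ hr.le
    _ ≤ _ := by gcongr

/-- Discrete convolution with a geometric kernel is bounded on `ℓ^q`, for every `q > 0`. -/
theorem lqN_geometric_conv_le (hq : 0 < q) {η : ℝ≥0∞} (hη : η < 1) (σ : ℕ → ℤ) :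
    ∃ C : ℝ≥0∞, C ≠ ∞ ∧ ∀ a : ℤ → ℝ≥0∞,
      lqN q (fun k => ∑' i : ℕ, η ^ i * a (k + σ i)) ≤ C * lqN q a := by
  by_cases h : q = ∞
  · subst h
    refine ⟨∑' i : ℕ, η ^ i, tsum_geometric_ne_top hη, fun a => ?_⟩
    simp only [lqN, if_true]
    refine iSup_le fun k => ?_
    rw [← ENNReal.tsum_mul_right]
    gcongr with i
    exact le_iSup a _
  · have hr : 0 < q.toReal := ENNReal.toReal_pos hq.ne' h
    obtain ⟨C, ζ, hC, hζ, hb⟩ := tsum_geometric_mul_rpow_le hη hr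
    refine ⟨(C * ∑' i : ℕ, ζ ^ i) ^ (1 / q.toReal), ENNReal.rpow_ne_top_of_nonneg (by positivity)
      (ENNReal.mul_ne_top hC (tsum_geometric_ne_top hζ)), fun a => ?_⟩
    simp only [lqN, h, if_false]
    set r := q.toReal
    rw [← ENNReal.mul_rpow_of_nonneg _ _ (by positivity)]
    gcongr
    calc ∑' k, (∑' i : ℕ, η ^ i * a (k + σ i)) ^ r
        ≤ ∑' k, C * ∑' i : ℕ, ζ ^ i * a (k + σ i) ^ r := by
          gcongr with k; exact hb _
      _ = C * ∑' i : ℕ, ζ ^ i * ∑' k, a (k + σ i) ^ r := by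
          rw [ENNReal.tsum_mul_left, ENNReal.tsum_comm]
          simp_rw [ENNReal.tsum_mul_left]
      _ = C * ∑' i : ℕ, ζ ^ i * ∑' k, a k ^ r := by
          congr 2
          ext i
          congr 1
          exact (Equiv.addRight (σ i)).tsum_eq (fun k => a k ^ r)
      _ = _ := by rw [ENNReal.tsum_mul_right, mul_assoc]

theorem measurable_lqN {Y : Type*} [MeasurableSpace Y] {a : ℤ → Y → ℝ≥0∞}
    (ha : ∀ k, Measurable (a k)) : Measurable fun x => lqN q fun k => a k x := by
  unfold lqN
  split_ifs
  · exact Measurable.iSup ha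
  · exact (Measurable.tsum fun k => (ha k).pow_const _).pow_const _

end SequenceNorms

section BallAverages

variable [PseudoMetricSpace X]

/-- `μ` is finite and positive on balls and doubling with constant `Cd` and exponent `D`. -/
structure DoublingOn (μ : Measure X) (Cd : ℝ≥0∞) (D : ℝ) : Prop where
  const_ne_top : Cd ≠ ∞
  exponent_pos : 0 < D
  ball_pos : ∀ (x : X) (r : ℝ), 0 < r → 0 < μ (Metric.ball x r)
  ball_lt_top : ∀ (x : X) (r : ℝ), 0 < r → μ (Metric.ball x r) < ∞
  ball_le : ∀ (x : X) (r R : ℝ), 0 < r → r ≤ R →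
    μ (Metric.ball x R) ≤ Cd * ENNReal.ofReal ((R / r) ^ D) * μ (Metric.ball x r)

/-- The average of `f` over the ball of radius `r` around `x`. -/
def ballAvg (μ : Measure X) (r : ℝ) (f : X → ℝ≥0∞) (x : X) : ℝ≥0∞ :=
  (μ (Metric.ball x r))⁻¹ * ∫⁻ z in Metric.ball x r, f z ∂μ

/-- The maximal function over the radii `r k`. -/
def maxFn (μ : Measure X) (r : ℤ → ℝ) (f : X → ℝ≥0∞) (x : X) : ℝ≥0∞ :=
  ⨆ k, ballAvg μ (r k) f x

variable {μ : Measure X} {Cd : ℝ≥0∞} {D : ℝ}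

theorem DoublingOn.ball_le_of_dist (h : DoublingOn μ Cd D) {x y : X} {r R S : ℝ} (hr : 0 < r)
    (hrS : r ≤ S) (hS : dist x y + R ≤ S) :
    μ (Metric.ball x R) ≤ Cd * ENNReal.ofReal ((S / r) ^ D) * μ (Metric.ball y r) :=
  (measure_mono (Metric.ball_subset_ball' (by linarith))).trans (h.ball_le y r S hr hrS)

theorem DoublingOn.isLocallyFinite (h : DoublingOn μ Cd D) : IsLocallyFiniteMeasure μ :=
  ⟨fun x => ⟨Metric.ball x 1, Metric.ball_mem_nhds x one_pos, h.ball_lt_top x 1 one_pos⟩⟩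

theorem DoublingOn.sigmaFinite [SecondCountableTopology X] (h : DoublingOn μ Cd D) :
    SigmaFinite μ := by
  have := h.isLocallyFinite
  infer_instance

theorem ballAvg_mono {r : ℝ} {f g : X → ℝ≥0∞} (hfg : ∀ x, f x ≤ g x) (x : X) :
    ballAvg μ r f x ≤ ballAvg μ r g x := by
  unfold ballAvg
  gcongr with z
  exact hfg z

theorem ballAvg_le_maxFn (r : ℤ → ℝ) (f : X → ℝ≥0∞) (k : ℤ) (x : X) :
    ballAvg μ (r k) f x ≤ maxFn μ r f x := le_iSup (fun k => ballAvg μ (r k) f x) k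

theorem ballAvg_const_le (r : ℝ) (c : ℝ≥0∞) (x : X) : ballAvg μ r (fun _ => c) x ≤ c := by
  unfold ballAvg
  rw [setLIntegral_const, mul_comm c, ← mul_assoc]
  exact (mul_le_mul_left (ENNReal.inv_mul_le_one _) c).trans_eq (one_mul c)

theorem ballAvg_const_mul {r : ℝ} {f : X → ℝ≥0∞} (c : ℝ≥0∞) (hc : c ≠ ∞) (x : X) :
    ballAvg μ r (fun z => c * f z) x = c * ballAvg μ r f x := by
  unfold ballAvg
  rw [lintegral_const_mul' _ _ hc]
  ring

theorem ballAvg_add {r : ℝ} {f g : X → ℝ≥0∞} (hf : Measurable f) (x : X) :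
    ballAvg μ r (fun z => f z + g z) x = ballAvg μ r f x + ballAvg μ r g x := by
  unfold ballAvg
  rw [lintegral_add_left hf, mul_add]

theorem ballAvg_tsum {r : ℝ} {f : ℕ → X → ℝ≥0∞} (hf : ∀ i, Measurable (f i)) (x : X) :
    ballAvg μ r (fun z => ∑' i, f i z) x = ∑' i, ballAvg μ r (f i) x := by
  unfold ballAvg
  rw [lintegral_tsum fun i => (hf i).aemeasurable, ENNReal.tsum_mul_left]

theorem ballAvg_rpow_le (h : DoublingOn μ Cd D) {r b : ℝ} (hr : 0 < r) (hb : 1 ≤ b)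
    {f : X → ℝ≥0∞} (hf : Measurable f) (x : X) :
    ballAvg μ r f x ^ b ≤ ballAvg μ r (fun z => f z ^ b) x := by
  have hb0 : 0 < b := by linarith
  have hm0 := (h.ball_pos x r hr).ne'
  have hmt := (h.ball_lt_top x r hr).ne
  rcases hb.eq_or_lt with rfl | hb1
  · simp
  have hconj : b.HolderConjugate (b / (b - 1)) := Real.HolderConjugate.conjExponent hb1
  have hH := ENNReal.lintegral_mul_le_Lp_mul_Lq (μ.restrict (Metric.ball x r)) hconj
    hf.aemeasurable (g := fun _ => 1) aemeasurable_const
  simp only [Pi.mul_apply, mul_one, ENNReal.one_rpow, lintegral_const, one_mul,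
    Measure.restrict_apply_univ] at hH
  unfold ballAvg
  set m := μ (Metric.ball x r)
  calc (m⁻¹ * ∫⁻ z in Metric.ball x r, f z ∂μ) ^ b
      ≤ (m⁻¹ * ((∫⁻ z in Metric.ball x r, f z ^ b ∂μ) ^ (1 / b) * m ^ (1 / (b / (b - 1))))) ^ b := by
        gcongr
    _ = m ^ (-b + (b - 1)) * ∫⁻ z in Metric.ball x r, f z ^ b ∂μ := by
        rw [ENNReal.mul_rpow_of_nonneg _ _ hb0.le, ENNReal.mul_rpow_of_nonneg _ _ hb0.le,
          ← ENNReal.rpow_mul, ← ENNReal.rpow_mul, one_div_mul_cancel hb0.ne', ENNReal.rpow_one,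
          ENNReal.inv_rpow, ← ENNReal.rpow_neg, ENNReal.rpow_add _ _ hm0 hmt]
        have : 1 / (b / (b - 1)) * b = b - 1 := by
          rw [one_div_div]; field_simp
        rw [this]; ring
    _ = _ := by
        rw [show -b + (b - 1) = -1 by ring, ENNReal.rpow_neg_one]

variable [OpensMeasurableSpace X] [SecondCountableTopology X]

theorem measurableSet_dist_lt (r : ℝ) : MeasurableSet {p : X × X | dist p.2 p.1 < r} :=
  (isOpen_lt (by fun_prop) continuous_const).measurableSet

theorem measurable_lintegral_ball [SFinite μ] {f : X → ℝ≥0∞} (hf : Measurable f) (r : ℝ) :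
    Measurable fun x => ∫⁻ z in Metric.ball x r, f z ∂μ := by
  have : (fun x => ∫⁻ z in Metric.ball x r, f z ∂μ) = fun x =>
      ∫⁻ z, {p : X × X | dist p.2 p.1 < r}.indicator (fun p => f p.2) (x, z) ∂μ := by
    ext x
    rw [← lintegral_indicator Metric.isOpen_ball.measurableSet]
    rfl
  rw [this]
  exact Measurable.lintegral_prod_right'
    ((hf.comp measurable_snd).indicator (measurableSet_dist_lt r))

theorem measurable_measure_ball [SFinite μ] (r : ℝ) :
    Measurable fun x => μ (Metric.ball x r) := by
  simpa using measurable_lintegral_ball (μ := μ) (f := fun _ => 1) measurable_const r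

theorem measurable_ballAvg [SFinite μ] {f : X → ℝ≥0∞} (hf : Measurable f) (r : ℝ) :
    Measurable (ballAvg μ r f) :=
  (measurable_measure_ball r).inv.mul (measurable_lintegral_ball hf r)

theorem measurable_maxFn [SFinite μ] {f : X → ℝ≥0∞} (hf : Measurable f) (r : ℤ → ℝ) :
    Measurable (maxFn μ r f) := Measurable.iSup fun k => measurable_ballAvg hf (r k)

theorem lintegral_ballAvg_mul_le [SFinite μ] (h : DoublingOn μ Cd D) {r : ℝ} (hr : 0 < r)
    {f w : X → ℝ≥0∞} (hf : Measurable f) (hw : Measurable w) :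
    ∫⁻ x, ballAvg μ r f x * w x ∂μ ≤
      Cd * ENNReal.ofReal (2 ^ D) * ∫⁻ x, f x * ballAvg μ r w x ∂μ := by
  set S := {p : X × X | dist p.2 p.1 < r} with hS
  have hSm : MeasurableSet S := measurableSet_dist_lt r
  have hC : Cd * ENNReal.ofReal (2 ^ D) ≠ ∞ := ENNReal.mul_ne_top h.const_ne_top (by simp)
  have hVm := measurable_measure_ball (μ := μ) r
  calc ∫⁻ x, ballAvg μ r f x * w x ∂μ
      = ∫⁻ x, ∫⁻ z, S.indicator (fun p => (μ (Metric.ball p.1 r))⁻¹ * f p.2 * w p.1) (x, z) ∂μ ∂μ := by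
        refine lintegral_congr fun x => ?_
        rw [ballAvg, ← lintegral_indicator Metric.isOpen_ball.measurableSet, mul_right_comm,
          ← lintegral_const_mul _ (hf.indicator Metric.isOpen_ball.measurableSet)]
        refine lintegral_congr fun z => ?_
        by_cases hz : dist z x < r
        · rw [Set.indicator_of_mem (show (x, z) ∈ S from hz), Set.indicator_of_mem (by exact hz)]
          ring
        · rw [Set.indicator_of_notMem (show (x, z) ∉ S from hz),
            Set.indicator_of_notMem (by exact hz), mul_zero]
    _ = ∫⁻ z, ∫⁻ x, S.indicator (fun p => (μ (Metric.ball p.1 r))⁻¹ * f p.2 * w p.1) (x, z) ∂μ ∂μ := by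
        rw [lintegral_lintegral_swap]
        refine Measurable.aemeasurable ?_
        exact Measurable.indicator (((hVm.comp measurable_fst).inv.mul (hf.comp measurable_snd)).mul
          (hw.comp measurable_fst)) hSm
    _ ≤ ∫⁻ z, Cd * ENNReal.ofReal (2 ^ D) * (f z * ballAvg μ r w z) ∂μ := by
        refine lintegral_mono fun z => ?_
        simp only
        rw [ballAvg, ← lintegral_indicator Metric.isOpen_ball.measurableSet, ← mul_assoc,
          ← mul_assoc, ← lintegral_const_mul _ (hw.indicator Metric.isOpen_ball.measurableSet)]
        refine lintegral_mono fun x => ?_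
        simp only
        by_cases hz : dist z x < r
        · rw [Set.indicator_of_mem (show (x, z) ∈ S from hz),
            Set.indicator_of_mem (by simpa [dist_comm] using hz)]
          have h1 : (μ (Metric.ball x r))⁻¹ ≤
              Cd * ENNReal.ofReal (2 ^ D) * (μ (Metric.ball z r))⁻¹ := by
            have h2 : μ (Metric.ball z r) ≤
                Cd * ENNReal.ofReal (2 ^ D) * μ (Metric.ball x r) := by
              have := h.ball_le_of_dist (x := z) (y := x) (R := r) (S := 2 * r) hr (by linarith)
                (by linarith)
              rwa [mul_div_cancel_right₀ _ hr.ne'] at this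
            have ha := (h.ball_pos x r hr).ne'
            have ha' := (h.ball_lt_top x r hr).ne
            have hb := (h.ball_pos z r hr).ne'
            have hb' := (h.ball_lt_top z r hr).ne
            rw [← div_eq_mul_inv, ENNReal.le_div_iff_mul_le (Or.inl hb) (Or.inl hb'),
              ENNReal.inv_mul_le_iff ha ha', mul_comm]
            exact h2
          calc (μ (Metric.ball x r))⁻¹ * f z * w x
              ≤ Cd * ENNReal.ofReal (2 ^ D) * (μ (Metric.ball z r))⁻¹ * f z * w x := by gcongr
            _ = _ := by ring
        · rw [Set.indicator_of_notMem (show (x, z) ∉ S from hz)]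
          exact zero_le
    _ = _ := lintegral_const_mul' _ _ hC

theorem lintegral_ballAvg_le [SFinite μ] (h : DoublingOn μ Cd D) {r : ℝ} (hr : 0 < r)
    {f : X → ℝ≥0∞} (hf : Measurable f) :
    ∫⁻ x, ballAvg μ r f x ∂μ ≤ Cd * ENNReal.ofReal (2 ^ D) * ∫⁻ x, f x ∂μ := by
  have := lintegral_ballAvg_mul_le h hr hf (w := fun _ => 1) measurable_const
  simp only [mul_one] at this
  refine this.trans ?_
  gcongr with x
  exact (mul_le_mul_right (ballAvg_const_le r 1 x) _).trans_eq (mul_one _)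

theorem maxFn_weak_type_of_radii_le (h : DoublingOn μ Cd D) {r : ℤ → ℝ} (hr : ∀ k, 0 < r k)
    {f : X → ℝ≥0∞} (τ : ℝ≥0∞) (R₀ : ℝ) :
    τ * μ {x | ∃ k, r k ≤ R₀ ∧ τ < ballAvg μ (r k) f x} ≤
      Cd * ENNReal.ofReal (5 ^ D) * ∫⁻ x, f x ∂μ := by
  set S := {x | ∃ k, r k ≤ R₀ ∧ τ < ballAvg μ (r k) f x} with hS
  have hk : ∀ x, ∃ k, x ∈ S → r k ≤ R₀ ∧ τ < ballAvg μ (r k) f x := fun x => by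
    by_cases hx : x ∈ S
    · obtain ⟨k, hk⟩ := hx
      exact ⟨k, fun _ => hk⟩
    · exact ⟨0, fun h => absurd h hx⟩
  choose κ hκ using hk
  obtain ⟨U, hUS, hUd, hU⟩ := Vitali.exists_disjoint_subfamily_covering_enlargement
    (fun x => Metric.ball x (r (κ x))) S (fun x => r (κ x)) 2 (by norm_num)
    (fun x _ => (hr _).le) R₀ (fun x hx => (hκ x hx).1) (fun x _ => ⟨x, Metric.mem_ball_self (hr _)⟩)
  have hUc : U.Countable := hUd.countable_of_isOpen (fun _ _ => Metric.isOpen_ball)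
    (fun x _ => ⟨x, Metric.mem_ball_self (hr _)⟩)
  have hcov : S ⊆ ⋃ b ∈ U, Metric.ball b (5 * r (κ b)) := by
    intro a ha
    obtain ⟨b, hb, ⟨z, hza, hzb⟩, hab⟩ := hU a ha
    simp only [Set.mem_iUnion]
    refine ⟨b, hb, ?_⟩
    simp only [Metric.mem_ball] at *
    have := dist_triangle a z b
    rw [dist_comm a z] at this
    linarith [hr (κ b)]
  have hball : ∀ b ∈ U, τ * μ (Metric.ball b (5 * r (κ b))) ≤
      Cd * ENNReal.ofReal (5 ^ D) * ∫⁻ x in Metric.ball b (r (κ b)), f x ∂μ := by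
    intro b hb
    have h1 := h.ball_le b (r (κ b)) (5 * r (κ b)) (hr _) (by linarith [hr (κ b)])
    rw [mul_div_cancel_right₀ _ (hr _).ne'] at h1
    have h2 := (hκ b (hUS hb)).2.le
    rw [ballAvg] at h2
    calc τ * μ (Metric.ball b (5 * r (κ b)))
        ≤ ((μ (Metric.ball b (r (κ b))))⁻¹ * ∫⁻ z in Metric.ball b (r (κ b)), f z ∂μ) *
          (Cd * ENNReal.ofReal (5 ^ D) * μ (Metric.ball b (r (κ b)))) := by gcongr
      _ = (Cd * ENNReal.ofReal (5 ^ D) * ∫⁻ z in Metric.ball b (r (κ b)), f z ∂μ) *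
          ((μ (Metric.ball b (r (κ b))))⁻¹ * μ (Metric.ball b (r (κ b)))) := by ring
      _ = _ := by
          rw [ENNReal.inv_mul_cancel (h.ball_pos _ _ (hr _)).ne' (h.ball_lt_top _ _ (hr _)).ne,
            mul_one]
  have := hUc.to_subtype
  calc τ * μ S ≤ τ * ∑' b : U, μ (Metric.ball (b : X) (5 * r (κ b))) := by
        gcongr
        exact (measure_mono hcov).trans (measure_biUnion_le μ hUc _)
    _ = ∑' b : U, τ * μ (Metric.ball (b : X) (5 * r (κ b))) := ENNReal.tsum_mul_left.symm
    _ ≤ ∑' b : U, Cd * ENNReal.ofReal (5 ^ D) *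
          ∫⁻ x in Metric.ball (b : X) (r (κ b)), f x ∂μ :=
        ENNReal.tsum_le_tsum fun b => hball b b.2
    _ = Cd * ENNReal.ofReal (5 ^ D) *
          ∑' b : U, ∫⁻ x in Metric.ball (b : X) (r (κ b)), f x ∂μ := ENNReal.tsum_mul_left
    _ = Cd * ENNReal.ofReal (5 ^ D) *
          ∫⁻ x in ⋃ b ∈ U, Metric.ball (b : X) (r (κ b)), f x ∂μ := by
        rw [lintegral_biUnion hUc (fun b _ => Metric.isOpen_ball.measurableSet) hUd]
    _ ≤ _ := by
        gcongr
        exact Measure.restrict_le_self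

theorem maxFn_weak_type (h : DoublingOn μ Cd D) {r : ℤ → ℝ} (hr : ∀ k, 0 < r k)
    (f : X → ℝ≥0∞) (τ : ℝ≥0∞) :
    τ * μ {x | τ < maxFn μ r f x} ≤ Cd * ENNReal.ofReal (5 ^ D) * ∫⁻ x, f x ∂μ := by
  have hU : {x | τ < maxFn μ r f x} =
      ⋃ n : ℕ, {x | ∃ k, r k ≤ (n : ℝ) ∧ τ < ballAvg μ (r k) f x} := by
    ext x
    simp only [Set.mem_ofPred_eq, Set.mem_iUnion, maxFn, lt_iSup_iff]
    constructor
    · rintro ⟨k, hk⟩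
      obtain ⟨n, hn⟩ := exists_nat_ge (r k)
      exact ⟨n, k, hn, hk⟩
    · rintro ⟨n, k, -, hk⟩
      exact ⟨k, hk⟩
  have hmono : Monotone fun n : ℕ => {x | ∃ k, r k ≤ (n : ℝ) ∧ τ < ballAvg μ (r k) f x} := by
    rintro m n hmn x ⟨k, hk, hx⟩
    exact ⟨k, hk.trans (by exact_mod_cast hmn), hx⟩
  rw [hU, hmono.measure_iUnion, ENNReal.mul_iSup]
  exact iSup_le fun n => maxFn_weak_type_of_radii_le h hr τ n

end BallAverages

theorem rpow_le_tsum_dyadic (F : ℝ≥0∞) {P : ℝ} (hP : 0 < P) :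
    F ^ P ≤ ∑' n : ℤ, (2 : ℝ≥0∞) ^ (((n : ℝ) + 1) * P) * (if (2 : ℝ≥0∞) ^ (n : ℝ) < F then 1 else 0) := by
  rcases eq_or_ne F 0 with rfl | h0
  · simp [ENNReal.zero_rpow_of_pos hP]
  rcases eq_or_ne F ∞ with rfl | ht
  · rw [ENNReal.top_rpow_of_pos hP]
    refine (ENNReal.tsum_const_eq_top_of_ne_zero (α := ℕ) one_ne_zero).ge.trans ?_
    refine le_trans ?_ (ENNReal.tsum_comp_le_tsum_of_injective Nat.cast_injective
      (fun n : ℤ => (2 : ℝ≥0∞) ^ (((n : ℝ) + 1) * P) * (if (2 : ℝ≥0∞) ^ (n : ℝ) < ∞ then 1 else 0)))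
    refine ENNReal.tsum_le_tsum fun n => ?_
    have : (2 : ℝ≥0∞) ^ (((n : ℤ) : ℝ)) < ∞ := ENNReal.rpow_lt_top_of_nonneg (by positivity) (by simp)
    simp only [this, if_true, mul_one]
    exact ENNReal.one_le_rpow (by norm_num) (by push_cast; positivity)
  · obtain ⟨n, hn1, hn2⟩ := ENNReal.exists_mem_Ioc_zpow h0 ht (y := 2) (by norm_num) (by simp)
    refine le_trans ?_ (ENNReal.le_tsum n)
    have h1 : (2 : ℝ≥0∞) ^ (n : ℝ) < F := by rwa [ENNReal.rpow_intCast]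
    rw [if_pos h1, mul_one, ENNReal.rpow_mul]
    refine ENNReal.rpow_le_rpow (hn2.trans_eq ?_) hP.le
    rw [← ENNReal.rpow_intCast]; push_cast; rfl

theorem tsum_dyadic_lt_le {r : ℝ} (hr : 0 < r) : ∃ C : ℝ≥0∞, C ≠ ∞ ∧ ∀ F : ℝ≥0∞,
    F * ∑' n : ℤ, (2 : ℝ≥0∞) ^ ((n : ℝ) * r) * (if (2 : ℝ≥0∞) ^ (n : ℝ) < F then 1 else 0) ≤
      C * F ^ (r + 1) := by
  have hη : (2 : ℝ≥0∞) ^ (-r) < 1 := ENNReal.rpow_lt_one_of_one_lt_of_neg (by norm_num) (by linarith)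
  refine ⟨∑' i : ℕ, ((2 : ℝ≥0∞) ^ (-r)) ^ i, tsum_geometric_ne_top hη, fun F => ?_⟩
  rcases eq_or_ne F 0 with rfl | h0
  · simp
  rcases eq_or_ne F ∞ with rfl | ht
  · rw [ENNReal.top_rpow_of_pos (by linarith), ENNReal.mul_top]
    · exact le_top
    · intro h
      have := ENNReal.tsum_eq_zero.1 h 0
      simp at this
  obtain ⟨N, hN1, hN2⟩ := ENNReal.exists_mem_Ioc_zpow h0 ht (y := 2) (by norm_num) (by simp)
  rw [← ENNReal.rpow_intCast] at hN1 hN2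
  rw [ENNReal.rpow_add _ _ h0 ht, ENNReal.rpow_one, mul_comm F, ← mul_assoc]
  gcongr
  have hinj : Function.Injective fun i : ℕ => N - (i : ℤ) := fun i j hij => by
    simpa using hij
  rw [← hinj.tsum_eq]
  · rw [← ENNReal.tsum_mul_right]
    refine ENNReal.tsum_le_tsum fun i => ?_
    calc _ ≤ (2 : ℝ≥0∞) ^ ((((N - (i : ℤ) : ℤ)) : ℝ) * r) * 1 := by gcongr; split_ifs <;> simp
      _ = ((2 : ℝ≥0∞) ^ (-r)) ^ i * ((2 : ℝ≥0∞) ^ (N : ℝ)) ^ r := by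
        rw [← ENNReal.rpow_natCast, ← ENNReal.rpow_mul, ← ENNReal.rpow_mul,
          ← ENNReal.rpow_add _ _ (by simp) (by simp), mul_one]
        congr 1; push_cast; ring
      _ ≤ _ := by gcongr
  · intro n hn
    simp only [Function.mem_support, ne_eq, mul_eq_zero, not_or, ite_eq_right_iff, one_ne_zero,
      imp_false, not_not] at hn
    have : n < N + 1 := by
      by_contra hcon
      push Not at hcon
      have h3 : (2 : ℝ≥0∞) ^ (((N + 1 : ℤ)) : ℝ) ≤ (2 : ℝ≥0∞) ^ (n : ℝ) :=
        ENNReal.rpow_le_rpow_of_exponent_le (by norm_num) (by exact_mod_cast hcon)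
      exact absurd (hn.2.trans_le (hN2.trans h3)) (lt_irrefl _)
    exact ⟨(N - n).toNat, by simp only; omega⟩

section FeffermanStein

theorem lintegral_tsum_mul {ι : Type*} [Countable ι] {μ : Measure X} {f : ι → X → ℝ≥0∞}
    (hf : ∀ k, Measurable (f k)) {w : X → ℝ≥0∞} (hw : Measurable w) :
    ∫⁻ x, (∑' k, f k x) * w x ∂μ = ∑' k, ∫⁻ x, f k x * w x ∂μ := by
  rw [← lintegral_tsum (f := fun k x => f k x * w x) fun k => ((hf k).mul hw).aemeasurable]
  simp_rw [ENNReal.tsum_mul_right]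

theorem lintegral_rpow_le_of_mul_le {μ : Measure X} [SigmaFinite μ] {r r' : ℝ}
    (hr : r.HolderConjugate r') {f : X → ℝ≥0∞} (hf : Measurable f) {K : ℝ≥0∞}
    (hK : ∀ w : X → ℝ≥0∞, Measurable w → ∫⁻ x, f x * w x ∂μ ≤ K * (∫⁻ x, w x ^ r' ∂μ) ^ (1 / r')) :
    ∫⁻ x, f x ^ r ∂μ ≤ K ^ r := by
  set g : ℕ → X → ℝ≥0∞ := fun n => (spanningSets μ n).indicator fun x => min (f x) n with hg
  have hgm : ∀ n, Measurable (g n) := fun n =>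
    (hf.min measurable_const).indicator (measurableSet_spanningSets μ n)
  have hgf : ∀ n x, g n x ≤ f x := fun n x => by
    exact (Set.indicator_le_self _ _ x).trans (min_le_left _ _)
  have hmono : Monotone g := fun m n hmn x => by
    refine Set.indicator_le_indicator_apply_of_subset ?_ ?_ |>.trans
      (Set.indicator_le_indicator ?_)
    · exact monotone_spanningSets μ hmn
    · exact zero_le
    · exact min_le_min le_rfl (by exact_mod_cast hmn)
  have hsup : ∀ x, f x ^ r = ⨆ n, g n x ^ r := fun x => by
    have h1 : f x = ⨆ n, g n x := by
      refine le_antisymm ?_ (iSup_le fun n => hgf n x)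
      refine le_of_forall_lt fun c hc => ?_
      obtain ⟨N, hN⟩ := ENNReal.exists_nat_gt (lt_top_of_lt hc).ne
      obtain ⟨M, hM⟩ := Set.mem_iUnion.1 ((iUnion_spanningSets μ).symm ▸ Set.mem_univ x)
      refine lt_of_lt_of_le ?_ (le_iSup _ (max N M))
      simp only [hg]
      rw [Set.indicator_of_mem (monotone_spanningSets μ (le_max_right N M) hM)]
      exact lt_min hc (hN.trans_le (by exact_mod_cast le_max_left N M))
    rw [h1]
    exact (ENNReal.orderIsoRpow r hr.pos).map_iSup _
  have hbound : ∀ n, ∫⁻ x, g n x ^ r ∂μ ≤ K ^ r := fun n => by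
    set I := ∫⁻ x, g n x ^ r ∂μ with hI
    have hIt : I ≠ ∞ := by
      have : I ≤ ∫⁻ x, (spanningSets μ n).indicator (fun _ => (n : ℝ≥0∞) ^ r) x ∂μ := by
        refine lintegral_mono fun x => ?_
        by_cases hx : x ∈ spanningSets μ n
        · simp only [hg, Set.indicator_of_mem hx]
          exact ENNReal.rpow_le_rpow (min_le_right _ _) hr.nonneg
        · simp [hg, Set.indicator_of_notMem hx, ENNReal.zero_rpow_of_pos hr.pos]
      refine ne_top_of_le_ne_top ?_ this
      rw [lintegral_indicator (measurableSet_spanningSets μ n), setLIntegral_const]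
      exact ENNReal.mul_ne_top (ENNReal.rpow_ne_top_of_nonneg hr.nonneg (by simp))
        (measure_spanningSets_lt_top μ n).ne
    rcases eq_or_ne I 0 with h0 | h0
    · rw [h0]; exact zero_le
    have h1 : I ≤ K * I ^ (1 / r') := by
      have h2 := hK (fun x => g n x ^ (r - 1)) ((hgm n).pow_const _)
      have h3 : ∀ x, (g n x ^ (r - 1)) ^ r' = g n x ^ r := fun x => by
        rw [← ENNReal.rpow_mul, hr.sub_one_mul_conj]
      simp only [h3] at h2
      refine le_trans (lintegral_mono fun x => ?_) h2
      calc g n x ^ r = g n x ^ (1 + (r - 1)) := by ring_nf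
        _ = g n x * g n x ^ (r - 1) := by
          rw [ENNReal.rpow_add_of_nonneg _ _ zero_le_one (by linarith [hr.lt]), ENNReal.rpow_one]
        _ ≤ f x * g n x ^ (r - 1) := by gcongr; exact hgf n x
    have h4 : I ^ (1 / r) ≤ K := by
      have h5 : I = I ^ (1 / r) * I ^ (1 / r') := by
        rw [← ENNReal.rpow_add _ _ h0 hIt, one_div, one_div, hr.inv_add_inv_eq_one, ENNReal.rpow_one]
      have h6 : I ^ (1 / r') ≠ 0 := by simp [ENNReal.rpow_eq_zero_iff, h0, hIt]
      have h7 : I ^ (1 / r') ≠ ∞ := ENNReal.rpow_ne_top_of_nonneg (by have := hr.symm.pos; positivity) hIt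
      rw [h5] at h1
      rw [← h5] at h1
      have h8 : I ^ (1 / r) * I ^ (1 / r') ≤ K * I ^ (1 / r') := h5 ▸ h1
      exact (ENNReal.mul_le_mul_iff_left h6 h7).1 h8
    calc I = (I ^ (1 / r)) ^ r := by
          rw [← ENNReal.rpow_mul, one_div_mul_cancel hr.ne_zero, ENNReal.rpow_one]
      _ ≤ K ^ r := ENNReal.rpow_le_rpow h4 hr.nonneg
  simp only [hsup]
  rw [lintegral_iSup (fun n => (hgm n).pow_const r)
    (fun m n hmn x => ENNReal.rpow_le_rpow (hmono hmn x) hr.nonneg)]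
  exact iSup_le hbound

variable [PseudoMetricSpace X] [OpensMeasurableSpace X] [SecondCountableTopology X]
  {μ : Measure X} {Cd : ℝ≥0∞} {D : ℝ}

theorem maxFn_strong_type (h : DoublingOn μ Cd D) {r : ℤ → ℝ} (hr : ∀ k, 0 < r k) {P : ℝ}
    (hP : 1 < P) : ∃ C : ℝ≥0∞, C ≠ ∞ ∧ ∀ f : X → ℝ≥0∞, Measurable f →
      ∫⁻ x, maxFn μ r f x ^ P ∂μ ≤ C * ∫⁻ x, f x ^ P ∂μ := by
  have := h.sigmaFinite
  obtain ⟨C, hC, hCF⟩ := tsum_dyadic_lt_le (r := P - 1) (by linarith)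
  set A := Cd * ENNReal.ofReal (5 ^ D) with hA
  have hAt : A ≠ ∞ := ENNReal.mul_ne_top h.const_ne_top (by simp)
  refine ⟨A * 2 ^ (2 * P) * C, by finiteness, fun f hf => ?_⟩
  have hMm := measurable_maxFn (μ := μ) hf r
  set c : ℤ → ℝ≥0∞ := fun n => (2 : ℝ≥0∞) ^ (n : ℝ) with hc
  have hcm : ∀ n, MeasurableSet {x | c n < f x} := fun n => measurableSet_lt measurable_const hf
  have hc0 : ∀ n, c n ≠ 0 := fun n => (ENNReal.rpow_pos (by simp) (by simp)).ne'
  have hct : ∀ n, c n ≠ ∞ := fun n => ENNReal.rpow_ne_top_of_ne_zero (by simp) (by simp)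
  have hlevel : ∀ n : ℤ, μ {x | c (n + 1) < maxFn μ r f x} ≤
      (c n)⁻¹ * (A * ∫⁻ x, f x * (if c n < f x then 1 else 0) ∂μ) := fun n => by
    set f₁ : X → ℝ≥0∞ := fun x => f x * (if c n < f x then 1 else 0) with hf₁
    have hf₁m : Measurable f₁ := hf.mul (Measurable.ite (hcm n) measurable_const measurable_const)
    have hsub : {x | c (n + 1) < maxFn μ r f x} ⊆ {x | c n < maxFn μ r f₁ x} := by
      intro x hx
      simp only [Set.mem_ofPred_eq, maxFn, lt_iSup_iff] at hx ⊢
      obtain ⟨k, hk⟩ := hx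
      refine ⟨k, ?_⟩
      have h1 : ballAvg μ (r k) f x ≤ ballAvg μ (r k) f₁ x + c n := by
        calc ballAvg μ (r k) f x ≤ ballAvg μ (r k) (fun z => f₁ z + c n) x :=
              ballAvg_mono (fun z => by
                simp only [hf₁]
                split_ifs with hz
                · simp
                · simpa using hz) x
          _ = ballAvg μ (r k) f₁ x + ballAvg μ (r k) (fun _ => c n) x := ballAvg_add hf₁m x
          _ ≤ _ := by gcongr; exact ballAvg_const_le _ _ _
      have h2 : c (n + 1) = c n + c n := by
        simp only [hc]
        rw [← two_mul]
        push_cast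
        rw [ENNReal.rpow_add _ _ (by simp) (by simp), ENNReal.rpow_one, mul_comm]
      rw [h2] at hk
      exact (ENNReal.add_lt_add_iff_right (hct n)).1 (hk.trans_le h1)
    rw [mul_comm, ← div_eq_mul_inv, ENNReal.le_div_iff_mul_le (Or.inl (hc0 n)) (Or.inl (hct n)),
      mul_comm]
    exact (mul_le_mul_right (measure_mono hsub) _).trans (maxFn_weak_type h hr f₁ (c n))
  calc ∫⁻ x, maxFn μ r f x ^ P ∂μ
      ≤ ∫⁻ x, ∑' n : ℤ, (2 : ℝ≥0∞) ^ (((n : ℝ) + 1) * P) *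
          (if c n < maxFn μ r f x then 1 else 0) ∂μ :=
        lintegral_mono fun x => rpow_le_tsum_dyadic _ (by linarith)
    _ = ∑' n : ℤ, (2 : ℝ≥0∞) ^ (((n : ℝ) + 1) * P) * μ {x | c n < maxFn μ r f x} := by
        have hm : ∀ n, MeasurableSet {x | c n < maxFn μ r f x} := fun n =>
          measurableSet_lt measurable_const hMm
        rw [lintegral_tsum fun n => ((Measurable.ite (hm n) measurable_const
          measurable_const).const_mul _).aemeasurable]
        refine tsum_congr fun n => ?_
        rw [lintegral_const_mul _ (Measurable.ite (hm n) measurable_const measurable_const)]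
        congr 1
        rw [← lintegral_indicator_one (hm n)]
        refine lintegral_congr fun x => ?_
        by_cases hx : c n < maxFn μ r f x <;> simp [Set.indicator, hx]
    _ = ∑' n : ℤ, (2 : ℝ≥0∞) ^ (((n : ℝ) + 2) * P) * μ {x | c (n + 1) < maxFn μ r f x} := by
        rw [← (Equiv.addRight (1 : ℤ)).tsum_eq]
        refine tsum_congr fun n => ?_
        simp only [Equiv.coe_addRight]
        push_cast
        ring_nf
    _ ≤ ∑' n : ℤ, (2 : ℝ≥0∞) ^ (((n : ℝ) + 2) * P) *
          ((c n)⁻¹ * (A * ∫⁻ x, f x * (if c n < f x then 1 else 0) ∂μ)) := by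
        gcongr with n; exact hlevel n
    _ = ∑' n : ℤ, A * 2 ^ (2 * P) * ((2 : ℝ≥0∞) ^ ((n : ℝ) * (P - 1)) *
          ∫⁻ x, f x * (if c n < f x then 1 else 0) ∂μ) := by
        refine tsum_congr fun n => ?_
        have : (2 : ℝ≥0∞) ^ (((n : ℝ) + 2) * P) * (c n)⁻¹ =
            2 ^ (2 * P) * (2 : ℝ≥0∞) ^ ((n : ℝ) * (P - 1)) := by
          rw [hc, ← ENNReal.rpow_neg, ← ENNReal.rpow_add _ _ (by simp) (by simp),
            ← ENNReal.rpow_add _ _ (by simp) (by simp)]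
          congr 1; ring
        rw [← mul_assoc, this]; ring
    _ = A * 2 ^ (2 * P) * ∫⁻ x, f x * ∑' n : ℤ, (2 : ℝ≥0∞) ^ ((n : ℝ) * (P - 1)) *
          (if c n < f x then 1 else 0) ∂μ := by
        rw [ENNReal.tsum_mul_left]
        congr 1
        have hm : ∀ n, Measurable fun x => f x * (if c n < f x then (1 : ℝ≥0∞) else 0) := fun n =>
          hf.mul (Measurable.ite (hcm n) measurable_const measurable_const)
        simp_rw [← lintegral_const_mul _ (hm _)]
        rw [← lintegral_tsum fun n => ((hm n).const_mul _).aemeasurable]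
        refine lintegral_congr fun x => ?_
        rw [← ENNReal.tsum_mul_left]
        exact tsum_congr fun n => by ring
    _ ≤ A * 2 ^ (2 * P) * ∫⁻ x, C * f x ^ P ∂μ := by
        refine mul_le_mul_right (lintegral_mono fun x => ?_) _
        have := hCF (f x)
        rwa [sub_add_cancel] at this
    _ = _ := by rw [lintegral_const_mul' _ _ hC]; ring

theorem lintegral_tsum_ballAvg_rpow_le_of_lt (h : DoublingOn μ Cd D) {r : ℤ → ℝ}
    (hr : ∀ k, 0 < r k) {P b : ℝ} (hb : 1 < b) (hbP : b < P) :
    ∃ C : ℝ≥0∞, C ≠ ∞ ∧ ∀ f : ℤ → X → ℝ≥0∞, (∀ k, Measurable (f k)) →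
      ∫⁻ x, (∑' k, ballAvg μ (r k) (f k) x ^ b) ^ (P / b) ∂μ ≤
        C * ∫⁻ x, (∑' k, f k x ^ b) ^ (P / b) ∂μ := by
  have := h.sigmaFinite
  have hb0 : 0 < b := by linarith
  have hθ : 1 < P / b := (one_lt_div hb0).2 hbP
  have hconj : (P / b).HolderConjugate (P / b / (P / b - 1)) := Real.HolderConjugate.conjExponent hθ
  set θ := P / b
  set θ' := θ / (θ - 1)
  obtain ⟨C, hC, hM⟩ := maxFn_strong_type h hr (P := θ') hconj.symm.lt
  set A := Cd * ENNReal.ofReal (2 ^ D) with hA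
  have hAt : A ≠ ∞ := ENNReal.mul_ne_top h.const_ne_top (by simp)
  have hθ0 := hconj.nonneg
  have hθ'0 := hconj.symm.nonneg
  refine ⟨(A * C ^ (1 / θ')) ^ θ, ENNReal.rpow_ne_top_of_nonneg hθ0
    (ENNReal.mul_ne_top hAt (ENNReal.rpow_ne_top_of_nonneg (by positivity) hC)), fun f hf => ?_⟩
  have hfb : ∀ k, Measurable fun x => f k x ^ b := fun k => (hf k).pow_const b
  have hH : Measurable fun x => ∑' k, f k x ^ b := Measurable.tsum hfb
  have ham : ∀ k, Measurable fun x => ballAvg μ (r k) (f k) x ^ b := fun k =>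
    (measurable_ballAvg (hf k) (r k)).pow_const b
  set J := ∫⁻ x, (∑' k, f k x ^ b) ^ θ ∂μ with hJ
  refine (lintegral_rpow_le_of_mul_le hconj (Measurable.tsum ham)
    (K := A * C ^ (1 / θ') * J ^ (1 / θ)) fun w hw => ?_).trans_eq ?_
  · calc ∫⁻ x, (∑' k, ballAvg μ (r k) (f k) x ^ b) * w x ∂μ
        = ∑' k, ∫⁻ x, ballAvg μ (r k) (f k) x ^ b * w x ∂μ := by
          exact lintegral_tsum_mul ham hw
      _ ≤ ∑' k, ∫⁻ x, ballAvg μ (r k) (fun z => f k z ^ b) x * w x ∂μ := by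
          gcongr with k x
          exact ballAvg_rpow_le h (hr k) hb.le (hf k) x
      _ ≤ ∑' k, A * ∫⁻ x, f k x ^ b * ballAvg μ (r k) w x ∂μ := by
          gcongr with k
          exact lintegral_ballAvg_mul_le h (hr k) (hfb k) hw
      _ ≤ ∑' k, A * ∫⁻ x, f k x ^ b * maxFn μ r w x ∂μ := by
          gcongr with k x
          exact ballAvg_le_maxFn r w k x
      _ = A * ∫⁻ x, (∑' k, f k x ^ b) * maxFn μ r w x ∂μ := by
          rw [ENNReal.tsum_mul_left, lintegral_tsum_mul hfb (measurable_maxFn hw r)]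
      _ ≤ A * (J ^ (1 / θ) * (∫⁻ x, maxFn μ r w x ^ θ' ∂μ) ^ (1 / θ')) := by
          gcongr
          exact ENNReal.lintegral_mul_le_Lp_mul_Lq μ hconj hH.aemeasurable
            (measurable_maxFn hw r).aemeasurable
      _ ≤ A * (J ^ (1 / θ) * (C * ∫⁻ x, w x ^ θ' ∂μ) ^ (1 / θ')) := by
          gcongr
          exact hM w hw
      _ = _ := by
          rw [ENNReal.mul_rpow_of_nonneg _ _ (by positivity)]
          ring
  · rw [ENNReal.mul_rpow_of_nonneg _ _ hθ0, ← ENNReal.rpow_mul, one_div_mul_cancel hconj.ne_zero,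
      ENNReal.rpow_one]

theorem lintegral_tsum_ballAvg_rpow_le_of_gt (h : DoublingOn μ Cd D) {r : ℤ → ℝ}
    (hr : ∀ k, 0 < r k) {P b : ℝ} (hP : 1 < P) (hPb : P < b) :
    ∃ C : ℝ≥0∞, C ≠ ∞ ∧ ∀ f : ℤ → X → ℝ≥0∞, (∀ k, Measurable (f k)) →
      ∫⁻ x, (∑' k, ballAvg μ (r k) (f k) x ^ b) ^ (P / b) ∂μ ≤
        C * ∫⁻ x, (∑' k, f k x ^ b) ^ (P / b) ∂μ := by
  have := h.sigmaFinite
  have hb : 1 < b := hP.trans hPb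
  have hb0 : 0 < b := by linarith
  have hP0 : 0 < P := by linarith
  have hcP : P.HolderConjugate (P / (P - 1)) := Real.HolderConjugate.conjExponent hP
  have hcb : b.HolderConjugate (b / (b - 1)) := Real.HolderConjugate.conjExponent hb
  have hlt : b / (b - 1) < P / (P - 1) := by
    rw [div_lt_div_iff₀ (by linarith) (by linarith)]; nlinarith
  set P' := P / (P - 1)
  set b' := b / (b - 1)
  have hP'0 : 0 < P' := hcP.symm.pos
  have hb'0 : 0 < b' := hcb.symm.pos
  obtain ⟨C, hC, hM⟩ := lintegral_tsum_ballAvg_rpow_le_of_lt h hr hcb.symm.lt hlt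
  set A := Cd * ENNReal.ofReal (2 ^ D) with hA
  have hAt : A ≠ ∞ := ENNReal.mul_ne_top h.const_ne_top (by simp)
  refine ⟨1 + (A * C ^ (1 / P')) ^ P, ENNReal.add_ne_top.2 ⟨by simp,
    ENNReal.rpow_ne_top_of_nonneg hP0.le
    (ENNReal.mul_ne_top hAt (ENNReal.rpow_ne_top_of_nonneg (by positivity) hC))⟩, fun f hf => ?_⟩
  set J := ∫⁻ x, (∑' k, f k x ^ b) ^ (P / b) ∂μ with hJ
  rcases eq_or_ne J ∞ with hJt | hJt
  · rw [hJt, ENNReal.mul_top (by simp)]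
    exact le_top
  set a : ℤ → X → ℝ≥0∞ := fun k => ballAvg μ (r k) (f k) with ha
  have ham : ∀ k, Measurable (a k) := fun k => measurable_ballAvg (hf k) (r k)
  have hafin : ∀ k, ∀ᵐ x ∂μ, a k x ≠ ∞ := fun k => by
    have h1 : ∫⁻ x, a k x ^ P ∂μ ≤ A * J := by
      calc ∫⁻ x, a k x ^ P ∂μ ≤ ∫⁻ x, ballAvg μ (r k) (fun z => f k z ^ P) x ∂μ :=
            lintegral_mono fun x => ballAvg_rpow_le h (hr k) hP.le (hf k) x
        _ ≤ A * ∫⁻ x, f k x ^ P ∂μ := lintegral_ballAvg_le h (hr k) ((hf k).pow_const P)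
        _ ≤ A * J := by
            refine mul_le_mul_right (lintegral_mono fun x => ?_) _
            calc f k x ^ P = (f k x ^ b) ^ (P / b) := by
                  rw [← ENNReal.rpow_mul, mul_div_cancel₀ _ hb0.ne']
              _ ≤ _ := ENNReal.rpow_le_rpow (ENNReal.le_tsum k) (by positivity)
    have h2 := ae_lt_top ((ham k).pow_const P)
      (ne_top_of_le_ne_top (ENNReal.mul_ne_top hAt hJt) h1)
    filter_upwards [h2] with x hx hcon
    rw [hcon, ENNReal.top_rpow_of_pos hP0] at hx
    exact lt_irrefl _ hx
  have hfinset : ∀ s : Finset ℤ, ∫⁻ x, (∑ k ∈ s, a k x ^ b) ^ (P / b) ∂μ ≤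
      (A * C ^ (1 / P')) ^ P * J := fun s => by
    set T : X → ℝ≥0∞ := fun x => ∑ k ∈ s, a k x ^ b with hT
    have hTm : Measurable T := Finset.measurable_sum s fun k _ => (ham k).pow_const b
    have hTfin : ∀ᵐ x ∂μ, T x ≠ ∞ := by
      filter_upwards [ae_all_iff.2 hafin] with x hx
      exact ENNReal.sum_ne_top.2 fun k _ => ENNReal.rpow_ne_top_of_nonneg hb0.le (hx k)
    have hrw : ∀ x, T x ^ (P / b) = (T x ^ (1 / b)) ^ P := fun x => by
      rw [← ENNReal.rpow_mul]; congr 1; ring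
    change ∫⁻ x, T x ^ (P / b) ∂μ ≤ _
    simp only [hrw]
    refine (lintegral_rpow_le_of_mul_le hcP (hTm.pow_const _)
      (K := A * C ^ (1 / P') * J ^ (1 / P)) fun w hw => ?_).trans_eq ?_
    · set v : ℤ → X → ℝ≥0∞ := fun k x =>
        if k ∈ s then a k x ^ (b - 1) * T x ^ ((1 - b) / b) * w x else 0 with hv
      have hvm : ∀ k, Measurable (v k) := fun k => by
        simp only [hv]
        split_ifs
        · exact (((ham k).pow_const _).mul (hTm.pow_const _)).mul hw
        · exact measurable_const
      have hBm : ∀ k, Measurable (ballAvg μ (r k) (v k)) := fun k => measurable_ballAvg (hvm k) _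
      calc ∫⁻ x, T x ^ (1 / b) * w x ∂μ
          ≤ ∫⁻ x, ∑ k ∈ s, a k x * v k x ∂μ := by
            refine lintegral_mono_ae ?_
            filter_upwards [hTfin] with x hx
            rcases eq_or_ne (T x) 0 with h0 | h0
            · rw [h0, ENNReal.zero_rpow_of_pos (by positivity), zero_mul]; exact zero_le
            refine le_of_eq ?_
            calc T x ^ (1 / b) * w x = T x * T x ^ ((1 - b) / b) * w x := by
                  nth_rewrite 2 [← ENNReal.rpow_one (T x)]
                  rw [← ENNReal.rpow_add _ _ h0 hx]
                  congr 2
                  field_simp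
                  ring
              _ = ∑ k ∈ s, a k x ^ b * (T x ^ ((1 - b) / b) * w x) := by
                  rw [← Finset.sum_mul, mul_assoc]
              _ = _ := by
                  refine Finset.sum_congr rfl fun k hk => ?_
                  simp only [hv, if_pos hk]
                  have : a k x ^ b = a k x * a k x ^ (b - 1) := by
                    nth_rewrite 2 [← ENNReal.rpow_one (a k x)]
                    rw [← ENNReal.rpow_add_of_nonneg _ _ zero_le_one (by linarith)]
                    congr 1; ring
                  rw [this]; ring
        _ = ∑ k ∈ s, ∫⁻ x, a k x * v k x ∂μ := lintegral_finsetSum _ fun k _ => (ham k).mul (hvm k)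
        _ ≤ ∑ k ∈ s, A * ∫⁻ x, f k x * ballAvg μ (r k) (v k) x ∂μ := by
            gcongr with k
            exact lintegral_ballAvg_mul_le h (hr k) (hf k) (hvm k)
        _ = A * ∫⁻ x, ∑ k ∈ s, f k x * ballAvg μ (r k) (v k) x ∂μ := by
            rw [← Finset.mul_sum]
            exact congrArg _ (lintegral_finsetSum _ fun k _ => (hf k).mul (hBm k)).symm
        _ ≤ A * ∫⁻ x, (∑' k, f k x ^ b) ^ (1 / b) *
              (∑' k, ballAvg μ (r k) (v k) x ^ b') ^ (1 / b') ∂μ := by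
            gcongr with x
            refine (ENNReal.inner_le_Lp_mul_Lq s _ _ hcb).trans ?_
            gcongr
            · exact ENNReal.sum_le_tsum s
            · exact ENNReal.sum_le_tsum s
        _ ≤ A * ((∫⁻ x, ((∑' k, f k x ^ b) ^ (1 / b)) ^ P ∂μ) ^ (1 / P) *
              (∫⁻ x, ((∑' k, ballAvg μ (r k) (v k) x ^ b') ^ (1 / b')) ^ P' ∂μ) ^ (1 / P')) := by
            gcongr
            exact ENNReal.lintegral_mul_le_Lp_mul_Lq μ hcP
              ((Measurable.tsum fun k => (hf k).pow_const _).pow_const _).aemeasurable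
              ((Measurable.tsum fun k => (hBm k).pow_const _).pow_const _).aemeasurable
        _ = A * (J ^ (1 / P) *
              (∫⁻ x, (∑' k, ballAvg μ (r k) (v k) x ^ b') ^ (P' / b') ∂μ) ^ (1 / P')) := by
            simp_rw [← ENNReal.rpow_mul, one_div_mul_eq_div]
            rfl
        _ ≤ A * (J ^ (1 / P) * (C * ∫⁻ x, (∑' k, v k x ^ b') ^ (P' / b') ∂μ) ^ (1 / P')) := by
            gcongr
            exact hM v hvm
        _ ≤ A * (J ^ (1 / P) * (C * ∫⁻ x, w x ^ P' ∂μ) ^ (1 / P')) := by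
            have hb1 : (b - 1) * b' = b := hcb.sub_one_mul_conj
            gcongr with x
            have h1 : ∑' k, v k x ^ b' ≤ w x ^ b' := by
              rw [tsum_eq_sum (s := s) fun k hk => by
                simp [hv, if_neg hk, ENNReal.zero_rpow_of_pos hb'0]]
              calc ∑ k ∈ s, v k x ^ b' = ∑ k ∈ s, a k x ^ b * (T x ^ (-1 : ℝ) * w x ^ b') := by
                    refine Finset.sum_congr rfl fun k hk => ?_
                    simp only [hv, if_pos hk]
                    rw [ENNReal.mul_rpow_of_nonneg _ _ hb'0.le,
                      ENNReal.mul_rpow_of_nonneg _ _ hb'0.le, ← ENNReal.rpow_mul,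
                      ← ENNReal.rpow_mul, hb1, mul_assoc]
                    congr 3
                    rw [show (1 - b) / b * b' = -((b - 1) * b') / b by ring, hb1, neg_div,
                      div_self hb0.ne']
                _ = T x * (T x)⁻¹ * w x ^ b' := by
                    rw [← Finset.sum_mul, ENNReal.rpow_neg_one, ← mul_assoc]
                _ ≤ 1 * w x ^ b' := by gcongr; exact ENNReal.mul_inv_le_one _
                _ = _ := one_mul _
            calc _ ≤ (w x ^ b') ^ (P' / b') := ENNReal.rpow_le_rpow h1 (by positivity)
              _ = _ := by rw [← ENNReal.rpow_mul, mul_div_cancel₀ _ hb'0.ne']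
        _ = _ := by
            rw [ENNReal.mul_rpow_of_nonneg _ _ (by positivity)]
            ring
    · rw [ENNReal.mul_rpow_of_nonneg _ _ hP0.le, ← ENNReal.rpow_mul, one_div_mul_cancel hP0.ne',
        ENNReal.rpow_one]
  have hsup : ∀ x, (∑' k, a k x ^ b) ^ (P / b) = ⨆ s : Finset ℤ, (∑ k ∈ s, a k x ^ b) ^ (P / b) :=
    fun x => by
      rw [ENNReal.tsum_eq_iSup_sum]
      exact (ENNReal.orderIsoRpow (P / b) (by positivity)).map_iSup _
  calc ∫⁻ x, (∑' k, a k x ^ b) ^ (P / b) ∂μ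
      = ⨆ s : Finset ℤ, ∫⁻ x, (∑ k ∈ s, a k x ^ b) ^ (P / b) ∂μ := by
        simp_rw [hsup]
        refine lintegral_iSup_directed (fun s => ((Finset.measurable_sum s fun k _ =>
          (ham k).pow_const b).pow_const _).aemeasurable) (Monotone.directed_le fun s t hst x => ?_)
        exact ENNReal.rpow_le_rpow (Finset.sum_le_sum_of_subset hst) (by positivity)
    _ ≤ (A * C ^ (1 / P')) ^ P * J := iSup_le hfinset
    _ ≤ _ := by gcongr; exact le_add_self

/-- The Fefferman–Stein vector-valued inequality for averages over balls of prescribed radii. -/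
theorem fefferman_stein (h : DoublingOn μ Cd D) {r : ℤ → ℝ} (hr : ∀ k, 0 < r k) {P : ℝ}
    (hP : 1 < P) {b : ℝ≥0∞} (hb : 1 < b) :
    ∃ C : ℝ≥0∞, C ≠ ∞ ∧ ∀ f : ℤ → X → ℝ≥0∞, (∀ k, Measurable (f k)) →
      ∫⁻ x, (lqN b fun k => ballAvg μ (r k) (f k) x) ^ P ∂μ ≤
        C * ∫⁻ x, (lqN b fun k => f k x) ^ P ∂μ := by
  have := h.sigmaFinite
  by_cases hbt : b = ∞
  · subst hbt
    obtain ⟨C, hC, hM⟩ := maxFn_strong_type h hr hP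
    refine ⟨C, hC, fun f hf => ?_⟩
    simp only [lqN, if_true]
    refine le_trans (lintegral_mono fun x => ?_) (hM _ (Measurable.iSup hf))
    gcongr
    exact iSup_le fun k => (ballAvg_mono (fun z => le_iSup (fun k => f k z) k) x).trans
      (ballAvg_le_maxFn r _ k x)
  · have hb1 : 1 < b.toReal := by
      rw [← ENNReal.toReal_one]; exact (ENNReal.toReal_lt_toReal (by simp) hbt).2 hb
    have hrw : ∀ a : ℤ → ℝ≥0∞, lqN b a ^ P = (∑' k, a k ^ b.toReal) ^ (P / b.toReal) := fun a => by
      rw [lqN, if_neg hbt, ← ENNReal.rpow_mul, one_div_mul_eq_div]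
    simp only [hrw]
    rcases lt_trichotomy b.toReal P with hlt | heq | hgt
    · exact lintegral_tsum_ballAvg_rpow_le_of_lt h hr hb1 hlt
    · refine ⟨Cd * ENNReal.ofReal (2 ^ D), ENNReal.mul_ne_top h.const_ne_top (by simp),
        fun f hf => ?_⟩
      simp only [heq, div_self (show P ≠ 0 by linarith), ENNReal.rpow_one]
      rw [lintegral_tsum fun k => ((measurable_ballAvg (hf k) (r k)).pow_const P).aemeasurable,
        lintegral_tsum fun k => ((hf k).pow_const P).aemeasurable, ← ENNReal.tsum_mul_left]
      refine ENNReal.tsum_le_tsum fun k => ?_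
      exact (lintegral_mono fun x => ballAvg_rpow_le h (hr k) hP.le (hf k) x).trans
        (lintegral_ballAvg_le h (hr k) ((hf k).pow_const P))
    · exact lintegral_tsum_ballAvg_rpow_le_of_gt h hr hP hgt

end FeffermanStein

section Kernels

variable [PseudoMetricSpace X]

/-- `Ω` satisfies the measure density condition at scales at most one. -/
structure DensityOn (μ : Measure X) (Ω : Set X) (c : ℝ≥0∞) : Prop where
  measurableSet : MeasurableSet Ω
  nonempty : Ω.Nonempty
  const_ne_top : c ≠ ∞
  ball_le : ∀ x ∈ Ω, ∀ r : ℝ, 0 < r → r ≤ 1 →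
    μ (Metric.ball x r) ≤ c * μ (Metric.ball x r ∩ Ω)

/-- `K` is supported near `x` at scale `r` and has size at most `ε` after normalization. -/
structure IsKernelAt (μ : Measure X) (x : X) (r ε : ℝ) (K : X → ℝ) : Prop where
  measurable : Measurable K
  eq_zero : ∀ z, 9 * r ≤ dist x z → K z = 0
  abs_le : ∀ z, |K z| ≤ ε / μ.real (Metric.ball x (10 * r))

/-- The unnormalized bump of radius `8 * r` around `x`. -/
def bump (r : ℝ) (x z : X) : ℝ := max 0 (1 - dist x z / (8 * r))

/-- The bump of radius `8 * r` around `x`, normalized to have integral one over `Ω`. -/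
def avgKer (μ : Measure X) (Ω : Set X) (r : ℝ) (x z : X) : ℝ :=
  bump r x z / ∫ z in Ω, bump r x z ∂μ

variable {μ : Measure X} {Cd c : ℝ≥0∞} {D : ℝ} {Ω : Set X}

theorem bump_nonneg (r : ℝ) (x z : X) : 0 ≤ bump r x z := le_max_left _ _

theorem bump_le_one {r : ℝ} (hr : 0 < r) (x z : X) : bump r x z ≤ 1 :=
  max_le zero_le_one (by have : 0 ≤ dist x z / (8 * r) := by positivity
                         linarith)

theorem bump_eq_zero {r : ℝ} (hr : 0 < r) {x z : X} (h : 8 * r ≤ dist x z) : bump r x z = 0 := by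
  refine max_eq_left ?_
  have : 1 ≤ dist x z / (8 * r) := (one_le_div (by positivity)).2 h
  linarith

theorem abs_bump_sub_le {r : ℝ} (hr : 0 < r) (x y z : X) :
    |bump r x z - bump r y z| ≤ dist x y / (8 * r) := by
  unfold bump
  rw [max_comm 0, max_comm 0]
  refine (abs_max_sub_max_le_abs _ _ _).trans ?_
  rw [show 1 - dist x z / (8 * r) - (1 - dist y z / (8 * r)) = (dist y z - dist x z) / (8 * r) by
    ring, abs_div, abs_of_pos (show 0 < 8 * r by positivity)]
  gcongr
  rw [abs_sub_comm]
  exact abs_dist_sub_le x y z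

theorem DoublingOn.real_ball_pos (h : DoublingOn μ Cd D) (x : X) {r : ℝ} (hr : 0 < r) :
    0 < μ.real (Metric.ball x r) :=
  ENNReal.toReal_pos (h.ball_pos x r hr).ne' (h.ball_lt_top x r hr).ne

theorem DoublingOn.real_ball_le (h : DoublingOn μ Cd D) {x y : X} {r R S : ℝ} (hr : 0 < r)
    (hrS : r ≤ S) (hS : dist x y + R ≤ S) :
    μ.real (Metric.ball x R) ≤ Cd.toReal * (S / r) ^ D * μ.real (Metric.ball y r) := by
  have h1 := h.ball_le_of_dist hr hrS hS
  have h2 := ENNReal.toReal_mono (ENNReal.mul_ne_top (ENNReal.mul_ne_top h.const_ne_top (by simp))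
    (h.ball_lt_top y r hr).ne) h1
  rwa [ENNReal.toReal_mul, ENNReal.toReal_mul, ENNReal.toReal_ofReal (Real.rpow_nonneg
    (div_nonneg (hr.le.trans hrS) hr.le) _)] at h2

theorem exists_mem_dist_lt_of_infDist_lt (hΩ : Ω.Nonempty) {x : X} {r : ℝ}
    (hx : Metric.infDist x Ω < r) : ∃ a ∈ Ω, dist x a < r := (Metric.infDist_lt_iff hΩ).1 hx

/-- Near `Ω`, the set `Ω` fills a fixed proportion of balls. -/
theorem DensityOn.exists_ball_le (hΩ : DensityOn μ Ω c) (h : DoublingOn μ Cd D) :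
    ∃ A : ℝ≥0∞, A ≠ ∞ ∧ ∀ (x : X) (r : ℝ), 0 < r → r ≤ 1 → Metric.infDist x Ω < 4 * r →
      μ (Metric.ball x (10 * r)) ≤ A * μ (Metric.ball x (5 * r) ∩ Ω) := by
  refine ⟨Cd * ENNReal.ofReal (14 ^ D) * c, ENNReal.mul_ne_top
    (ENNReal.mul_ne_top h.const_ne_top (by simp)) hΩ.const_ne_top, fun x r hr hr1 hx => ?_⟩
  obtain ⟨a, ha, hxa⟩ := exists_mem_dist_lt_of_infDist_lt hΩ.nonempty hx
  calc μ (Metric.ball x (10 * r)) ≤ Cd * ENNReal.ofReal ((14 * r / r) ^ D) * μ (Metric.ball a r) :=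
        h.ball_le_of_dist hr (by linarith) (by linarith)
    _ ≤ Cd * ENNReal.ofReal (14 ^ D) * (c * μ (Metric.ball a r ∩ Ω)) := by
        rw [mul_div_cancel_right₀ _ hr.ne']
        gcongr
        exact hΩ.ball_le a ha r hr hr1
    _ ≤ Cd * ENNReal.ofReal (14 ^ D) * (c * μ (Metric.ball x (5 * r) ∩ Ω)) := by
        gcongr
        exact Metric.ball_subset_ball' (by rw [dist_comm]; linarith)
    _ = _ := by ring

theorem IsKernelAt.const_mul {x : X} {r ε a b : ℝ} {K : X → ℝ} (hK : IsKernelAt μ x r ε K)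
    (ha : |a| ≤ b) : IsKernelAt μ x r (b * ε) fun z => a * K z where
  measurable := hK.measurable.const_mul a
  eq_zero z hz := by rw [hK.eq_zero z hz, mul_zero]
  abs_le z := by
    rw [abs_mul, mul_div_assoc]
    exact mul_le_mul ha (hK.abs_le z) (abs_nonneg _) ((abs_nonneg _).trans ha)

theorem IsKernelAt.add {x : X} {r ε ε' : ℝ} {K K' : X → ℝ} (hK : IsKernelAt μ x r ε K)
    (hK' : IsKernelAt μ x r ε' K') : IsKernelAt μ x r (ε + ε') fun z => K z + K' z where
  measurable := hK.measurable.add hK'.measurable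
  eq_zero z hz := by rw [hK.eq_zero z hz, hK'.eq_zero z hz, add_zero]
  abs_le z := by
    rw [add_div]
    exact (abs_add_le _ _).trans (add_le_add (hK.abs_le z) (hK'.abs_le z))

theorem IsKernelAt.sub {x : X} {r ε ε' : ℝ} {K K' : X → ℝ} (hK : IsKernelAt μ x r ε K)
    (hK' : IsKernelAt μ x r ε' K') : IsKernelAt μ x r (ε + ε') fun z => K z - K' z := by
  have := hK.add (hK'.const_mul (a := -1) (b := 1) (by simp))
  simpa [sub_eq_add_neg] using this

theorem IsKernelAt.mono_const {x : X} {r ε ε' : ℝ} {K : X → ℝ} (hK : IsKernelAt μ x r ε K)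
    (hε : ε ≤ ε') : IsKernelAt μ x r ε' K where
  measurable := hK.measurable
  eq_zero := hK.eq_zero
  abs_le z := (hK.abs_le z).trans (by gcongr)

theorem IsKernelAt.zero (x : X) (r : ℝ) {ε : ℝ} (hε : 0 ≤ ε) :
    IsKernelAt μ x r ε fun _ => 0 where
  measurable := measurable_const
  eq_zero _ _ := rfl
  abs_le z := by simpa using div_nonneg hε measureReal_nonneg

theorem IsKernelAt.mono_radius (h : DoublingOn μ Cd D) {x : X} {r r' ε M : ℝ} {K : X → ℝ}
    (hr : 0 < r) (hrr' : r ≤ r') (hM : r' ≤ M * r) (hε : 0 ≤ ε) (hK : IsKernelAt μ x r ε K) :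
    IsKernelAt μ x r' (Cd.toReal * M ^ D * ε) K where
  measurable := hK.measurable
  eq_zero z hz := hK.eq_zero z (by linarith)
  abs_le z := by
    refine (hK.abs_le z).trans ?_
    have h1 := h.real_ball_pos x (r := 10 * r) (by positivity)
    have h2 := h.real_ball_pos x (r := 10 * r') (by linarith)
    have h3 := h.real_ball_le (x := x) (y := x) (r := 10 * r) (R := 10 * r') (S := M * (10 * r))
      (by positivity) (by linarith) (by rw [dist_self]; linarith)
    rw [mul_div_cancel_right₀ _ (by positivity)] at h3
    rw [div_le_div_iff₀ h1 h2]
    nlinarith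

variable [OpensMeasurableSpace X]

theorem measurable_bump (r : ℝ) (x : X) : Measurable (bump r x) := by
  unfold bump
  exact (Continuous.measurable (by fun_prop))

theorem IsKernelAt.integrable (h : DoublingOn μ Cd D) {x : X} {r ε : ℝ} (hr : 0 < r) {K : X → ℝ}
    (hK : IsKernelAt μ x r ε K) : Integrable K μ := by
  have hK' : K = (Metric.ball x (9 * r)).indicator K := by
    ext z
    by_cases hz : z ∈ Metric.ball x (9 * r)
    · rw [Set.indicator_of_mem hz]
    · rw [Set.indicator_of_notMem hz, hK.eq_zero z]
      simpa [dist_comm] using hz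
  rw [hK', integrable_indicator_iff Metric.isOpen_ball.measurableSet]
  exact Measure.integrableOn_of_bounded (h.ball_lt_top x (9 * r) (by positivity)).ne
    hK.measurable.aestronglyMeasurable (Filter.Eventually.of_forall hK.abs_le)

theorem isKernelAt_bump (h : DoublingOn μ Cd D) {x : X} {r : ℝ} (hr : 0 < r) :
    IsKernelAt μ x r (μ.real (Metric.ball x (10 * r))) (bump r x) where
  measurable := measurable_bump r x
  eq_zero z hz := bump_eq_zero hr (by linarith)
  abs_le z := by
    rw [div_self (h.real_ball_pos x (by positivity)).ne', abs_of_nonneg (bump_nonneg _ _ _)]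
    exact bump_le_one hr x z

theorem DensityOn.exists_le_integral_bump (hΩ : DensityOn μ Ω c) (h : DoublingOn μ Cd D) :
    ∃ A : ℝ, 0 < A ∧ ∀ (x : X) (r : ℝ), 0 < r → r ≤ 1 → Metric.infDist x Ω < 4 * r →
      μ.real (Metric.ball x (10 * r)) ≤ A * ∫ z in Ω, bump r x z ∂μ := by
  obtain ⟨A, hA, hAx⟩ := hΩ.exists_ball_le h
  refine ⟨8 / 3 * (A.toReal + 1), by positivity, fun x r hr hr1 hx => ?_⟩
  have hfin : μ (Metric.ball x (5 * r) ∩ Ω) ≠ ∞ :=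
    ((measure_mono Set.inter_subset_left).trans_lt (h.ball_lt_top x (5 * r) (by positivity))).ne
  have hbm := (isKernelAt_bump h (x := x) hr).integrable h hr
  have h1 : μ.real (Metric.ball x (10 * r)) ≤ A.toReal * μ.real (Metric.ball x (5 * r) ∩ Ω) := by
    have := ENNReal.toReal_mono (ENNReal.mul_ne_top hA hfin) (hAx x r hr hr1 hx)
    rwa [ENNReal.toReal_mul] at this
  have h2 : 3 / 8 * μ.real (Metric.ball x (5 * r) ∩ Ω) ≤ ∫ z in Ω, bump r x z ∂μ := by
    calc 3 / 8 * μ.real (Metric.ball x (5 * r) ∩ Ω)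
        = ∫ z in Metric.ball x (5 * r) ∩ Ω, (3 / 8 : ℝ) ∂μ := by
          rw [setIntegral_const, smul_eq_mul, mul_comm]
      _ ≤ ∫ z in Metric.ball x (5 * r) ∩ Ω, bump r x z ∂μ := by
          refine setIntegral_mono_on (integrableOn_const hfin) hbm.integrableOn
            (Metric.isOpen_ball.measurableSet.inter hΩ.measurableSet) fun z hz => ?_
          refine le_max_of_le_right ?_
          have h3 : dist x z < 5 * r := by simpa [dist_comm] using hz.1
          have : dist x z / (8 * r) ≤ 5 / 8 := by
            rw [div_le_div_iff₀ (by positivity) (by norm_num)]; linarith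
          linarith
      _ ≤ _ := setIntegral_mono_set hbm.integrableOn
          (Filter.Eventually.of_forall fun z => bump_nonneg r x z)
          (Filter.Eventually.of_forall Set.inter_subset_right)
  have h4 : 0 ≤ μ.real (Metric.ball x (5 * r) ∩ Ω) := measureReal_nonneg
  have h5 : 0 ≤ A.toReal := ENNReal.toReal_nonneg
  nlinarith

/-- The normalized bumps are kernels depending in a Lipschitz way on their center. -/
theorem DensityOn.exists_isKernelAt_avgKer (hΩ : DensityOn μ Ω c) (h : DoublingOn μ Cd D) :
    ∃ A : ℝ, 0 ≤ A ∧ ∀ (x : X) (r : ℝ), 0 < r → r ≤ 1 → Metric.infDist x Ω < 4 * r →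
      IsKernelAt μ x r A (avgKer μ Ω r x) ∧ ∫ z in Ω, avgKer μ Ω r x z ∂μ = 1 ∧
      ∀ y, Metric.infDist y Ω < 4 * r → dist x y ≤ r →
        IsKernelAt μ x r (A * (dist x y / r)) fun z => avgKer μ Ω r x z - avgKer μ Ω r y z := by
  obtain ⟨A, hA, hAx⟩ := hΩ.exists_le_integral_bump h
  set B := Cd.toReal * (11 / 10) ^ D with hB
  have hB0 : 0 ≤ B := by positivity
  refine ⟨A + A * A * B, by positivity, fun x r hr hr1 hx => ?_⟩
  set V : X → ℝ := fun x => ∫ z in Ω, bump r x z ∂μ with hV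
  have hm : ∀ x, 0 < μ.real (Metric.ball x (10 * r)) := fun x => h.real_ball_pos x (by positivity)
  have hVm : ∀ x, Metric.infDist x Ω < 4 * r → μ.real (Metric.ball x (10 * r)) ≤ A * V x :=
    fun x hx => hAx x r hr hr1 hx
  have hVpos : ∀ x, Metric.infDist x Ω < 4 * r → 0 < V x := fun x hx =>
    pos_of_mul_pos_right ((hm x).trans_le (hVm x hx)) hA.le
  have hinv : ∀ x, Metric.infDist x Ω < 4 * r → (V x)⁻¹ ≤ A / μ.real (Metric.ball x (10 * r)) :=
    fun x hx => by
      rw [inv_eq_one_div, div_le_div_iff₀ (hVpos x hx) (hm x)]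
      linarith [hVm x hx]
  have hbi : ∀ x, IntegrableOn (bump r x) Ω μ := fun x =>
    ((isKernelAt_bump h (x := x) hr).integrable h hr).integrableOn
  refine ⟨⟨(measurable_bump r x).div_const _, fun z hz => ?_, fun z => ?_⟩, ?_, fun y hy hxy => ?_⟩
  · rw [avgKer, bump_eq_zero hr (by linarith), zero_div]
  · rw [avgKer, abs_div, abs_of_nonneg (bump_nonneg _ _ _), abs_of_pos (hVpos x hx)]
    calc bump r x z / V x ≤ 1 / V x := by
          have := hVpos x hx
          gcongr
          exact bump_le_one hr x z
      _ ≤ A / μ.real (Metric.ball x (10 * r)) := by rw [one_div]; exact hinv x hx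
      _ ≤ _ := by
          gcongr
          nlinarith [mul_nonneg (mul_nonneg hA.le hA.le) hB0]
  · simp only [avgKer]
    rw [integral_div]
    exact div_self (hVpos x hx).ne'
  · have hVx := hVpos x hx
    have hVy := hVpos y hy
    refine ⟨((measurable_bump r x).div_const _).sub ((measurable_bump r y).div_const _),
      fun z hz => ?_, fun z => ?_⟩
    · rw [avgKer, avgKer, bump_eq_zero hr (by linarith), bump_eq_zero hr, zero_div, zero_div,
        sub_zero]
      have := dist_triangle x y z
      linarith
    have hd : 0 ≤ dist x y / (8 * r) := by positivity
    have hVV : |V y - V x| ≤ dist x y / (8 * r) * μ.real (Metric.ball x (10 * r)) := by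
      have h1 : V y - V x = ∫ z in Ω, (bump r y z - bump r x z) ∂μ :=
        (integral_sub (hbi y) (hbi x)).symm
      rw [h1]
      calc |∫ z in Ω, (bump r y z - bump r x z) ∂μ|
          ≤ ∫ z in Ω, |bump r y z - bump r x z| ∂μ := abs_integral_le_integral_abs
        _ ≤ ∫ z in Ω, (Metric.ball x (10 * r)).indicator (fun _ => dist x y / (8 * r)) z ∂μ := by
            have hi : Integrable ((Metric.ball x (10 * r)).indicator
                (fun _ => dist x y / (8 * r))) μ :=
              (integrable_indicator_iff Metric.isOpen_ball.measurableSet).2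
                (integrableOn_const (h.ball_lt_top x _ (by positivity)).ne)
            refine integral_mono ((hbi y).sub (hbi x)).abs hi.integrableOn fun z => ?_
            by_cases hz : z ∈ Metric.ball x (10 * r)
            · simp only [Set.indicator_of_mem hz]
              rw [abs_sub_comm]
              exact abs_bump_sub_le hr x y z
            · simp only [Set.indicator_of_notMem hz]
              have h2 : 10 * r ≤ dist x z := by simpa [dist_comm] using hz
              have := dist_triangle x y z
              rw [bump_eq_zero hr (by linarith), bump_eq_zero hr (by linarith), sub_zero, abs_zero]
        _ = ∫ z in Metric.ball x (10 * r) ∩ Ω, dist x y / (8 * r) ∂μ := by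
            rw [integral_indicator Metric.isOpen_ball.measurableSet,
              Measure.restrict_restrict Metric.isOpen_ball.measurableSet]
        _ = dist x y / (8 * r) * μ.real (Metric.ball x (10 * r) ∩ Ω) := by
            rw [setIntegral_const, smul_eq_mul, mul_comm]
        _ ≤ _ := by
            gcongr
            · exact (h.ball_lt_top x _ (by positivity)).ne
            · exact Set.inter_subset_left
    have hmxy : μ.real (Metric.ball x (10 * r)) ≤ B * μ.real (Metric.ball y (10 * r)) := by
      have := h.real_ball_le (x := x) (y := y) (r := 10 * r) (R := 10 * r) (S := 11 * r)
        (by positivity) (by linarith) (by linarith)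
      rwa [mul_div_mul_right _ _ hr.ne'] at this
    set m := μ.real (Metric.ball x (10 * r)) with hmdef
    have hm0 : 0 < m := hm x
    have hinvy : (V y)⁻¹ ≤ A * B / m := by
      refine (hinv y hy).trans ?_
      rw [div_le_div_iff₀ (hm y) hm0]
      nlinarith
    have hsplit : avgKer μ Ω r x z - avgKer μ Ω r y z =
        (bump r x z - bump r y z) * (V x)⁻¹ +
          bump r y z * ((V y - V x) * ((V x)⁻¹ * (V y)⁻¹)) := by
      simp only [avgKer]
      change bump r x z / V x - bump r y z / V y = _
      field_simp
      ring
    rw [hsplit]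
    calc |(bump r x z - bump r y z) * (V x)⁻¹ +
          bump r y z * ((V y - V x) * ((V x)⁻¹ * (V y)⁻¹))|
        ≤ |bump r x z - bump r y z| * (V x)⁻¹ +
          |bump r y z| * (|V y - V x| * ((V x)⁻¹ * (V y)⁻¹)) := by
          refine (abs_add_le _ _).trans_eq ?_
          rw [abs_mul, abs_mul, abs_mul, abs_of_pos (inv_pos.2 hVx),
            abs_of_pos (mul_pos (inv_pos.2 hVx) (inv_pos.2 hVy))]
      _ ≤ dist x y / (8 * r) * (A / m) +
          1 * (dist x y / (8 * r) * m * (A / m * (A * B / m))) := by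
          have hv1 := (inv_pos.2 hVx).le
          have hv2 := (inv_pos.2 hVy).le
          gcongr
          · exact abs_bump_sub_le hr x y z
          · exact hinv x hx
          · rw [abs_of_nonneg (bump_nonneg _ _ _)]
            exact bump_le_one hr y z
          · exact hinv x hx
      _ = (A + A * A * B) * (dist x y / (8 * r)) / m := by field_simp
      _ ≤ _ := by
          gcongr
          linarith

end Kernels

section Oscillation

/-- The dyadic scale of order `k`. -/
def rad (α : ℝ) (k : ℤ) : ℝ := 2 ^ (-(α * k))

theorem rad_pos (α : ℝ) (k : ℤ) : 0 < rad α k := Real.rpow_pos_of_pos two_pos _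

theorem rad_zero (α : ℝ) : rad α 0 = 1 := by simp [rad]

theorem rad_add (α : ℝ) (k l : ℤ) : rad α (k + l) = rad α k * rad α l := by
  rw [rad, rad, rad, ← Real.rpow_add two_pos]
  push_cast
  ring_nf

theorem rad_anti {α : ℝ} (hα : 0 < α) {k l : ℤ} (h : k ≤ l) : rad α l ≤ rad α k := by
  have : (k : ℝ) ≤ l := by exact_mod_cast h
  exact Real.rpow_le_rpow_of_exponent_le one_le_two (by nlinarith)

theorem rad_le_one {α : ℝ} (hα : 0 < α) {k : ℤ} (h : 0 ≤ k) : rad α k ≤ 1 :=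
  (rad_anti hα h).trans_eq (rad_zero α)

variable [PseudoMetricSpace X] {μ : Measure X} {Cd c : ℝ≥0∞} {D : ℝ} {Ω E : Set X}

/-- `P k` controls the oscillation of `u` on `Ω ∖ E` at the scale `rad α k`. -/
structure IsOscBound (Ω E : Set X) (α : ℝ) (u : X → ℝ) (P : ℤ → X → ℝ≥0∞) : Prop where
  measurable : ∀ k, Measurable (P k)
  antitone : ∀ x, Antitone fun k => P k x
  tendsto : ∀ x ∈ Ω \ E, ∀ k : ℤ,
    Filter.Tendsto (fun n : ℕ => P (k + n) x) Filter.atTop (nhds 0)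
  bound : ∀ k : ℤ, 0 ≤ k → ∀ x ∈ Ω \ E, ∀ y ∈ Ω \ E, dist x y < 20 * rad α (k - 1) →
    ‖u x - u y‖ₑ ≤ P k x + P k y

theorem exists_mem_le_ballAvg (hE : μ E = 0) {A : ℝ≥0∞} (hA : A ≠ ∞) {x : X} {R : ℝ}
    (hR : μ (Metric.ball x R) ≠ 0) (hR' : μ (Metric.ball x R) < ∞) {T : Set X} (hT : MeasurableSet T)
    (hTB : T ⊆ Metric.ball x R) (hBT : μ (Metric.ball x R) ≤ A * μ T)
    {f : X → ℝ≥0∞} (hf : Measurable f) :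
    ∃ w ∈ T \ E, f w ≤ A * ballAvg μ R f x := by
  have hT0 : μ T ≠ 0 := fun h => hR (by simpa [h] using hBT)
  have hA0 : A ≠ 0 := fun h => hR (by simpa [h] using hBT)
  have : IsFiniteMeasure (μ.restrict T) :=
    ⟨by rw [Measure.restrict_apply_univ]; exact (measure_mono hTB).trans_lt hR'⟩
  obtain ⟨w, hw, hfw⟩ := exists_notMem_null_le_laverage (μ := μ.restrict T) (N := E ∪ Tᶜ)
    (by simpa [Measure.restrict_eq_zero] using hT0) hf.aemeasurable
    (measure_union_null (Measure.restrict_le_self.absolutelyContinuous hE)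
      (by rw [Measure.restrict_apply hT.compl]; simp))
  simp only [mem_union, mem_compl_iff, not_or, not_not] at hw
  refine ⟨w, ⟨hw.2, hw.1⟩, hfw.trans ?_⟩
  rw [setLAverage_eq, ENNReal.div_eq_inv_mul, ballAvg, ← mul_assoc]
  have h1 : (μ T)⁻¹ ≤ A * (μ (Metric.ball x R))⁻¹ := by
    calc (μ T)⁻¹ = A * (A⁻¹ * (μ T)⁻¹) := by
          rw [← mul_assoc, ENNReal.mul_inv_cancel hA0 hA, one_mul]
      _ = A * (A * μ T)⁻¹ := by rw [ENNReal.mul_inv (Or.inl hA0) (Or.inl hA)]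
      _ ≤ _ := by gcongr
  exact mul_le_mul' h1 (lintegral_mono_set hTB)

/-- The `t`-mean of `f` over the ball of radius `r`. -/
def powAvg (μ : Measure X) (t r : ℝ) (f : X → ℝ≥0∞) (x : X) : ℝ≥0∞ :=
  ballAvg μ r (fun z => f z ^ t) x ^ (1 / t)

variable [OpensMeasurableSpace X]

theorem IsOscBound.enorm_sub_le {α t : ℝ} (hα : 0 < α) (ht : 0 < t) (h : DoublingOn μ Cd D)
    (hΩ : DensityOn μ Ω c) (hE : μ E = 0) {u : X → ℝ} {P : ℤ → X → ℝ≥0∞}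
    (hP : IsOscBound Ω E α u P) {k : ℤ} (hk : 0 ≤ k) {z w : X} (hz : z ∈ Ω \ E) (hw : w ∈ Ω \ E)
    (hzw : dist z w < 18 * rad α k) :
    ‖u z - u w‖ₑ ≤ P k w + 2 * ∑' i : ℕ, c ^ (1 / t) *
      powAvg μ t (rad α (k + i)) (P (k + i)) z := by
  set b : ℕ → ℝ≥0∞ := fun i => c ^ (1 / t) * powAvg μ t (rad α (k + i)) (P (k + i)) z with hb
  have hex : ∀ i : ℕ, ∃ v ∈ (Metric.ball z (rad α (k + i)) ∩ Ω) \ E, P (k + i) v ≤ b i := by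
    intro i
    have hki : (0 : ℤ) ≤ k + i := by positivity
    obtain ⟨v, hv, hfv⟩ := exists_mem_le_ballAvg (μ := μ) hE hΩ.const_ne_top
      (h.ball_pos z (rad α (k + i)) (rad_pos _ _)).ne' (h.ball_lt_top z _ (rad_pos _ _))
      (Metric.isOpen_ball.measurableSet.inter hΩ.measurableSet) inter_subset_left
      (hΩ.ball_le z hz.1 (rad α (k + i)) (rad_pos _ _) (rad_le_one hα hki))
      ((hP.measurable (k + i)).pow_const t)
    refine ⟨v, hv, ?_⟩
    rw [hb]
    simp only [powAvg]
    rw [← ENNReal.mul_rpow_of_nonneg _ _ (by positivity), one_div]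
    exact (ENNReal.le_rpow_inv_iff ht).2 hfv
  choose v hv hPv using hex
  have hvm : ∀ i, v i ∈ Ω \ E := fun i => ⟨(hv i).1.2, (hv i).2⟩
  have hvd : ∀ i : ℕ, dist (v i) z < rad α (k + i) := fun i => (hv i).1.1
  have hrad : ∀ i : ℕ, rad α (k + (i + 1 : ℕ)) ≤ rad α (k + i) := fun i =>
    rad_anti hα (by push_cast; linarith)
  have hrad' : ∀ i : ℕ, rad α (k + i) ≤ rad α (k + i - 1) := fun i => rad_anti hα (by linarith)
  have hchain : ∀ n : ℕ, ‖u w - u (v n)‖ₑ + b n ≤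
      P k w + 2 * ∑ i ∈ Finset.range (n + 1), b i := by
    intro n
    induction n with
    | zero =>
      have h1 := hrad' 0
      have h2 := hvd 0
      have h0 := rad_pos α k
      simp only [Nat.cast_zero, add_zero] at h1 h2
      have := hP.bound k hk w hw (v 0) (hvm 0) (by
        have := dist_triangle w z (v 0)
        rw [dist_comm w z, dist_comm z (v 0)] at this
        linarith)
      have h3 := hPv 0
      simp only [Nat.cast_zero, add_zero] at h3
      simp only [zero_add, Finset.range_one, Finset.sum_singleton]
      calc ‖u w - u (v 0)‖ₑ + b 0 ≤ P k w + b 0 + b 0 := by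
            gcongr
            exact this.trans (by gcongr)
        _ = _ := by ring
    | succ n ih =>
      rw [Finset.sum_range_succ]
      have hki : (0 : ℤ) ≤ k + (n + 1 : ℕ) := by positivity
      have h1 := hP.bound (k + (n + 1 : ℕ)) hki (v n) (hvm n) (v (n + 1)) (hvm _) (by
        have h2 := dist_triangle_right (v n) (v (n + 1)) z
        have h3 := hvd n
        have h4 := hvd (n + 1)
        have h5 := hrad n
        have h6 := rad_pos α (k + n)
        have h7 : k + ((n + 1 : ℕ) : ℤ) - 1 = k + n := by push_cast; ring
        rw [h7]
        linarith)
      have h2 : P (k + (n + 1 : ℕ)) (v n) ≤ b n :=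
        (hP.antitone (v n) (by push_cast; linarith)).trans (hPv n)
      have h3 : ‖u w - u (v (n + 1))‖ₑ ≤ ‖u w - u (v n)‖ₑ + ‖u (v n) - u (v (n + 1))‖ₑ := by
        rw [← sub_add_sub_cancel (u w) (u (v n))]
        exact enorm_add_le _ _
      calc ‖u w - u (v (n + 1))‖ₑ + b (n + 1)
          ≤ ‖u w - u (v n)‖ₑ + (b n + b (n + 1)) + b (n + 1) := by
            gcongr
            exact h3.trans (by gcongr; exact h1.trans (add_le_add h2 (hPv _)))
        _ = (‖u w - u (v n)‖ₑ + b n) + 2 * b (n + 1) := by ring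
        _ ≤ _ := by
            rw [mul_add, ← add_assoc]
            gcongr
  have hfin : ∀ n : ℕ, ‖u z - u w‖ₑ ≤ P k w + 2 * ∑' i, b i + P (k + n) z := by
    intro n
    have h1 := hP.bound (k + n) (by positivity) z hz (v n) (hvm n) (by
      rw [dist_comm]
      have h3 := hvd n
      have h6 := rad_pos α (k + n)
      have := hrad' n
      linarith)
    have h3 : ‖u z - u w‖ₑ ≤ ‖u w - u (v n)‖ₑ + ‖u z - u (v n)‖ₑ := by
      rw [← sub_sub_sub_cancel_right (u z) (u w) (u (v n)), sub_eq_add_neg]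
      refine (enorm_add_le _ _).trans ?_
      rw [enorm_neg, add_comm]
    calc ‖u z - u w‖ₑ ≤ ‖u w - u (v n)‖ₑ + (P (k + n) z + b n) :=
          h3.trans (by gcongr; exact h1.trans (by gcongr; exact hPv n))
      _ = (‖u w - u (v n)‖ₑ + b n) + P (k + n) z := by ring
      _ ≤ _ := by
          refine add_le_add ((hchain n).trans ?_) le_rfl
          gcongr
          exact ENNReal.sum_le_tsum _
  refine ge_of_tendsto' (x := Filter.atTop) ?_ hfin
  simpa using (tendsto_const_nhds (x := P k w + 2 * ∑' i, b i)).add (hP.tendsto z hz k)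

variable [SecondCountableTopology X]

theorem measurable_powAvg [SFinite μ] {f : X → ℝ≥0∞} (hf : Measurable f) (t r : ℝ) :
    Measurable (powAvg μ t r f) := (measurable_ballAvg (hf.pow_const t) r).pow_const _

theorem lintegral_ball_powAvg_le [SFinite μ] (h : DoublingOn μ Cd D) {t : ℝ} (ht : 0 < t)
    (ht1 : t < 1) : ∃ C : ℝ≥0∞, C ≠ ∞ ∧ ∀ (x : X) (r R : ℝ) (f : X → ℝ≥0∞), 0 < r → r ≤ R →
      Measurable f → ∫⁻ z in Metric.ball x (9 * R), powAvg μ t r f z ∂μ ≤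
        C * ENNReal.ofReal ((R / r) ^ (D * (1 / t - 1))) *
          (μ (Metric.ball x (10 * R)) * powAvg μ t (10 * R) f x) := by
  have hβ : 0 < 1 / t - 1 := by
    have := one_lt_one_div ht ht1
    linarith
  have hD := h.exponent_pos
  refine ⟨Cd * ENNReal.ofReal (2 ^ D) * (Cd * ENNReal.ofReal (20 ^ D)) ^ (1 / t - 1),
    ENNReal.mul_ne_top (ENNReal.mul_ne_top h.const_ne_top (by simp))
      (ENNReal.rpow_ne_top_of_nonneg hβ.le (ENNReal.mul_ne_top h.const_ne_top (by simp))),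
    fun x r R f hr hrR hf => ?_⟩
  have hR : 0 < R := hr.trans_le hrR
  have hg : Measurable fun z => f z ^ t := hf.pow_const t
  set g : X → ℝ≥0∞ := fun z => f z ^ t with hgdef
  set m := μ (Metric.ball x (10 * R)) with hm
  have hm0 : m ≠ 0 := (h.ball_pos x _ (by positivity)).ne'
  have hmt : m ≠ ∞ := (h.ball_lt_top x _ (by positivity)).ne
  set AA := ballAvg μ (10 * R) g x with hAA
  have hint : ∫⁻ z in Metric.ball x (10 * R), g z ∂μ = m * AA := by
    rw [hAA, ballAvg, ← mul_assoc, ENNReal.mul_inv_cancel hm0 hmt, one_mul]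
  set M := Cd * ENNReal.ofReal ((20 * R / r) ^ D) with hM
  have hpt : ∀ z ∈ Metric.ball x (9 * R), ballAvg μ r g z ≤ M * AA := by
    intro z hz
    have hz' : dist x z < 9 * R := by rw [dist_comm]; exact hz
    have h1 : m ≤ M * μ (Metric.ball z r) :=
      h.ball_le_of_dist hr (by linarith) (by linarith)
    have hb0 := (h.ball_pos z r hr).ne'
    have hbt := (h.ball_lt_top z r hr).ne
    have h2 : ∫⁻ y in Metric.ball z r, g y ∂μ ≤ m * AA := by
      rw [← hint]
      exact lintegral_mono_set (Metric.ball_subset_ball' (by rw [dist_comm]; linarith))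
    calc ballAvg μ r g z ≤ (μ (Metric.ball z r))⁻¹ * (m * AA) := by
          unfold ballAvg
          gcongr
      _ ≤ (μ (Metric.ball z r))⁻¹ * (M * μ (Metric.ball z r) * AA) := by gcongr
      _ = ((μ (Metric.ball z r))⁻¹ * μ (Metric.ball z r)) * (M * AA) := by ring
      _ = M * AA := by rw [ENNReal.inv_mul_cancel hb0 hbt, one_mul]
  have hball : MeasurableSet (Metric.ball x (9 * R)) := Metric.isOpen_ball.measurableSet
  have hadj : ∫⁻ z in Metric.ball x (9 * R), ballAvg μ r g z ∂μ ≤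
      Cd * ENNReal.ofReal (2 ^ D) * (m * AA) := by
    have h1 := lintegral_ballAvg_mul_le (μ := μ) h hr hg
      (w := (Metric.ball x (9 * R)).indicator fun _ => 1) (measurable_const.indicator hball)
    calc ∫⁻ z in Metric.ball x (9 * R), ballAvg μ r g z ∂μ
        = ∫⁻ z, ballAvg μ r g z * (Metric.ball x (9 * R)).indicator (fun _ => 1) z ∂μ := by
          rw [← lintegral_indicator hball]
          congr 1
          ext z
          by_cases hz : z ∈ Metric.ball x (9 * R)
          · simp [Set.indicator_of_mem hz]
          · simp [Set.indicator_of_notMem hz]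
      _ ≤ _ := h1
      _ ≤ _ := by
          gcongr
          rw [← hint, ← lintegral_indicator Metric.isOpen_ball.measurableSet]
          refine lintegral_mono fun z => ?_
          by_cases hz : z ∈ Metric.ball x (10 * R)
          · rw [Set.indicator_of_mem hz]
            calc _ ≤ g z * 1 := by
                  gcongr
                  refine le_trans (ballAvg_mono (fun y => ?_) z) (ballAvg_const_le r 1 z)
                  exact Set.indicator_le_self' (fun _ _ => zero_le) y
              _ = g z := mul_one _
          · rw [Set.indicator_of_notMem hz]
            have : ballAvg μ r ((Metric.ball x (9 * R)).indicator fun _ => 1) z = 0 := by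
              unfold ballAvg
              rw [setLIntegral_congr_fun (g := fun _ => 0) Metric.isOpen_ball.measurableSet]
              · simp
              · intro y hy
                refine Set.indicator_of_notMem (fun hy' => hz ?_) _
                rw [Metric.mem_ball] at hy hy' ⊢
                have := dist_triangle_left z x y
                linarith
            simp [this]
  have hsplit : ∀ a : ℝ≥0∞, a ^ (1 / t) = a * a ^ (1 / t - 1) := fun a => by
    conv_lhs => rw [show 1 / t = 1 + (1 / t - 1) by ring]
    rw [ENNReal.rpow_add_of_nonneg _ _ zero_le_one hβ.le, ENNReal.rpow_one]
  calc ∫⁻ z in Metric.ball x (9 * R), powAvg μ t r f z ∂μ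
      ≤ ∫⁻ z in Metric.ball x (9 * R), ballAvg μ r g z * (M * AA) ^ (1 / t - 1) ∂μ := by
        refine setLIntegral_mono' hball fun z hz => ?_
        unfold powAvg
        rw [hsplit]
        gcongr
        exact hpt z hz
    _ = (∫⁻ z in Metric.ball x (9 * R), ballAvg μ r g z ∂μ) * (M * AA) ^ (1 / t - 1) := by
        rw [lintegral_mul_const _ (measurable_ballAvg hg r)]
    _ ≤ Cd * ENNReal.ofReal (2 ^ D) * (m * AA) * (M * AA) ^ (1 / t - 1) := by gcongr
    _ = Cd * ENNReal.ofReal (2 ^ D) * M ^ (1 / t - 1) * (m * (AA * AA ^ (1 / t - 1))) := by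
        rw [ENNReal.mul_rpow_of_nonneg _ _ hβ.le]
        ring
    _ = Cd * ENNReal.ofReal (2 ^ D) * M ^ (1 / t - 1) * (m * powAvg μ t (10 * R) f x) := by
        rw [powAvg, hsplit]
    _ = _ := by
        have : M ^ (1 / t - 1) = (Cd * ENNReal.ofReal (20 ^ D)) ^ (1 / t - 1) *
            ENNReal.ofReal ((R / r) ^ (D * (1 / t - 1))) := by
          rw [hM, mul_div_assoc, Real.mul_rpow (by norm_num) (by positivity),
            ENNReal.ofReal_mul (by positivity), ← mul_assoc, ENNReal.mul_rpow_of_nonneg _ _ hβ.le,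
            ENNReal.ofReal_rpow_of_nonneg (by positivity) hβ.le, ← Real.rpow_mul (by positivity)]
        rw [this]
        ring

end Oscillation

section KernelEstimates

variable [PseudoMetricSpace X] {μ : Measure X} {Cd c : ℝ≥0∞} {D : ℝ} {Ω E : Set X}

/-- The sum of the means of the oscillation bounds `P` of order at least `k`. -/
def tailAvg (μ : Measure X) (α D t : ℝ) (P : ℤ → X → ℝ≥0∞) (k : ℤ) (x : X) : ℝ≥0∞ :=
  ∑' i : ℕ, ENNReal.ofReal (2 ^ (α * D * (1 / t - 1))) ^ i *
    powAvg μ t (10 * rad α k) (P (k + i)) x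

theorem powAvg_le_tailAvg (α D t : ℝ) (P : ℤ → X → ℝ≥0∞) (k : ℤ) (x : X) :
    powAvg μ t (10 * rad α k) (P k) x ≤ tailAvg μ α D t P k x := by
  have := ENNReal.le_tsum (f := fun i : ℕ => ENNReal.ofReal (2 ^ (α * D * (1 / t - 1))) ^ i *
    powAvg μ t (10 * rad α k) (P (k + i)) x) 0
  simpa [tailAvg] using this

theorem rad_div_rad_rpow (α b : ℝ) (k : ℤ) (i : ℕ) :
    ENNReal.ofReal ((rad α k / rad α (k + i)) ^ b) = ENNReal.ofReal (2 ^ (α * b)) ^ i := by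
  rw [← ENNReal.ofReal_pow (by positivity), rad, rad, ← Real.rpow_sub two_pos,
    ← Real.rpow_mul two_pos.le, ← Real.rpow_natCast, ← Real.rpow_mul two_pos.le]
  congr 2
  push_cast
  ring

variable [OpensMeasurableSpace X]

theorem IsKernelAt.lintegral_enorm_mul_le (h : DoublingOn μ Cd D) {x : X} {r ε : ℝ} {K : X → ℝ}
    (hr : 0 < r) (hK : IsKernelAt μ x r ε K) {g : X → ℝ} {Y : ℝ≥0∞}
    (hg : ∫⁻ z in Metric.ball x (9 * r) ∩ Ω, ‖g z‖ₑ ∂μ ≤ μ (Metric.ball x (10 * r)) * Y) :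
    ∫⁻ z in Ω, ‖K z * g z‖ₑ ∂μ ≤ ENNReal.ofReal ε * Y := by
  have hball : MeasurableSet (Metric.ball x (9 * r)) := Metric.isOpen_ball.measurableSet
  set m := μ.real (Metric.ball x (10 * r)) with hm
  have hm0 : 0 < m := h.real_ball_pos x (by positivity)
  have hμm : μ (Metric.ball x (10 * r)) = ENNReal.ofReal m :=
    (ENNReal.ofReal_toReal (h.ball_lt_top x _ (by positivity)).ne).symm
  calc ∫⁻ z in Ω, ‖K z * g z‖ₑ ∂μ
      ≤ ∫⁻ z in Ω, (Metric.ball x (9 * r)).indicator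
          (fun z => ENNReal.ofReal (ε / m) * ‖g z‖ₑ) z ∂μ := by
        refine lintegral_mono fun z => ?_
        by_cases hz : z ∈ Metric.ball x (9 * r)
        · rw [Set.indicator_of_mem hz, enorm_mul]
          gcongr
          rw [Real.enorm_eq_ofReal_abs]
          exact ENNReal.ofReal_le_ofReal (hK.abs_le z)
        · rw [hK.eq_zero z (by simpa [dist_comm] using hz)]
          simp
    _ = ENNReal.ofReal (ε / m) * ∫⁻ z in Metric.ball x (9 * r) ∩ Ω, ‖g z‖ₑ ∂μ := by
        rw [lintegral_indicator hball, Measure.restrict_restrict hball,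
          lintegral_const_mul' _ _ ENNReal.ofReal_ne_top]
    _ ≤ ENNReal.ofReal (ε / m) * (ENNReal.ofReal m * Y) := by rw [← hμm]; gcongr
    _ = _ := by
        rw [← mul_assoc, ← ENNReal.ofReal_mul' hm0.le, div_mul_cancel₀ _ hm0.ne']

variable [SecondCountableTopology X]

theorem measurable_tailAvg [SFinite μ] {P : ℤ → X → ℝ≥0∞} (hP : ∀ k, Measurable (P k))
    (α D t : ℝ) (k : ℤ) : Measurable (tailAvg μ α D t P k) :=
  Measurable.tsum fun _ => (measurable_powAvg (hP _) t _).const_mul _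

theorem exists_lintegral_enorm_sub_le [SFinite μ] (h : DoublingOn μ Cd D) (hΩ : DensityOn μ Ω c)
    {α t : ℝ} (hα : 0 < α) (ht : 0 < t) (ht1 : t < 1) :
    ∃ C : ℝ≥0∞, C ≠ ∞ ∧ ∀ (E : Set X) (u : X → ℝ) (P : ℤ → X → ℝ≥0∞), μ E = 0 →
      IsOscBound Ω E α u P → ∀ k : ℤ, 0 ≤ k → ∀ x w : X,
      w ∈ Metric.ball x (9 * rad α k) → w ∈ Ω \ E →
      ∫⁻ z in Metric.ball x (9 * rad α k) ∩ Ω, ‖u z - u w‖ₑ ∂μ ≤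
        μ (Metric.ball x (10 * rad α k)) * (C * (P k w + tailAvg μ α D t P k x)) := by
  obtain ⟨C, hC, hCx⟩ := lintegral_ball_powAvg_le h ht ht1
  have hct : c ^ (1 / t) ≠ ∞ := ENNReal.rpow_ne_top_of_nonneg (by positivity) hΩ.const_ne_top
  refine ⟨1 + 2 * (c ^ (1 / t) * C), by finiteness, fun E u P hE hP k hk x w hwx hw => ?_⟩
  set r := rad α k with hr
  have hr0 : 0 < r := rad_pos α k
  set m := μ (Metric.ball x (10 * r)) with hm
  set γ := ENNReal.ofReal (2 ^ (α * D * (1 / t - 1))) with hγ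
  have hball : MeasurableSet (Metric.ball x (9 * r)) := Metric.isOpen_ball.measurableSet
  have hmeas : ∀ i : ℕ, Measurable (powAvg μ t (rad α (k + i)) (P (k + i))) := fun i =>
    measurable_powAvg (hP.measurable _) t _
  have hsum : ∫⁻ z in Metric.ball x (9 * r), ∑' i : ℕ, c ^ (1 / t) *
      powAvg μ t (rad α (k + i)) (P (k + i)) z ∂μ ≤
        c ^ (1 / t) * C * (m * tailAvg μ α D t P k x) := by
    rw [lintegral_tsum (f := fun (i : ℕ) z => c ^ (1 / t) *
      powAvg μ t (rad α (k + i)) (P (k + i)) z) fun i => ((hmeas i).const_mul _).aemeasurable]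
    unfold tailAvg
    rw [← ENNReal.tsum_mul_left, ← ENNReal.tsum_mul_left]
    refine ENNReal.tsum_le_tsum fun i => ?_
    rw [lintegral_const_mul _ (hmeas i)]
    have h1 := hCx x (rad α (k + i)) r (P (k + i)) (rad_pos _ _)
      (rad_anti hα (by linarith [Int.natCast_nonneg i])) (hP.measurable _)
    rw [hr, rad_div_rad_rpow, ← mul_assoc α] at h1
    calc _ ≤ _ := mul_le_mul_right h1 _
      _ = _ := by ring
  calc ∫⁻ z in Metric.ball x (9 * r) ∩ Ω, ‖u z - u w‖ₑ ∂μ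
      ≤ ∫⁻ z in Metric.ball x (9 * r) ∩ Ω, (P k w + 2 * ∑' i : ℕ, c ^ (1 / t) *
          powAvg μ t (rad α (k + i)) (P (k + i)) z) ∂μ := by
        refine lintegral_mono_ae ?_
        have hE' : ∀ᵐ z ∂μ.restrict (Metric.ball x (9 * r) ∩ Ω), z ∉ E :=
          ae_restrict_of_ae (measure_eq_zero_iff_ae_notMem.1 hE)
        filter_upwards [hE', ae_restrict_mem (hball.inter hΩ.measurableSet)] with z hz hzB
        refine hP.enorm_sub_le hα ht h hΩ hE hk ⟨hzB.2, hz⟩ hw ?_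
        have h1 := hzB.1
        rw [Metric.mem_ball] at h1 hwx
        have := dist_triangle_right z w x
        linarith
    _ ≤ ∫⁻ z in Metric.ball x (9 * r), (P k w + 2 * ∑' i : ℕ, c ^ (1 / t) *
          powAvg μ t (rad α (k + i)) (P (k + i)) z) ∂μ := lintegral_mono_set inter_subset_left
    _ = P k w * μ (Metric.ball x (9 * r)) + 2 * ∫⁻ z in Metric.ball x (9 * r), ∑' i : ℕ,
          c ^ (1 / t) * powAvg μ t (rad α (k + i)) (P (k + i)) z ∂μ := by
        rw [lintegral_add_left measurable_const, setLIntegral_const, lintegral_const_mul]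
        exact Measurable.tsum fun i => (hmeas i).const_mul _
    _ ≤ P k w * m + 2 * (c ^ (1 / t) * C * (m * tailAvg μ α D t P k x)) := by
        exact add_le_add (mul_le_mul_right (measure_mono (Metric.ball_subset_ball (by linarith))) _)
          (mul_le_mul_right hsum _)
    _ = m * (1 * P k w + 2 * (c ^ (1 / t) * C) * tailAvg μ α D t P k x) := by ring
    _ ≤ m * ((1 + 2 * (c ^ (1 / t) * C)) * P k w +
          (1 + 2 * (c ^ (1 / t) * C)) * tailAvg μ α D t P k x) := by
        gcongr
        · exact le_self_add
        · exact le_add_self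
    _ = _ := by rw [mul_add (1 + 2 * (c ^ (1 / t) * C))]

theorem exists_lintegral_enorm_sub_le_tailAvg [SFinite μ] (h : DoublingOn μ Cd D)
    (hΩ : DensityOn μ Ω c) {α t : ℝ} (hα : 0 < α) (ht : 0 < t) (ht1 : t < 1) :
    ∃ C : ℝ≥0∞, C ≠ ∞ ∧ ∀ (E : Set X) (u : X → ℝ) (P : ℤ → X → ℝ≥0∞), μ E = 0 →
      IsOscBound Ω E α u P → ∀ k : ℤ, 0 ≤ k → ∀ x : X, Metric.infDist x Ω < 4 * rad α k →
      (∃ w : X, ∫⁻ z in Metric.ball x (9 * rad α k) ∩ Ω, ‖u z - u w‖ₑ ∂μ ≤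
        μ (Metric.ball x (10 * rad α k)) * (C * tailAvg μ α D t P k x)) ∧
      (Measurable u → ∫⁻ z in Metric.ball x (9 * rad α k) ∩ Ω, ‖u z‖ₑ ∂μ ≤
        μ (Metric.ball x (10 * rad α k)) * (C * (tailAvg μ α D t P k x +
          powAvg μ t (10 * rad α k) (Ω.indicator fun z => ‖u z‖ₑ) x))) := by
  obtain ⟨C, hC, hCx⟩ := exists_lintegral_enorm_sub_le h hΩ hα ht ht1
  obtain ⟨A, hA, hAx⟩ := hΩ.exists_ball_le h
  have hAt : A ^ (1 / t) ≠ ∞ := ENNReal.rpow_ne_top_of_nonneg (by positivity) hA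
  have h2t : (2 : ℝ≥0∞) ^ (1 / t) ≠ ∞ := ENNReal.rpow_ne_top_of_nonneg (by positivity) (by simp)
  set B := A ^ (1 / t) * 2 ^ (1 / t) with hB
  have hBt : B ≠ ∞ := ENNReal.mul_ne_top hAt h2t
  refine ⟨C * (A ^ (1 / t) + 1) + (C * (B + 1) + B), by finiteness,
    fun E u P hE hP k hk x hx => ?_⟩
  set r := rad α k with hr
  have hr0 : 0 < r := rad_pos α k
  have hr1 : r ≤ 1 := rad_le_one hα hk
  have hB5 : Metric.ball x (5 * r) ∩ Ω ⊆ Metric.ball x (10 * r) :=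
    inter_subset_left.trans (Metric.ball_subset_ball (by linarith))
  have hgood : ∀ {f : X → ℝ≥0∞}, Measurable f → ∃ w ∈ (Metric.ball x (5 * r) ∩ Ω) \ E,
      f w ≤ A * ballAvg μ (10 * r) f x := fun hf =>
    exists_mem_le_ballAvg hE hA (h.ball_pos x _ (by positivity)).ne'
      (h.ball_lt_top x _ (by positivity))
      (Metric.isOpen_ball.measurableSet.inter hΩ.measurableSet) hB5 (hAx x r hr0 hr1 hx) hf
  have hw9 : ∀ w ∈ (Metric.ball x (5 * r) ∩ Ω) \ E,
      w ∈ Metric.ball x (9 * r) ∧ w ∈ Ω \ E := fun w hw =>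
    ⟨Metric.ball_subset_ball (by linarith) hw.1.1, hw.1.2, hw.2⟩
  have hPt : Measurable fun z => P k z ^ t := (hP.measurable k).pow_const t
  have hTle := powAvg_le_tailAvg (μ := μ) α D t P k x
  set T := tailAvg μ α D t P k x with hT
  set m := μ (Metric.ball x (10 * r)) with hm
  constructor
  · obtain ⟨w, hw, hfw⟩ := hgood hPt
    refine ⟨w, (hCx E u P hE hP k hk x w (hw9 w hw).1 (hw9 w hw).2).trans ?_⟩
    have hPw : P k w ≤ A ^ (1 / t) * T := by
      refine le_trans ?_ (mul_le_mul_right hTle _)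
      rw [powAvg, ← ENNReal.mul_rpow_of_nonneg _ _ (by positivity), one_div]
      exact (ENNReal.le_rpow_inv_iff ht).2 hfw
    refine mul_le_mul_right ?_ _
    calc C * (P k w + T) ≤ C * (A ^ (1 / t) * T + T) := by gcongr
      _ = C * (A ^ (1 / t) + 1) * T := by ring
      _ ≤ _ := mul_le_mul_left le_self_add _
  · intro hu
    set v : X → ℝ≥0∞ := Ω.indicator fun z => ‖u z‖ₑ with hv
    have hvm : Measurable v := hu.enorm.indicator hΩ.measurableSet
    set U := powAvg μ t (10 * r) v x with hU
    obtain ⟨w, hw, hfw⟩ := hgood (hPt.add (hvm.pow_const t))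
    have hpow : ∀ a, a ^ t ≤ P k w ^ t + v w ^ t → a ≤ B * (T + U) := by
      intro a ha
      have h1 : P k w ^ t + v w ^ t ≤ A * (ballAvg μ (10 * r) (fun z => P k z ^ t) x +
          ballAvg μ (10 * r) (fun z => v z ^ t) x) := by
        rw [← ballAvg_add hPt]
        exact hfw
      calc a ≤ (A * (ballAvg μ (10 * r) (fun z => P k z ^ t) x +
            ballAvg μ (10 * r) (fun z => v z ^ t) x)) ^ (1 / t) := by
            rw [one_div]
            exact (ENNReal.le_rpow_inv_iff ht).2 (ha.trans h1)
        _ ≤ A ^ (1 / t) * (2 ^ (1 / t) * (powAvg μ t (10 * r) (P k) x + U)) := by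
            rw [ENNReal.mul_rpow_of_nonneg _ _ (by positivity)]
            exact mul_le_mul_right (ennreal_add_rpow_le _ _ (by positivity)) _
        _ ≤ A ^ (1 / t) * (2 ^ (1 / t) * (T + U)) := by gcongr
        _ = _ := by rw [← mul_assoc]
    have hPw := hpow (P k w) le_self_add
    have huw : ‖u w‖ₑ ≤ B * (T + U) := by
      refine hpow _ ?_
      rw [hv, Set.indicator_of_mem hw.1.2]
      exact le_add_self
    calc ∫⁻ z in Metric.ball x (9 * r) ∩ Ω, ‖u z‖ₑ ∂μ
        ≤ ∫⁻ z in Metric.ball x (9 * r) ∩ Ω, (‖u z - u w‖ₑ + ‖u w‖ₑ) ∂μ := by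
          refine lintegral_mono fun z => ?_
          simpa using enorm_add_le (u z - u w) (u w)
      _ = ∫⁻ z in Metric.ball x (9 * r) ∩ Ω, ‖u z - u w‖ₑ ∂μ +
            ‖u w‖ₑ * μ (Metric.ball x (9 * r) ∩ Ω) := by
          rw [lintegral_add_right _ measurable_const, setLIntegral_const]
      _ ≤ m * (C * (P k w + T)) + B * (T + U) * m := by
          refine add_le_add (hCx E u P hE hP k hk x w (hw9 w hw).1 (hw9 w hw).2)
            (mul_le_mul' huw (measure_mono ?_))
          exact inter_subset_left.trans (Metric.ball_subset_ball (by linarith))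
      _ ≤ m * (C * (B * (T + U) + (T + U))) + B * (T + U) * m :=
          add_le_add (mul_le_mul_right (mul_le_mul_right (add_le_add hPw le_self_add) _) _) le_rfl
      _ = m * ((C * (B + 1) + B) * (T + U)) := by ring
      _ ≤ _ := mul_le_mul_right (mul_le_mul_left le_add_self _) _

/-- Estimates for the integrals of a function over `Ω` against kernels. -/
theorem exists_kernel_estimates [SFinite μ] (h : DoublingOn μ Cd D)
    (hΩ : DensityOn μ Ω c) {α t : ℝ} (hα : 0 < α) (ht : 0 < t) (ht1 : t < 1) :
    ∃ C : ℝ≥0∞, C ≠ ∞ ∧ ∀ (E : Set X) (u : X → ℝ) (P : ℤ → X → ℝ≥0∞), μ E = 0 → Measurable u →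
      IsOscBound Ω E α u P → ∀ k : ℤ, 0 ≤ k → ∀ (x : X) (ε : ℝ) (K : X → ℝ),
      Metric.infDist x Ω < 4 * rad α k → IsKernelAt μ x (rad α k) ε K →
      (tailAvg μ α D t P k x ≠ ∞ → IntegrableOn (fun z => K z * u z) Ω μ) ∧
      (∫ z in Ω, K z ∂μ = 0 → ‖∫ z in Ω, K z * u z ∂μ‖ₑ ≤
        C * ENNReal.ofReal ε * tailAvg μ α D t P k x) ∧
      (‖∫ z in Ω, K z * u z ∂μ‖ₑ ≤ C * ENNReal.ofReal ε * (tailAvg μ α D t P k x +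
        powAvg μ t (10 * rad α k) (Ω.indicator fun z => ‖u z‖ₑ) x)) ∧
      (x ∈ Ω \ E → ∫ z in Ω, K z ∂μ = 1 → tailAvg μ α D t P k x ≠ ∞ →
        ‖∫ z in Ω, K z * u z ∂μ - u x‖ₑ ≤
          C * ENNReal.ofReal ε * (P k x + tailAvg μ α D t P k x)) := by
  obtain ⟨C, hC, hCx⟩ := exists_lintegral_enorm_sub_le h hΩ hα ht ht1
  obtain ⟨C', hC', hCx'⟩ := exists_lintegral_enorm_sub_le_tailAvg h hΩ hα ht ht1
  refine ⟨C + C', by finiteness, fun E u P hE hu hP k hk x ε K hx hK => ?_⟩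
  have hr0 : 0 < rad α k := rad_pos α k
  obtain ⟨⟨w, hw⟩, hw'⟩ := hCx' E u P hE hP k hk x hx
  have hKi : IntegrableOn K Ω μ := (hK.integrable h hr0).integrableOn
  have hsub : ∀ (a : ℝ) (z : X), K z * u z = K z * (u z - a) + a * K z := fun a z => by ring
  have hwK := hK.lintegral_enorm_mul_le h hr0 (g := fun z => u z - u w) hw
  have hint : ∀ a : ℝ, IntegrableOn (fun z => K z * u z) Ω μ →
      ∫ z in Ω, K z * u z ∂μ = ∫ z in Ω, K z * (u z - a) ∂μ + a * ∫ z in Ω, K z ∂μ := by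
    intro a hi
    rw [← integral_const_mul, ← integral_add]
    · exact integral_congr_ae (Filter.Eventually.of_forall fun z => hsub a z)
    · refine (hi.sub (hKi.const_mul a)).congr (Filter.Eventually.of_forall fun z => ?_)
      simp only [Pi.sub_apply]
      rw [hsub a z, add_sub_cancel_right]
    · exact hKi.const_mul a
  have hi : tailAvg μ α D t P k x ≠ ∞ → IntegrableOn (fun z => K z * u z) Ω μ := by
    intro hT
    have h1 : IntegrableOn (fun z => K z * (u z - u w)) Ω μ := by
      refine ⟨(hK.measurable.mul (hu.sub measurable_const)).aestronglyMeasurable, ?_⟩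
      exact hwK.trans_lt (ENNReal.mul_lt_top ENNReal.ofReal_lt_top
        (ENNReal.mul_lt_top hC'.lt_top hT.lt_top))
    exact (h1.add (hKi.const_mul (u w))).congr
      (Filter.Eventually.of_forall fun z => (hsub (u w) z).symm)
  have hfinal : ∀ Y : ℝ≥0∞, ENNReal.ofReal ε * (C' * Y) ≤ (C + C') * ENNReal.ofReal ε * Y := by
    intro Y
    calc ENNReal.ofReal ε * (C' * Y) = C' * ENNReal.ofReal ε * Y := by ring
      _ ≤ _ := by gcongr; exact le_add_self
  refine ⟨hi, fun h0 => ?_, ?_, fun hxΩ h1 hT => ?_⟩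
  · by_cases hi' : IntegrableOn (fun z => K z * u z) Ω μ
    · rw [hint (u w) hi', h0, mul_zero, add_zero]
      exact (enorm_integral_le_lintegral_enorm _).trans (hwK.trans (hfinal _))
    · rw [integral_undef hi']
      simp
  · exact (enorm_integral_le_lintegral_enorm _).trans
      ((hK.lintegral_enorm_mul_le h hr0 (hw' hu)).trans (hfinal _))
  · rw [hint (u x) (hi hT), h1, mul_one, add_sub_cancel_right]
    refine (enorm_integral_le_lintegral_enorm _).trans
      ((hK.lintegral_enorm_mul_le h hr0 (hCx E u P hE hP k hk x x
        (Metric.mem_ball_self (by positivity)) hxΩ)).trans ?_)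
    calc _ = C * ENNReal.ofReal ε * (P k x + tailAvg μ α D t P k x) := by ring
      _ ≤ _ := by gcongr; exact le_self_add

end KernelEstimates

section ExtensionKernels

variable [PseudoMetricSpace X] {μ : Measure X} {Cd c : ℝ≥0∞} {D : ℝ} {Ω : Set X}

/-- A cutoff equal to one within distance `r` of `Ω` and vanishing beyond distance `2 * r`. -/
def cutoff (Ω : Set X) (r : ℝ) (x : X) : ℝ := max 0 (min 1 (2 - Metric.infDist x Ω / r))

theorem cutoff_nonneg (r : ℝ) (x : X) : 0 ≤ cutoff Ω r x := le_max_left _ _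

theorem cutoff_le_one (r : ℝ) (x : X) : cutoff Ω r x ≤ 1 :=
  max_le zero_le_one (min_le_left _ _)

theorem abs_cutoff_le_one (r : ℝ) (x : X) : |cutoff Ω r x| ≤ 1 := by
  rw [abs_of_nonneg (cutoff_nonneg _ _)]
  exact cutoff_le_one _ _

theorem cutoff_eq_one {r : ℝ} (hr : 0 < r) {x : X} (hx : Metric.infDist x Ω ≤ r) :
    cutoff Ω r x = 1 := by
  have : Metric.infDist x Ω / r ≤ 1 := (div_le_one hr).2 hx
  rw [cutoff, min_eq_left (by linarith), max_eq_right zero_le_one]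

theorem cutoff_eq_zero {r : ℝ} (hr : 0 < r) {x : X} (hx : 2 * r ≤ Metric.infDist x Ω) :
    cutoff Ω r x = 0 := by
  have : 2 ≤ Metric.infDist x Ω / r := (le_div_iff₀ hr).2 hx
  exact max_eq_left ((min_le_right _ _).trans (by linarith))

theorem abs_cutoff_sub_le {r : ℝ} (hr : 0 < r) (x y : X) :
    |cutoff Ω r x - cutoff Ω r y| ≤ dist x y / r := by
  unfold cutoff
  rw [max_comm 0, max_comm 0, min_comm 1, min_comm 1]
  refine (abs_max_sub_max_le_abs _ _ _).trans ((abs_min_sub_min_le_max _ _ _ _).trans ?_)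
  rw [sub_self, abs_zero, max_eq_left (abs_nonneg _),
    show 2 - Metric.infDist x Ω / r - (2 - Metric.infDist y Ω / r) =
      (Metric.infDist y Ω - Metric.infDist x Ω) / r by ring, abs_div, abs_of_pos hr]
  gcongr
  rw [abs_sub_le_iff]
  constructor
  · have := Metric.infDist_le_infDist_add_dist (s := Ω) (x := y) (y := x)
    rw [dist_comm] at this
    linarith
  · have := Metric.infDist_le_infDist_add_dist (s := Ω) (x := x) (y := y)
    linarith

/-- The kernel of the initial term of the extension operator. -/
def initKer (μ : Measure X) (Ω : Set X) (α : ℝ) (x z : X) : ℝ :=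
  cutoff Ω (rad α 0) x * avgKer μ Ω (rad α 0) x z

/-- The kernels of the increments of the extension operator. -/
def stepKer (μ : Measure X) (Ω : Set X) (α : ℝ) (k : ℕ) (x z : X) : ℝ :=
  cutoff Ω (rad α (k + 1 : ℕ)) x *
    (avgKer μ Ω (rad α (k + 1 : ℕ)) x z - avgKer μ Ω (rad α k) x z)

theorem stepKer_eq_zero {α : ℝ} {k : ℕ} {x : X}
    (hx : 2 * rad α (k + 1 : ℕ) ≤ Metric.infDist x Ω) (z : X) : stepKer μ Ω α k x z = 0 := by
  rw [stepKer, cutoff_eq_zero (rad_pos _ _) hx, zero_mul]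

theorem rad_succ (α : ℝ) (k : ℕ) : 2 ^ α * rad α (k + 1 : ℕ) = rad α k := by
  rw [rad, rad, ← Real.rpow_add two_pos]
  push_cast
  ring_nf

variable [OpensMeasurableSpace X]

/-- Bounds for the initial kernel. -/
theorem exists_isKernelAt_initKer (h : DoublingOn μ Cd D) (hΩ : DensityOn μ Ω c) (α : ℝ) :
    ∃ A : ℝ, 0 ≤ A ∧ ∀ x, (IsKernelAt μ x (rad α 0) A (initKer μ Ω α x)) ∧
      ∀ y, dist x y ≤ rad α 0 → IsKernelAt μ x (rad α 0) (A * (dist x y / rad α 0))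
        fun z => initKer μ Ω α x z - initKer μ Ω α y z := by
  obtain ⟨A, hA, hAx⟩ := hΩ.exists_isKernelAt_avgKer h
  have hr := rad_pos α 0
  have hr1 : rad α 0 ≤ 1 := (rad_zero α).le
  refine ⟨2 * A, by positivity, fun x => ⟨?_, fun y hxy => ?_⟩⟩
  · by_cases hx : Metric.infDist x Ω < 4 * rad α 0
    · refine IsKernelAt.mono_const ((hAx x _ hr hr1 hx).1.const_mul (abs_cutoff_le_one _ x)) ?_
      linarith
    · have : initKer μ Ω α x = fun _ => 0 := by
        ext z
        rw [initKer, cutoff_eq_zero hr (by linarith), zero_mul]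
      rw [this]
      exact IsKernelAt.zero x _ (by positivity)
  · have hd : 0 ≤ dist x y / rad α 0 := by positivity
    have hxy1 := Metric.infDist_le_infDist_add_dist (s := Ω) (x := x) (y := y)
    have hxy2 := Metric.infDist_le_infDist_add_dist (s := Ω) (x := y) (y := x)
    rw [dist_comm] at hxy2
    by_cases hx : Metric.infDist x Ω < 3 * rad α 0 ∧ Metric.infDist y Ω < 3 * rad α 0
    · obtain ⟨h1, -, h3⟩ := hAx x _ hr hr1 (by linarith)
      have h4 := (h3 y (by linarith) hxy).const_mul (abs_cutoff_le_one (Ω := Ω) (rad α 0) y)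
      have h5 := h1.const_mul (abs_cutoff_sub_le (Ω := Ω) hr x y)
      refine IsKernelAt.mono_const (K := fun z => initKer μ Ω α x z - initKer μ Ω α y z)
        (ε := 1 * (A * (dist x y / rad α 0)) + dist x y / rad α 0 * A) ?_ (by linarith)
      convert h4.add h5 using 2 with z
      simp only [initKer]
      ring
    · have hx' : 2 * rad α 0 ≤ Metric.infDist x Ω ∧ 2 * rad α 0 ≤ Metric.infDist y Ω := by
        by_contra hcon
        rw [not_and_or, not_le, not_le] at hcon
        rcases hcon with h1 | h1 <;> exact hx ⟨by linarith, by linarith⟩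
      have : (fun z => initKer μ Ω α x z - initKer μ Ω α y z) = fun _ => 0 := by
        ext z
        simp only [initKer]
        rw [cutoff_eq_zero hr hx'.1, cutoff_eq_zero hr hx'.2, zero_mul, zero_mul, sub_zero]
      rw [this]
      exact IsKernelAt.zero x _ (by positivity)

/-- Bounds for the increment kernels. -/
theorem exists_isKernelAt_stepKer (h : DoublingOn μ Cd D) (hΩ : DensityOn μ Ω c) {α : ℝ}
    (hα : 0 < α) :
    ∃ A : ℝ, 0 ≤ A ∧ ∀ (k : ℕ) (x : X), (IsKernelAt μ x (rad α k) A (stepKer μ Ω α k x)) ∧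
      ∫ z in Ω, stepKer μ Ω α k x z ∂μ = 0 ∧
      ∀ y, dist x y ≤ rad α (k + 1 : ℕ) →
        IsKernelAt μ x (rad α k) (A * (dist x y / rad α k))
          fun z => stepKer μ Ω α k x z - stepKer μ Ω α k y z := by
  obtain ⟨A, hA, hAx⟩ := hΩ.exists_isKernelAt_avgKer h
  set M : ℝ := 2 ^ α with hM
  have hM0 : 0 < M := Real.rpow_pos_of_pos two_pos _
  set B := Cd.toReal * M ^ D with hB
  have hB0 : 0 ≤ B := by positivity
  refine ⟨(B * A + A) * M + (B * A * M + A), by positivity, fun k x => ?_⟩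
  have hk1 : (0 : ℤ) ≤ (k + 1 : ℕ) := by positivity
  have hr := rad_pos α k
  have hr' := rad_pos α (k + 1 : ℕ)
  have hr1 : rad α k ≤ 1 := rad_le_one hα (by positivity)
  have hr1' : rad α (k + 1 : ℕ) ≤ 1 := rad_le_one hα hk1
  have hrr : rad α (k + 1 : ℕ) ≤ rad α k := rad_anti hα (by push_cast; linarith)
  have hMr : rad α k ≤ M * rad α (k + 1 : ℕ) := (rad_succ α k).ge
  have hM1 : 1 ≤ M := Real.one_le_rpow one_le_two hα.le
  have hker : Metric.infDist x Ω < 4 * rad α (k + 1 : ℕ) → IsKernelAt μ x (rad α k) (B * A + A)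
      fun z => avgKer μ Ω (rad α (k + 1 : ℕ)) x z - avgKer μ Ω (rad α k) x z := fun hx =>
    ((hAx x _ hr' hr1' hx).1.mono_radius h hr' hrr hMr hA).sub
      (hAx x _ hr hr1 (by linarith)).1
  refine ⟨?_, ?_, fun y hxy => ?_⟩
  · by_cases hx : Metric.infDist x Ω < 4 * rad α (k + 1 : ℕ)
    · refine IsKernelAt.mono_const ((hker hx).const_mul (abs_cutoff_le_one _ x)) ?_
      have : B * A + A ≤ (B * A + A) * M := le_mul_of_one_le_right (by positivity) hM1
      have : 0 ≤ B * A * M + A := by positivity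
      linarith
    · have : stepKer μ Ω α k x = fun _ => 0 := by
        ext z
        exact stepKer_eq_zero (by linarith) z
      rw [this]
      exact IsKernelAt.zero x _ (by positivity)
  · by_cases hx : Metric.infDist x Ω < 4 * rad α (k + 1 : ℕ)
    · simp only [stepKer]
      obtain ⟨h1, h2, -⟩ := hAx x _ hr' hr1' hx
      obtain ⟨h3, h4, -⟩ := hAx x _ hr hr1 (by linarith)
      rw [integral_const_mul, integral_sub, h2, h4, sub_self, mul_zero]
      · exact (h1.integrable h hr').integrableOn
      · exact (h3.integrable h hr).integrableOn
    · simp only [stepKer_eq_zero (show 2 * rad α (k + 1 : ℕ) ≤ Metric.infDist x Ω by linarith)]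
      simp
  · have hd : 0 ≤ dist x y / rad α k := by positivity
    have hxy1 := Metric.infDist_le_infDist_add_dist (s := Ω) (x := x) (y := y)
    have hxy2 := Metric.infDist_le_infDist_add_dist (s := Ω) (x := y) (y := x)
    rw [dist_comm] at hxy2
    have hdd : dist x y / rad α (k + 1 : ℕ) = M * (dist x y / rad α k) := by
      rw [← rad_succ α k, hM]
      field_simp
    by_cases hx : Metric.infDist x Ω < 3 * rad α (k + 1 : ℕ) ∧
        Metric.infDist y Ω < 3 * rad α (k + 1 : ℕ)
    · obtain ⟨-, -, h1⟩ := hAx x _ hr' hr1' (by linarith)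
      obtain ⟨-, -, h2⟩ := hAx x _ hr hr1 (by linarith)
      have h3 := ((h1 y (by linarith) hxy).mono_radius h hr' hrr hMr (by positivity)).sub
        (h2 y (by linarith) (hxy.trans hrr))
      have h4 := h3.const_mul (abs_cutoff_le_one (Ω := Ω) (rad α (k + 1 : ℕ)) y)
      have h5 := (hker (by linarith)).const_mul (abs_cutoff_sub_le (Ω := Ω) hr' x y)
      rw [hdd] at h4 h5
      refine IsKernelAt.mono_const (K := fun z => stepKer μ Ω α k x z - stepKer μ Ω α k y z)
        (ε := 1 * (B * (A * (M * (dist x y / rad α k))) + A * (dist x y / rad α k)) +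
          M * (dist x y / rad α k) * (B * A + A)) ?_ (le_of_eq (by ring))
      convert h4.add h5 using 2 with z
      simp only [stepKer]
      ring
    · have hx' : 2 * rad α (k + 1 : ℕ) ≤ Metric.infDist x Ω ∧
          2 * rad α (k + 1 : ℕ) ≤ Metric.infDist y Ω := by
        by_contra hcon
        rw [not_and_or, not_le, not_le] at hcon
        rcases hcon with h1 | h1 <;> exact hx ⟨by linarith, by linarith⟩
      simp only [stepKer_eq_zero hx'.1, stepKer_eq_zero hx'.2, sub_zero]
      exact IsKernelAt.zero x _ (by positivity)

end ExtensionKernels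

section ExtensionSums

variable [PseudoMetricSpace X] {μ : Measure X} {Cd c : ℝ≥0∞} {D : ℝ} {Ω : Set X}

/-- The initial term of the extension of `u`. -/
def extInit (μ : Measure X) (Ω : Set X) (α : ℝ) (u : X → ℝ) (x : X) : ℝ :=
  ∫ z in Ω, initKer μ Ω α x z * u z ∂μ

/-- The increments of the extension of `u`. -/
def extStep (μ : Measure X) (Ω : Set X) (α : ℝ) (u : X → ℝ) (k : ℕ) (x : X) : ℝ :=
  ∫ z in Ω, stepKer μ Ω α k x z * u z ∂μ

/-- The approximations of the extension of `u`. -/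
def extSum (μ : Measure X) (Ω : Set X) (α : ℝ) (u : X → ℝ) (K : ℕ) (x : X) : ℝ :=
  extInit μ Ω α u x + ∑ k ∈ Finset.range K, extStep μ Ω α u k x

/-- The mean of `|u|` over `Ω` at unit scale. -/
def unitAvg (μ : Measure X) (Ω : Set X) (α t : ℝ) (u : X → ℝ) (x : X) : ℝ≥0∞ :=
  powAvg μ t (10 * rad α 0) (Ω.indicator fun z => ‖u z‖ₑ) x

variable [OpensMeasurableSpace X] [SecondCountableTopology X]

theorem exists_extInit_estimates [SFinite μ] (h : DoublingOn μ Cd D) (hΩ : DensityOn μ Ω c)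
    {α t : ℝ} (hα : 0 < α) (ht : 0 < t) (ht1 : t < 1) :
    ∃ C : ℝ≥0∞, C ≠ ∞ ∧ ∀ (E : Set X) (u : X → ℝ) (P : ℤ → X → ℝ≥0∞), μ E = 0 → Measurable u →
      IsOscBound Ω E α u P → (∀ k, 0 ≤ k → ∀ x, tailAvg μ α D t P k x ≠ ∞) →
      ∀ x, IntegrableOn (fun z => initKer μ Ω α x z * u z) Ω μ ∧
        ‖extInit μ Ω α u x‖ₑ ≤ C * (tailAvg μ α D t P 0 x + unitAvg μ Ω α t u x) ∧
        ∀ y, dist x y ≤ rad α 0 → ‖extInit μ Ω α u x - extInit μ Ω α u y‖ₑ ≤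
          C * ENNReal.ofReal (dist x y / rad α 0) *
            (tailAvg μ α D t P 0 x + unitAvg μ Ω α t u x) := by
  obtain ⟨C, hC, hCx⟩ := exists_kernel_estimates h hΩ hα ht ht1
  obtain ⟨A, hA, hAx⟩ := exists_isKernelAt_initKer h hΩ α
  refine ⟨C * ENNReal.ofReal A, by finiteness, fun E u P hE hu hP hfin => ?_⟩
  have hr := rad_pos α 0
  have hzero : ∀ x, 2 * rad α 0 ≤ Metric.infDist x Ω → ∀ z, initKer μ Ω α x z = 0 :=
    fun x hx z => by rw [initKer, cutoff_eq_zero hr hx, zero_mul]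
  have hint : ∀ x, IntegrableOn (fun z => initKer μ Ω α x z * u z) Ω μ := by
    intro x
    by_cases hx : Metric.infDist x Ω < 4 * rad α 0
    · exact (hCx E u P hE hu hP 0 le_rfl x A _ hx (hAx x).1).1 (hfin 0 le_rfl x)
    · simp only [hzero x (by linarith), zero_mul]
      exact integrableOn_zero
  refine fun x => ⟨hint x, ?_, fun y hxy => ?_⟩
  · by_cases hx : Metric.infDist x Ω < 4 * rad α 0
    · exact (hCx E u P hE hu hP 0 le_rfl x A _ hx (hAx x).1).2.2.1
    · simp only [extInit, hzero x (by linarith), zero_mul, integral_zero, enorm_zero]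
      exact zero_le
  · have hsub : extInit μ Ω α u x - extInit μ Ω α u y =
        ∫ z in Ω, (initKer μ Ω α x z - initKer μ Ω α y z) * u z ∂μ := by
      simp only [extInit, sub_mul]
      exact (integral_sub (hint x) (hint y)).symm
    rw [hsub]
    by_cases hx : Metric.infDist x Ω < 4 * rad α 0
    · have := (hCx E u P hE hu hP 0 le_rfl x _ _ hx ((hAx x).2 y hxy)).2.2.1
      rwa [ENNReal.ofReal_mul hA, ← mul_assoc] at this
    · have hxy1 := Metric.infDist_le_infDist_add_dist (s := Ω) (x := x) (y := y)
      simp only [hzero x (by linarith), hzero y (by linarith), sub_zero, zero_mul, integral_zero,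
        enorm_zero]
      exact zero_le

theorem exists_extStep_estimates [SFinite μ] (h : DoublingOn μ Cd D) (hΩ : DensityOn μ Ω c)
    {α t : ℝ} (hα : 0 < α) (ht : 0 < t) (ht1 : t < 1) :
    ∃ C : ℝ≥0∞, C ≠ ∞ ∧ ∀ (E : Set X) (u : X → ℝ) (P : ℤ → X → ℝ≥0∞), μ E = 0 → Measurable u →
      IsOscBound Ω E α u P → (∀ k, 0 ≤ k → ∀ x, tailAvg μ α D t P k x ≠ ∞) →
      ∀ (k : ℕ) (x : X), IntegrableOn (fun z => stepKer μ Ω α k x z * u z) Ω μ ∧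
        ‖extStep μ Ω α u k x‖ₑ ≤ C * tailAvg μ α D t P k x ∧
        ∀ y, dist x y ≤ rad α (k + 1 : ℕ) → ‖extStep μ Ω α u k x - extStep μ Ω α u k y‖ₑ ≤
          C * ENNReal.ofReal (dist x y / rad α k) * tailAvg μ α D t P k x := by
  obtain ⟨C, hC, hCx⟩ := exists_kernel_estimates h hΩ hα ht ht1
  obtain ⟨A, hA, hAx⟩ := exists_isKernelAt_stepKer h hΩ hα
  refine ⟨C * ENNReal.ofReal A, by finiteness, fun E u P hE hu hP hfin k => ?_⟩
  have hk : (0 : ℤ) ≤ k := by positivity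
  have hr := rad_pos α k
  have hrr : rad α (k + 1 : ℕ) ≤ rad α k := rad_anti hα (by push_cast; linarith)
  have hint : ∀ x, IntegrableOn (fun z => stepKer μ Ω α k x z * u z) Ω μ := by
    intro x
    by_cases hx : Metric.infDist x Ω < 4 * rad α k
    · exact (hCx E u P hE hu hP k hk x A _ hx (hAx k x).1).1 (hfin k hk x)
    · simp only [stepKer_eq_zero (show 2 * rad α (k + 1 : ℕ) ≤ Metric.infDist x Ω by linarith),
        zero_mul]
      exact integrableOn_zero
  refine fun x => ⟨hint x, ?_, fun y hxy => ?_⟩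
  · by_cases hx : Metric.infDist x Ω < 4 * rad α k
    · exact (hCx E u P hE hu hP k hk x A _ hx (hAx k x).1).2.1 (hAx k x).2.1
    · simp only [extStep, stepKer_eq_zero
        (show 2 * rad α (k + 1 : ℕ) ≤ Metric.infDist x Ω by linarith), zero_mul, integral_zero,
        enorm_zero]
      exact zero_le
  · have hsub : extStep μ Ω α u k x - extStep μ Ω α u k y =
        ∫ z in Ω, (stepKer μ Ω α k x z - stepKer μ Ω α k y z) * u z ∂μ := by
      simp only [extStep, sub_mul]
      exact (integral_sub (hint x) (hint y)).symm
    rw [hsub]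
    by_cases hx : Metric.infDist x Ω < 4 * rad α k
    · have h0 : ∫ z in Ω, (stepKer μ Ω α k x z - stepKer μ Ω α k y z) ∂μ = 0 := by
        rw [integral_sub, (hAx k x).2.1, (hAx k y).2.1, sub_zero]
        · exact ((hAx k x).1.integrable h hr).integrableOn
        · exact ((hAx k y).1.integrable h hr).integrableOn
      have := (hCx E u P hE hu hP k hk x _ _ hx ((hAx k x).2.2 y hxy)).2.1 h0
      rwa [ENNReal.ofReal_mul hA, ← mul_assoc] at this
    · have hxy1 := Metric.infDist_le_infDist_add_dist (s := Ω) (x := x) (y := y)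
      simp only [stepKer_eq_zero (show 2 * rad α (k + 1 : ℕ) ≤ Metric.infDist x Ω by linarith),
        stepKer_eq_zero (show 2 * rad α (k + 1 : ℕ) ≤ Metric.infDist y Ω by linarith), sub_zero,
        zero_mul, integral_zero, enorm_zero]
      exact zero_le

/-- Near `Ω` the approximations telescope to a single average. -/
theorem exists_extSum_estimates [SFinite μ] (h : DoublingOn μ Cd D) (hΩ : DensityOn μ Ω c)
    {α t : ℝ} (hα : 0 < α) (ht : 0 < t) (ht1 : t < 1) :
    ∃ C : ℝ≥0∞, C ≠ ∞ ∧ ∀ (E : Set X) (u : X → ℝ) (P : ℤ → X → ℝ≥0∞), μ E = 0 → Measurable u →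
      IsOscBound Ω E α u P → (∀ k, 0 ≤ k → ∀ x, tailAvg μ α D t P k x ≠ ∞) →
      ∀ (m : ℕ) (x : X), Metric.infDist x Ω ≤ rad α m →
        (x ∈ Ω \ E → ‖extSum μ Ω α u m x - u x‖ₑ ≤ C * (P m x + tailAvg μ α D t P m x)) ∧
        ∀ y, Metric.infDist y Ω ≤ rad α m → dist x y ≤ rad α m →
          ‖extSum μ Ω α u m x - extSum μ Ω α u m y‖ₑ ≤
            C * ENNReal.ofReal (dist x y / rad α m) * tailAvg μ α D t P m x := by
  obtain ⟨C, hC, hCx⟩ := exists_kernel_estimates h hΩ hα ht ht1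
  obtain ⟨A, hA, hAx⟩ := hΩ.exists_isKernelAt_avgKer h
  refine ⟨C * ENNReal.ofReal A, by finiteness, fun E u P hE hu hP hfin m x hx => ?_⟩
  have hr0 : ∀ j : ℕ, 0 < rad α j := fun j => rad_pos α j
  have hr1 : ∀ j : ℕ, rad α j ≤ 1 := fun j => rad_le_one hα (by positivity)
  have hker : ∀ (j : ℕ) (x : X), Metric.infDist x Ω ≤ rad α j →
      IsKernelAt μ x (rad α j) A (avgKer μ Ω (rad α j) x) ∧
        ∫ z in Ω, avgKer μ Ω (rad α j) x z ∂μ = 1 ∧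
        IntegrableOn (fun z => avgKer μ Ω (rad α j) x z * u z) Ω μ := by
    intro j x hx
    have hx' : Metric.infDist x Ω < 4 * rad α j := by linarith [hr0 j]
    obtain ⟨h1, h2, -⟩ := hAx x _ (hr0 j) (hr1 j) hx'
    exact ⟨h1, h2, (hCx E u P hE hu hP j (by positivity) x A _ hx' h1).1
      (hfin j (by positivity) x)⟩
  have hsum : ∀ (m : ℕ) (x : X), Metric.infDist x Ω ≤ rad α m →
      extSum μ Ω α u m x = ∫ z in Ω, avgKer μ Ω (rad α m) x z * u z ∂μ := by
    intro m
    induction m with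
    | zero =>
      intro x hx
      simp only [Nat.cast_zero] at hx
      simp only [extSum, Finset.range_zero, Finset.sum_empty, add_zero, extInit, initKer,
        cutoff_eq_one (rad_pos α 0) hx, one_mul, Nat.cast_zero]
    | succ m ih =>
      intro x hx
      have hx' : Metric.infDist x Ω ≤ rad α m :=
        hx.trans (rad_anti hα (by push_cast; linarith))
      have h1 : extStep μ Ω α u m x = ∫ z in Ω, avgKer μ Ω (rad α (m + 1 : ℕ)) x z * u z ∂μ -
          ∫ z in Ω, avgKer μ Ω (rad α m) x z * u z ∂μ := by
        rw [← integral_sub (hker _ x hx).2.2 (hker _ x hx').2.2]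
        simp only [extStep, stepKer, cutoff_eq_one (rad_pos α _) hx, one_mul, sub_mul]
      have h2 : extSum μ Ω α u (m + 1) x = extSum μ Ω α u m x + extStep μ Ω α u m x := by
        rw [extSum, extSum, Finset.sum_range_succ, add_assoc]
      rw [h2, ih x hx', h1]
      ring
  have hx' : Metric.infDist x Ω < 4 * rad α m := by linarith [hr0 m]
  have hm : (0 : ℤ) ≤ m := by positivity
  refine ⟨fun hxΩ => ?_, fun y hy hxy => ?_⟩
  · rw [hsum m x hx]
    exact (hCx E u P hE hu hP m hm x A _ hx' (hker m x hx).1).2.2.2 hxΩ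
      (hker m x hx).2.1 (hfin m hm x)
  · have hy' : Metric.infDist y Ω < 4 * rad α m := by linarith [hr0 m]
    rw [hsum m x hx, hsum m y hy, ← integral_sub (hker m x hx).2.2 (hker m y hy).2.2]
    have hK := (hAx x _ (hr0 m) (hr1 m) hx').2.2 y hy' hxy
    have h0 : ∫ z in Ω, (avgKer μ Ω (rad α m) x z - avgKer μ Ω (rad α m) y z) ∂μ = 0 := by
      rw [integral_sub, (hker m x hx).2.1, (hker m y hy).2.1, sub_self]
      · exact ((hker m x hx).1.integrable h (hr0 m)).integrableOn
      · exact ((hker m y hy).1.integrable h (hr0 m)).integrableOn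
    have := (hCx E u P hE hu hP m hm x _ _ hx' hK).2.1 h0
    rw [ENNReal.ofReal_mul hA, ← mul_assoc] at this
    simpa only [sub_mul] using this

/-- The supremum of the earlier terms of a sequence, damped exponentially. -/
def supTail (α : ℝ) (a : ℤ → ℝ≥0∞) (n : ℤ) : ℝ≥0∞ :=
  ⨆ i : ℕ, ENNReal.ofReal (rad α i) * a (n - i)

/-- The averages controlling the extension of `u`. -/
def extBound (μ : Measure X) (Ω : Set X) (α D t : ℝ) (u : X → ℝ) (P : ℤ → X → ℝ≥0∞) (k : ℤ)
    (x : X) : ℝ≥0∞ :=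
  tailAvg μ α D t P k x + (Pi.single 0 (unitAvg μ Ω α t u x) : ℤ → ℝ≥0∞) k

theorem tailAvg_le_extBound (α t : ℝ) (u : X → ℝ) (P : ℤ → X → ℝ≥0∞) (k : ℤ) (x : X) :
    tailAvg μ α D t P k x ≤ extBound μ Ω α D t u P k x := le_self_add

theorem le_supTail {α : ℝ} (a : ℤ → ℝ≥0∞) {k n : ℕ} (hkn : k ≤ n) {d : ℝ} (hd : d ≤ rad α n) :
    ENNReal.ofReal (d / rad α k) * a k ≤ supTail α a n := by
  have h1 := le_iSup (fun i : ℕ => ENNReal.ofReal (rad α i) * a (n - i)) (n - k)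
  refine le_trans ?_ h1
  have h2 : (n : ℤ) - ((n - k : ℕ) : ℤ) = k := by push_cast [hkn]; ring
  rw [h2]
  gcongr
  rw [div_le_iff₀ (rad_pos _ _), ← rad_add]
  refine hd.trans_eq ?_
  congr 1
  push_cast [hkn]
  ring

theorem exists_enorm_extSum_sub_le [SFinite μ] (h : DoublingOn μ Cd D) (hΩ : DensityOn μ Ω c)
    {α t : ℝ} (hα : 0 < α) (ht : 0 < t) (ht1 : t < 1) :
    ∃ C : ℝ≥0∞, C ≠ ∞ ∧ ∀ (E : Set X) (u : X → ℝ) (P : ℤ → X → ℝ≥0∞), μ E = 0 → Measurable u →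
      IsOscBound Ω E α u P → (∀ k, 0 ≤ k → ∀ x, tailAvg μ α D t P k x ≠ ∞) →
      ∀ (n : ℕ) (x y : X), dist x y ≤ rad α n / 4 → ∀ K, n ≤ K →
        ‖extSum μ Ω α u K x - extSum μ Ω α u K y‖ₑ ≤
          C * (supTail α (fun k => extBound μ Ω α D t u P k x) n +
            ∑' i : ℕ, (tailAvg μ α D t P (n + i) x + tailAvg μ α D t P (n + i) y)) := by
  obtain ⟨C₀, hC₀, hI⟩ := exists_extInit_estimates h hΩ hα ht ht1
  obtain ⟨C₁, hC₁, hS⟩ := exists_extStep_estimates h hΩ hα ht ht1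
  obtain ⟨C₂, hC₂, hT⟩ := exists_extSum_estimates h hΩ hα ht ht1
  obtain ⟨N, hN⟩ : ∃ N : ℕ, rad α N ≤ 3 / 8 := by
    have h1 : (2 : ℝ) ^ (-α) < 1 := Real.rpow_lt_one_of_one_lt_of_neg one_lt_two (by linarith)
    obtain ⟨N, hN⟩ := exists_pow_lt_of_lt_one (show (0 : ℝ) < 3 / 8 by norm_num) h1
    refine ⟨N, le_trans (le_of_eq ?_) hN.le⟩
    rw [rad, ← Real.rpow_natCast, ← Real.rpow_mul two_pos.le]
    push_cast
    ring_nf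
  refine ⟨C₀ + C₂ + N * C₁ + C₁, by finiteness, fun E u P hE hu hP hfin n x y hxy K hK => ?_⟩
  set R : ℤ → X → ℝ≥0∞ := tailAvg μ α D t P with hR
  set S := supTail α (fun k => extBound μ Ω α D t u P k x) n with hSdef
  have hn := rad_pos α n
  have hxyn : dist x y ≤ rad α n := by linarith
  have hmono : ∀ {j : ℕ}, j ≤ n → rad α n ≤ rad α j := fun hj => rad_anti hα (by exact_mod_cast hj)
  have hSk : ∀ k : ℕ, k ≤ n → ENNReal.ofReal (dist x y / rad α k) * R k x ≤ S := fun k hk =>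
    le_trans (by gcongr; exact tailAvg_le_extBound α t u P k x) (le_supTail _ hk hxyn)
  -- a starting index at which the increments become manageable
  obtain ⟨m, hmn, hm, hrest⟩ : ∃ m : ℕ, m ≤ n ∧
      ‖extSum μ Ω α u m x - extSum μ Ω α u m y‖ₑ ≤ (C₀ + C₂) * S ∧
      ∀ k : ℕ, k < n → m + N ≤ k → 2 * rad α (k + 1 : ℕ) ≤ Metric.infDist x Ω ∧
        2 * rad α (k + 1 : ℕ) ≤ Metric.infDist y Ω := by
    have hxy1 := Metric.infDist_le_infDist_add_dist (s := Ω) (x := x) (y := y)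
    have hxy2 := Metric.infDist_le_infDist_add_dist (s := Ω) (x := y) (y := x)
    rw [dist_comm] at hxy2
    have hfar : ∀ j k : ℕ, j ≤ n → j + N ≤ k + 1 →
        ¬ (Metric.infDist x Ω ≤ rad α j ∧ Metric.infDist y Ω ≤ rad α j) →
        2 * rad α (k + 1 : ℕ) ≤ Metric.infDist x Ω ∧
          2 * rad α (k + 1 : ℕ) ≤ Metric.infDist y Ω := by
      intro j k hj hjk hnear
      have h1 : rad α (k + 1 : ℕ) ≤ rad α j * (3 / 8) := by
        calc rad α (k + 1 : ℕ) ≤ rad α (j + N) := rad_anti hα (by exact_mod_cast hjk)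
          _ = rad α j * rad α N := rad_add _ _ _
          _ ≤ _ := by gcongr; exact (rad_pos _ _).le
      have h2 := hmono hj
      rw [not_and_or, not_le, not_le] at hnear
      rcases hnear with h3 | h3 <;> constructor <;> linarith
    by_cases h0 : Metric.infDist x Ω ≤ rad α (0 : ℕ) ∧ Metric.infDist y Ω ≤ rad α (0 : ℕ)
    · classical
      set p : ℕ → Prop := fun j => Metric.infDist x Ω ≤ rad α j ∧ Metric.infDist y Ω ≤ rad α j
      have hpm : p (Nat.findGreatest p n) := Nat.findGreatest_spec (Nat.zero_le n) h0
      refine ⟨Nat.findGreatest p n, Nat.findGreatest_le n, ?_, fun k hkn hk => ?_⟩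
      · refine ((hT E u P hE hu hP hfin _ x hpm.1).2 y hpm.2
          (hxyn.trans (hmono (Nat.findGreatest_le n)))).trans ?_
        rw [mul_assoc]
        exact mul_le_mul' le_add_self (hSk _ (Nat.findGreatest_le n))
      · refine hfar (Nat.findGreatest p n + 1) k (by omega) (by omega) ?_
        exact Nat.findGreatest_is_greatest (P := p) (n := n) (Nat.lt_succ_self _) (by omega)
    · refine ⟨0, Nat.zero_le n, ?_, fun k hkn hk => hfar 0 k (Nat.zero_le n) (by omega) h0⟩
      simp only [extSum, Finset.range_zero, Finset.sum_empty, add_zero]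
      refine ((hI E u P hE hu hP hfin x).2.2 y (hxyn.trans (hmono (Nat.zero_le n)))).trans ?_
      rw [mul_assoc]
      refine mul_le_mul' le_self_add ?_
      have := le_supTail (fun k => extBound μ Ω α D t u P k x) (Nat.zero_le n) hxyn
      rw [← hSdef] at this
      simpa [extBound] using this
  have hsplit : extSum μ Ω α u K x - extSum μ Ω α u K y =
      (extSum μ Ω α u m x - extSum μ Ω α u m y) +
      (∑ k ∈ Finset.Ico m n, (extStep μ Ω α u k x - extStep μ Ω α u k y) +
        ∑ k ∈ Finset.Ico n K, (extStep μ Ω α u k x - extStep μ Ω α u k y)) := by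
    have h1 : ∀ z, extSum μ Ω α u K z = extSum μ Ω α u m z +
        (∑ k ∈ Finset.Ico m n, extStep μ Ω α u k z +
          ∑ k ∈ Finset.Ico n K, extStep μ Ω α u k z) := by
      intro z
      rw [Finset.sum_Ico_consecutive _ hmn hK, extSum, extSum, add_assoc,
        Finset.sum_range_add_sum_Ico _ (hmn.trans hK)]
    rw [h1, h1, Finset.sum_sub_distrib, Finset.sum_sub_distrib]
    ring
  have hmid : ‖∑ k ∈ Finset.Ico m n, (extStep μ Ω α u k x - extStep μ Ω α u k y)‖ₑ ≤
      N * C₁ * S := by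
    have hterm : ∀ k ∈ Finset.Ico m n, ‖extStep μ Ω α u k x - extStep μ Ω α u k y‖ₑ ≤
        if k < m + N then C₁ * S else 0 := by
      intro k hk
      rw [Finset.mem_Ico] at hk
      split_ifs with hkN
      · refine ((hS E u P hE hu hP hfin k x).2.2 y (hxyn.trans (hmono hk.2))).trans ?_
        rw [mul_assoc]
        exact mul_le_mul_right (hSk k hk.2.le) _
      · obtain ⟨h1, h2⟩ := hrest k hk.2 (not_lt.1 hkN)
        simp [extStep, stepKer_eq_zero h1, stepKer_eq_zero h2]
    calc _ ≤ ∑ k ∈ Finset.Ico m n, ‖extStep μ Ω α u k x - extStep μ Ω α u k y‖ₑ :=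
          enorm_sum_le _ _
      _ ≤ ∑ k ∈ Finset.Ico m n, if k < m + N then C₁ * S else 0 := Finset.sum_le_sum hterm
      _ = ∑ k ∈ (Finset.Ico m n).filter (· < m + N), C₁ * S := (Finset.sum_filter _ _).symm
      _ ≤ ∑ k ∈ Finset.Ico m (m + N), C₁ * S := by
          refine Finset.sum_le_sum_of_subset fun k hk => ?_
          simp only [Finset.mem_filter, Finset.mem_Ico] at hk ⊢
          exact ⟨hk.1.1, hk.2⟩
      _ = N * C₁ * S := by
          rw [Finset.sum_const, Nat.card_Ico, Nat.add_sub_cancel_left, nsmul_eq_mul, mul_assoc]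
  have htail : ‖∑ k ∈ Finset.Ico n K, (extStep μ Ω α u k x - extStep μ Ω α u k y)‖ₑ ≤
      C₁ * ∑' i : ℕ, (R (n + i) x + R (n + i) y) := by
    calc _ ≤ ∑ k ∈ Finset.Ico n K, ‖extStep μ Ω α u k x - extStep μ Ω α u k y‖ₑ :=
          enorm_sum_le _ _
      _ ≤ ∑ k ∈ Finset.Ico n K, C₁ * (R k x + R k y) := by
          refine Finset.sum_le_sum fun k _ => ?_
          refine enorm_sub_le.trans ?_
          rw [mul_add]
          exact add_le_add (hS E u P hE hu hP hfin k x).2.1 (hS E u P hE hu hP hfin k y).2.1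
      _ = ∑ i ∈ Finset.range (K - n), C₁ * (R (n + i) x + R (n + i) y) := by
          rw [Finset.sum_Ico_eq_sum_range]
          push_cast
          rfl
      _ ≤ ∑' i : ℕ, C₁ * (R (n + i) x + R (n + i) y) := ENNReal.sum_le_tsum _
      _ = _ := ENNReal.tsum_mul_left
  set Z := ∑' i : ℕ, (R (n + i) x + R (n + i) y)
  rw [hsplit]
  calc _ ≤ (C₀ + C₂) * S + (N * C₁ * S + C₁ * Z) :=
        (enorm_add_le _ _).trans (add_le_add hm ((enorm_add_le _ _).trans (add_le_add hmid htail)))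
    _ = (C₀ + C₂ + N * C₁) * S + C₁ * Z := by ring
    _ ≤ (C₀ + C₂ + N * C₁ + C₁) * S + (C₀ + C₂ + N * C₁ + C₁) * Z :=
        add_le_add (mul_le_mul_left le_self_add _) (mul_le_mul_left le_add_self _)
    _ = _ := by rw [mul_add]

end ExtensionSums

section WeightedNorms

/-- The dyadic weight `2 ^ (s * k)`. -/
def wt (s : ℝ) (k : ℤ) : ℝ≥0∞ := ENNReal.ofReal (rad s (-k))

theorem wt_zero (s : ℝ) : wt s 0 = 1 := by simp [wt, rad_zero]

theorem wt_ne_top (s : ℝ) (k : ℤ) : wt s k ≠ ∞ := ENNReal.ofReal_ne_top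

theorem wt_ne_zero (s : ℝ) (k : ℤ) : wt s k ≠ 0 := by
  simpa [wt] using rad_pos s (-k)

theorem wt_add (s : ℝ) (k l : ℤ) : wt s (k + l) = wt s k * wt s l := by
  rw [wt, wt, wt, neg_add, rad_add, ENNReal.ofReal_mul (rad_pos _ _).le]

theorem wt_mul_wt_neg (a b : ℝ) (k : ℤ) : wt a k * wt b (-k) = wt (a - b) k := by
  rw [wt, wt, wt, ← ENNReal.ofReal_mul (rad_pos _ _).le, rad, rad, rad,
    ← Real.rpow_add two_pos]
  congr 2
  push_cast
  ring

theorem wt_natCast (s : ℝ) (i : ℕ) : wt s i = wt s 1 ^ i := by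
  induction i with
  | zero => simp [wt_zero]
  | succ i ih => rw [Nat.cast_succ, wt_add, ih, pow_succ]

theorem wt_one_lt_one {s : ℝ} (hs : s < 0) : wt s 1 < 1 := by
  rw [wt, ENNReal.ofReal_lt_one, rad]
  refine Real.rpow_lt_one_of_one_lt_of_neg one_lt_two ?_
  push_cast
  linarith

theorem wt_neg_mul_wt (s : ℝ) (k : ℤ) : wt s (-k) * wt s k = 1 := by
  rw [← wt_add, neg_add_cancel, wt_zero]

theorem ofReal_rad (s : ℝ) (k : ℤ) : ENNReal.ofReal (rad s k) = wt s (-k) := by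
  rw [wt, neg_neg]

/-- The weighted sums appearing in the modulus of continuity of the extension. -/
def modSum (α : ℝ) (a : ℤ → ℝ≥0∞) (n : ℤ) : ℝ≥0∞ := supTail α a n + ∑' i : ℕ, a (n + i)

theorem exists_lqN_modSum_le {q : ℝ≥0∞} (hq : 0 < q) {s α : ℝ} (hs : 0 < s)
    (hsα : s < α ∨ (q = ∞ ∧ s ≤ α)) :
    ∃ C : ℝ≥0∞, C ≠ ∞ ∧ ∀ a : ℤ → ℝ≥0∞,
      lqN q (fun n => wt s n * modSum α a n) ≤ C * lqN q (fun n => wt s n * a n) := by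
  obtain ⟨C₁, hC₁, h1⟩ := lqN_add_le hq
  obtain ⟨C₂, hC₂, h2⟩ := lqN_geometric_conv_le hq (wt_one_lt_one (neg_lt_zero.2 hs))
    (fun i => (i : ℤ))
  have hsup : ∃ C : ℝ≥0∞, C ≠ ∞ ∧ ∀ a : ℤ → ℝ≥0∞,
      lqN q (fun n => wt s n * supTail α a n) ≤ C * lqN q (fun n => wt s n * a n) := by
    have hterm : ∀ (a : ℤ → ℝ≥0∞) (n : ℤ) (i : ℕ),
        wt s n * (ENNReal.ofReal (rad α i) * a (n - i)) =
          wt (s - α) 1 ^ i * (wt s (n - i) * a (n - i)) := by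
      intro a n i
      rw [← wt_natCast, ← wt_mul_wt_neg, ofReal_rad]
      conv_lhs => rw [show n = (n - i) + i by ring, wt_add]
      ring_nf
    rcases hsα with hsα | ⟨rfl, hsα⟩
    · obtain ⟨C, hC, h3⟩ := lqN_geometric_conv_le hq (wt_one_lt_one (sub_neg.2 hsα))
        (fun i => -(i : ℤ))
      refine ⟨C, hC, fun a => le_trans (lqN_mono fun n => ?_) (h3 _)⟩
      rw [supTail, ENNReal.mul_iSup]
      refine iSup_le fun i => ?_
      rw [hterm, sub_eq_add_neg n]
      exact ENNReal.le_tsum (f := fun i : ℕ => wt (s - α) 1 ^ i *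
        (wt s (n + -(i : ℤ)) * a (n + -(i : ℤ)))) i
    · refine ⟨1, ENNReal.one_ne_top, fun a => ?_⟩
      rw [one_mul]
      conv_lhs => rw [lqN, if_pos rfl]
      refine iSup_le fun n => ?_
      rw [supTail, ENNReal.mul_iSup]
      refine iSup_le fun i => ?_
      rw [hterm]
      refine le_trans (mul_le_of_le_one_left zero_le (pow_le_one' ?_ i))
        (le_lqN hq (fun n => wt s n * a n) (n - i))
      rw [wt, ENNReal.ofReal_le_one, rad]
      refine Real.rpow_le_one_of_one_le_of_nonpos one_lt_two.le ?_
      push_cast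
      linarith
  obtain ⟨C₃, hC₃, h3⟩ := hsup
  refine ⟨C₁ * (C₃ + C₂), by finiteness, fun a => ?_⟩
  simp only [modSum, mul_add]
  refine (h1 _ _).trans ?_
  rw [← mul_add, mul_assoc, add_mul]
  refine mul_le_mul_right (add_le_add (h3 a) (le_trans (le_of_eq ?_) (h2 _))) _
  congr 1
  ext n
  rw [← ENNReal.tsum_mul_left]
  congr 1
  ext i
  rw [wt_add, ← wt_natCast, mul_assoc, mul_left_comm, ← mul_assoc (wt (-s) i)]
  have : wt (-s) i * wt s i = 1 := by
    have := wt_mul_wt_neg (-s) (-s) i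
    rw [show wt s i = wt (-s) (-i) by simp [wt, rad], this]
    simp [wt, rad]
  rw [this, one_mul]

variable [PseudoMetricSpace X] {μ : Measure X} {Cd c : ℝ≥0∞} {D : ℝ} {Ω : Set X}

theorem powAvg_const_mul {t : ℝ} (ht : 0 < t) (r : ℝ) {a : ℝ≥0∞} (ha : a ≠ ∞) (f : X → ℝ≥0∞)
    (x : X) : powAvg μ t r (fun z => a * f z) x = a * powAvg μ t r f x := by
  unfold powAvg
  simp only [ENNReal.mul_rpow_of_nonneg _ _ ht.le]
  rw [ballAvg_const_mul _ (by finiteness), ENNReal.mul_rpow_of_nonneg _ _ (by positivity),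
    ← ENNReal.rpow_mul, mul_one_div_cancel ht.ne', ENNReal.rpow_one]

theorem powAvg_mono {t : ℝ} (ht : 0 < t) (r : ℝ) {f g : X → ℝ≥0∞} (hfg : ∀ x, f x ≤ g x)
    (x : X) : powAvg μ t r f x ≤ powAvg μ t r g x :=
  ENNReal.rpow_le_rpow (ballAvg_mono (fun z => ENNReal.rpow_le_rpow (hfg z) ht.le) x)
    (by positivity)

theorem powAvg_ne_top (h : DoublingOn μ Cd D) {t p r : ℝ} (ht : 0 < t) (htp : t ≤ p) (hr : 0 < r)
    {f : X → ℝ≥0∞} (hf : ∫⁻ z, f z ^ p ∂μ ≠ ∞) (x : X) : powAvg μ t r f x ≠ ∞ := by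
  refine ENNReal.rpow_ne_top_of_nonneg (by positivity) (ENNReal.mul_ne_top
    (ENNReal.inv_ne_top.2 (h.ball_pos x r hr).ne') (ne_of_lt ?_))
  have hp : 0 < p := ht.trans_le htp
  calc ∫⁻ z in Metric.ball x r, f z ^ t ∂μ
      ≤ ∫⁻ z in Metric.ball x r, (1 + f z ^ p) ∂μ := by
        refine lintegral_mono fun z => ?_
        rcases le_total (f z) 1 with hz | hz
        · exact (ENNReal.rpow_le_one hz ht.le).trans le_self_add
        · exact (ENNReal.rpow_le_rpow_of_exponent_le hz htp).trans le_add_self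
    _ = μ (Metric.ball x r) + ∫⁻ z in Metric.ball x r, f z ^ p ∂μ := by
        rw [lintegral_add_left measurable_const, lintegral_const]
        simp
    _ < ∞ := ENNReal.add_lt_top.2 ⟨h.ball_lt_top x r hr,
        (setLIntegral_le_lintegral _ _).trans_lt hf.lt_top⟩

theorem wt_mul_tailAvg {t : ℝ} (ht : 0 < t) (α s : ℝ) (P : ℤ → X → ℝ≥0∞) (k : ℤ) (x : X) :
    wt s k * tailAvg μ α D t P k x = ∑' i : ℕ, wt (α * D * (1 / t - 1) - s) 1 ^ i *
      powAvg μ t (10 * rad α k) (fun z => wt s (k + i) * P (k + i) z) x := by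
  rw [tailAvg, ← ENNReal.tsum_mul_left]
  congr 1
  ext i
  have h1 : ENNReal.ofReal (2 ^ (α * D * (1 / t - 1))) = wt (α * D * (1 / t - 1)) 1 := by
    simp [wt, rad]
  rw [powAvg_const_mul ht _ (wt_ne_top _ _), h1, ← wt_natCast, ← wt_natCast, ← wt_mul_wt_neg]
  conv_lhs => rw [show wt s k = wt s (-(i : ℤ)) * wt s (k + i) by rw [← wt_add]; ring_nf]
  ring

theorem tailAvg_ne_top (h : DoublingOn μ Cd D) {q : ℝ≥0∞} (hq : 0 < q) {α s t p : ℝ}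
    (ht : 0 < t) (htp : t ≤ p) (hδ : α * D * (1 / t - 1) < s) {P : ℤ → X → ℝ≥0∞}
    (hP : ∫⁻ x, lqN q (fun k => wt s k * P k x) ^ p ∂μ ≠ ∞) (k : ℤ) (x : X) :
    tailAvg μ α D t P k x ≠ ∞ := by
  have h1 : wt s k * tailAvg μ α D t P k x ≠ ∞ := by
    rw [wt_mul_tailAvg ht]
    refine ne_of_lt (lt_of_le_of_lt (ENNReal.tsum_le_tsum fun i => mul_le_mul_right
      (powAvg_mono ht _ (fun z => le_lqN hq (fun k => wt s k * P k z) (k + i)) x) _) ?_)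
    rw [ENNReal.tsum_mul_right]
    exact ENNReal.mul_lt_top (tsum_geometric_ne_top (wt_one_lt_one (sub_neg.2 hδ))).lt_top
      (powAvg_ne_top h ht htp (by linarith [rad_pos α k]) hP x).lt_top
  intro h2
  rw [h2, ENNReal.mul_top (wt_ne_zero s k)] at h1
  exact h1 rfl

variable [OpensMeasurableSpace X] [SecondCountableTopology X]

theorem exists_lintegral_lqN_tailAvg_le [SFinite μ] (h : DoublingOn μ Cd D) {q : ℝ≥0∞}
    {α s t p : ℝ} (ht : 0 < t) (htp : t < p) (htq : ENNReal.ofReal t < q)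
    (hδ : α * D * (1 / t - 1) < s) :
    ∃ C : ℝ≥0∞, C ≠ ∞ ∧ ∀ P : ℤ → X → ℝ≥0∞, (∀ k, Measurable (P k)) →
      ∫⁻ x, lqN q (fun k => wt s k * tailAvg μ α D t P k x) ^ p ∂μ ≤
        C * ∫⁻ x, lqN q (fun k => wt s k * P k x) ^ p ∂μ := by
  have ht' : ENNReal.ofReal t ≠ 0 := by simpa using ht
  have hb : 1 < q / ENNReal.ofReal t := by
    rwa [ENNReal.lt_div_iff_mul_lt (Or.inl ht') (Or.inl ENNReal.ofReal_ne_top), one_mul]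
  have hpt : 1 < p / t := by rwa [one_lt_div ht]
  have hpt0 : 0 ≤ p / t := zero_le_one.trans hpt.le
  have hrew : ∀ a : ℤ → ℝ≥0∞, lqN q a ^ p =
      lqN (q / ENNReal.ofReal t) (fun k => a k ^ t) ^ (p / t) := by
    intro a
    rw [lqN_rpow ht, ← ENNReal.rpow_mul, mul_div_cancel₀ p ht.ne']
  obtain ⟨C₁, ζ, hC₁, hζ, h1⟩ := tsum_geometric_mul_rpow_le (wt_one_lt_one (sub_neg.2 hδ)) ht
  obtain ⟨C₂, hC₂, h2⟩ := fefferman_stein h (r := fun k => 10 * rad α k)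
    (fun k => by linarith [rad_pos α k]) hpt hb
  obtain ⟨C₃, hC₃, h3⟩ := lqN_geometric_conv_le (zero_lt_one.trans hb) hζ (fun i => (i : ℤ))
  refine ⟨C₁ ^ (p / t) * (C₂ * C₃ ^ (p / t)), by finiteness, fun P hP => ?_⟩
  set H : ℤ → X → ℝ≥0∞ := fun k x => ∑' i : ℕ, ζ ^ i * (wt s (k + i) * P (k + i) x) ^ t with hH
  have hGm : ∀ k, Measurable fun x => (wt s k * P k x) ^ t :=
    fun k => ((hP k).const_mul _).pow_const _
  have hHm : ∀ k, Measurable (H k) := fun k =>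
    Measurable.tsum fun i => (hGm _).const_mul _
  have hζt : ∀ i : ℕ, ζ ^ i ≠ ∞ := fun i => ENNReal.pow_ne_top (hζ.trans ENNReal.one_lt_top).ne
  have hpt1 : ∀ k x, (wt s k * tailAvg μ α D t P k x) ^ t ≤
      C₁ * ballAvg μ (10 * rad α k) (H k) x := by
    intro k x
    rw [wt_mul_tailAvg ht]
    refine (h1 _).trans (mul_le_mul_right (le_of_eq ?_) _)
    rw [hH, ballAvg_tsum fun i => (hGm _).const_mul _]
    congr 1
    ext i
    rw [ballAvg_const_mul _ (hζt i), powAvg, ← ENNReal.rpow_mul, one_div_mul_cancel ht.ne',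
      ENNReal.rpow_one]
  simp only [hrew]
  calc _ ≤ ∫⁻ x, C₁ ^ (p / t) * lqN (q / ENNReal.ofReal t)
        (fun k => ballAvg μ (10 * rad α k) (H k) x) ^ (p / t) ∂μ := by
        refine lintegral_mono fun x => ?_
        rw [← ENNReal.mul_rpow_of_nonneg _ _ hpt0, ← lqN_const_mul (zero_lt_one.trans hb)]
        exact ENNReal.rpow_le_rpow (lqN_mono fun k => hpt1 k x) hpt0
    _ ≤ C₁ ^ (p / t) * (C₂ * ∫⁻ x, lqN (q / ENNReal.ofReal t)
        (fun k => H k x) ^ (p / t) ∂μ) := by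
        rw [lintegral_const_mul' _ _ (by finiteness)]
        exact mul_le_mul_right (h2 H hHm) _
    _ ≤ C₁ ^ (p / t) * (C₂ * ∫⁻ x, C₃ ^ (p / t) * lqN (q / ENNReal.ofReal t)
        (fun k => (wt s k * P k x) ^ t) ^ (p / t) ∂μ) := by
        refine mul_le_mul_right (mul_le_mul_right (lintegral_mono fun x => ?_) _) _
        rw [← ENNReal.mul_rpow_of_nonneg _ _ hpt0]
        exact ENNReal.rpow_le_rpow (h3 fun k => (wt s k * P k x) ^ t) hpt0
    _ = _ := by
        rw [lintegral_const_mul' _ _ (by finiteness)]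
        ring

theorem exists_lintegral_unitAvg_le [SFinite μ] (h : DoublingOn μ Cd D) {t p : ℝ} (α : ℝ)
    (ht : 0 < t) (htp : t < p) (hΩ : MeasurableSet Ω) :
    ∃ C : ℝ≥0∞, C ≠ ∞ ∧ ∀ u : X → ℝ, Measurable u →
      ∫⁻ x, unitAvg μ Ω α t u x ^ p ∂μ ≤ C * ∫⁻ x in Ω, ‖u x‖ₑ ^ p ∂μ := by
  have hr : 0 < 10 * rad α 0 := by linarith [rad_pos α 0]
  refine ⟨Cd * ENNReal.ofReal (2 ^ D), ENNReal.mul_ne_top h.const_ne_top ENNReal.ofReal_ne_top,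
    fun u hu => ?_⟩
  have hv : Measurable (Ω.indicator fun z => ‖u z‖ₑ) := hu.enorm.indicator hΩ
  have hp : 0 < p := ht.trans htp
  have hpt : 1 < p / t := by rwa [one_lt_div ht]
  calc _ ≤ ∫⁻ x, ballAvg μ (10 * rad α 0) (fun z => Ω.indicator (fun z => ‖u z‖ₑ) z ^ p) x ∂μ := by
        refine lintegral_mono fun x => ?_
        have := ballAvg_rpow_le h hr hpt.le (hv.pow_const t) x
        simp only [← ENNReal.rpow_mul, mul_div_cancel₀ p ht.ne'] at this
        rw [unitAvg, powAvg, ← ENNReal.rpow_mul, one_div_mul_eq_div]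
        exact this
    _ ≤ _ := lintegral_ballAvg_le h hr (hv.pow_const p)
    _ = _ := by
        rw [← lintegral_indicator hΩ]
        congr 2
        ext x
        by_cases hx : x ∈ Ω
        · simp [hx]
        · simp [hx, hp]

theorem measurable_extBound [SFinite μ] {u : X → ℝ} (hu : Measurable u) (hΩ : MeasurableSet Ω)
    {P : ℤ → X → ℝ≥0∞} (hP : ∀ k, Measurable (P k)) (α t : ℝ) (k : ℤ) :
    Measurable (extBound μ Ω α D t u P k) := by
  unfold extBound
  refine (measurable_tailAvg hP α D t k).add ?_
  by_cases hk : k = 0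
  · subst hk
    simp only [Pi.single_eq_same]
    exact measurable_powAvg (hu.enorm.indicator hΩ) t _
  · simp only [Pi.single_eq_of_ne hk]
    exact measurable_const

theorem exists_lintegral_lqN_modSum_le [SFinite μ] (h : DoublingOn μ Cd D) {q : ℝ≥0∞}
    {α s t p : ℝ} (hs : 0 < s) (hsα : s < α ∨ (q = ∞ ∧ s ≤ α)) (ht : 0 < t) (htp : t < p)
    (htq : ENNReal.ofReal t < q) (hδ : α * D * (1 / t - 1) < s) (hΩ : MeasurableSet Ω) :
    ∃ C : ℝ≥0∞, C ≠ ∞ ∧ ∀ (u : X → ℝ) (P : ℤ → X → ℝ≥0∞), Measurable u →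
      (∀ k, Measurable (P k)) →
      ∫⁻ x, lqN q (fun n => wt s n * modSum α (fun k => extBound μ Ω α D t u P k x) n) ^ p ∂μ ≤
        C * (∫⁻ x, lqN q (fun k => wt s k * P k x) ^ p ∂μ + ∫⁻ x in Ω, ‖u x‖ₑ ^ p ∂μ) := by
  have hq : 0 < q := zero_le.trans_lt htq
  have hp : 0 < p := ht.trans htp
  obtain ⟨C₁, hC₁, h1⟩ := exists_lqN_modSum_le hq hs hsα
  obtain ⟨C₂, hC₂, h2⟩ := lqN_add_le hq
  obtain ⟨C₃, hC₃, h3⟩ := exists_lintegral_lqN_tailAvg_le h ht htp htq hδ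
  obtain ⟨C₄, hC₄, h4⟩ := exists_lintegral_unitAvg_le h α ht htp hΩ
  refine ⟨C₁ ^ p * (C₂ ^ p * (2 ^ p * (C₃ + C₄))), by finiteness, fun u P hu hP => ?_⟩
  have hpt : ∀ x, lqN q (fun n => wt s n * modSum α (fun k => extBound μ Ω α D t u P k x) n) ^ p ≤
      C₁ ^ p * (C₂ ^ p * (2 ^ p * (lqN q (fun k => wt s k * tailAvg μ α D t P k x) ^ p +
        unitAvg μ Ω α t u x ^ p))) := by
    intro x
    have hB : lqN q (fun k => wt s k * extBound μ Ω α D t u P k x) ≤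
        C₂ * (lqN q (fun k => wt s k * tailAvg μ α D t P k x) + unitAvg μ Ω α t u x) := by
      refine le_trans (le_of_eq ?_) ((h2 (fun k => wt s k * tailAvg μ α D t P k x)
        (Pi.single 0 (unitAvg μ Ω α t u x))).trans (by rw [lqN_single hq]))
      congr 1
      ext k
      rw [extBound, mul_add]
      congr 1
      by_cases hk : k = 0
      · subst hk
        simp [wt_zero]
      · simp [Pi.single_eq_of_ne hk]
    refine (ENNReal.rpow_le_rpow ((h1 _).trans (mul_le_mul_right hB _)) hp.le).trans ?_
    rw [ENNReal.mul_rpow_of_nonneg _ _ hp.le, ENNReal.mul_rpow_of_nonneg _ _ hp.le]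
    exact mul_le_mul_right (mul_le_mul_right (ennreal_add_rpow_le _ _ hp.le) _) _
  refine (lintegral_mono hpt).trans ?_
  rw [lintegral_const_mul' _ _ (by finiteness), lintegral_const_mul' _ _ (by finiteness),
    lintegral_const_mul' _ _ (by finiteness), lintegral_add_left
      ((measurable_lqN fun k => (measurable_tailAvg hP α D t k).const_mul _).pow_const _)]
  rw [mul_assoc, mul_assoc, mul_assoc]
  refine mul_le_mul_right (mul_le_mul_right (mul_le_mul_right ?_ _) _) _
  rw [mul_add, add_mul, add_mul]
  have := h3 P hP
  have := h4 u hu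
  calc _ ≤ C₃ * ∫⁻ x, lqN q (fun k => wt s k * P k x) ^ p ∂μ +
        C₄ * ∫⁻ x in Ω, ‖u x‖ₑ ^ p ∂μ := add_le_add (h3 P hP) (h4 u hu)
    _ ≤ _ := add_le_add le_self_add le_add_self

end WeightedNorms

section ExtensionOperator

theorem exists_linearMap_eq_lim : ∃ L : (ℕ → ℝ) →ₗ[ℝ] ℝ, ∀ (a : ℕ → ℝ) (l : ℝ),
    Filter.Tendsto a Filter.atTop (nhds l) → L a = l := by
  let V : Submodule ℝ (ℕ → ℝ) :=
    { carrier := {a | ∃ l, Filter.Tendsto a Filter.atTop (nhds l)}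
      add_mem' := fun ⟨l, hl⟩ ⟨m, hm⟩ => ⟨l + m, hl.add hm⟩
      zero_mem' := ⟨0, tendsto_const_nhds⟩
      smul_mem' := fun c _ ⟨l, hl⟩ => ⟨c • l, hl.const_smul c⟩ }
  let f : V →ₗ[ℝ] ℝ :=
    { toFun := fun a => a.2.choose
      map_add' := fun a b => tendsto_nhds_unique (a + b).2.choose_spec
        (a.2.choose_spec.add b.2.choose_spec)
      map_smul' := fun c a => tendsto_nhds_unique (c • a).2.choose_spec
        (a.2.choose_spec.const_smul c) }
  obtain ⟨L, hL⟩ := f.exists_extend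
  refine ⟨L, fun a l ha => ?_⟩
  have h1 : L a = f ⟨a, l, ha⟩ := by rw [← hL]; rfl
  rw [h1]
  exact tendsto_nhds_unique (⟨a, l, ha⟩ : V).2.choose_spec ha

/-- A linear extension of the limit to all sequences. -/
def limLin : (ℕ → ℝ) →ₗ[ℝ] ℝ := exists_linearMap_eq_lim.choose

theorem limLin_eq {a : ℕ → ℝ} {l : ℝ} (h : Filter.Tendsto a Filter.atTop (nhds l)) :
    limLin a = l := exists_linearMap_eq_lim.choose_spec a l h

variable [PseudoMetricSpace X] {μ : Measure X} {Cd c : ℝ≥0∞} {D : ℝ} {Ω : Set X}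

theorem continuous_of_enorm_sub_le {f : X → ℝ} {A : X → ℝ≥0∞} {δ r : ℝ} (hδ : 0 < δ)
    (hA : ∀ x, A x ≠ ∞)
    (h : ∀ x y, dist x y ≤ δ → ‖f x - f y‖ₑ ≤ A x * ENNReal.ofReal (dist x y / r)) :
    Continuous f := by
  refine continuous_iff_continuousAt.2 fun x => ?_
  rw [ContinuousAt, tendsto_iff_edist_tendsto_0]
  have h1 : Filter.Tendsto (fun y => A x * ENNReal.ofReal (dist x y / r)) (nhds x) (nhds 0) := by
    have h2 : Filter.Tendsto (fun y => dist x y / r) (nhds x) (nhds 0) := by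
      have : Continuous fun y => dist x y / r := by fun_prop
      simpa using this.tendsto x
    have h3 := ENNReal.Tendsto.const_mul (ENNReal.tendsto_ofReal h2) (Or.inr (hA x))
    simpa using h3
  refine tendsto_of_tendsto_of_tendsto_of_le_of_le' tendsto_const_nhds h1
    (Filter.Eventually.of_forall fun y => zero_le) ?_
  filter_upwards [Metric.closedBall_mem_nhds x hδ] with y hy
  rw [edist_comm, edist_eq_enorm_sub]
  exact h x y (by rw [dist_comm]; exact hy)

/-- The linear extension operator. -/
def extOp (μ : Measure X) (Ω : Set X) (α : ℝ) (u : X → ℝ) (x : X) : ℝ :=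
  limLin fun K => extSum μ Ω α u K x

variable [OpensMeasurableSpace X] [SecondCountableTopology X]

theorem exists_extOp_bound [SFinite μ] (h : DoublingOn μ Cd D) (hΩ : DensityOn μ Ω c) {q : ℝ≥0∞}
    {α s t p : ℝ} (hs : 0 < s) (hsα : s < α ∨ (q = ∞ ∧ s ≤ α)) (ht : 0 < t) (ht1 : t < 1)
    (htp : t < p) (htq : ENNReal.ofReal t < q) (hδ : α * D * (1 / t - 1) < s) :
    ∃ C : ℝ≥0∞, C ≠ ∞ ∧ ∀ (E : Set X) (u : X → ℝ) (P : ℤ → X → ℝ≥0∞), μ E = 0 → Measurable u →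
      IsOscBound Ω E α u P → ∫⁻ x, lqN q (fun k => wt s k * P k x) ^ p ∂μ ≠ ∞ →
      ∫⁻ x in Ω, ‖u x‖ₑ ^ p ∂μ ≠ ∞ →
      (∀ x, IntegrableOn (fun z => initKer μ Ω α x z * u z) Ω μ) ∧
      (∀ (k : ℕ) x, IntegrableOn (fun z => stepKer μ Ω α k x z * u z) Ω μ) ∧
      AEMeasurable (extOp μ Ω α u) μ ∧ (∀ᵐ x ∂μ, x ∈ Ω → extOp μ Ω α u x = u x) ∧
      ∃ Γ : ℤ → X → ℝ≥0∞, (∀ k, Measurable (Γ k)) ∧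
        ∫⁻ x, lqN q (fun k => Γ k x) ^ p ∂μ ≤
          C * (∫⁻ x, lqN q (fun k => wt s k * P k x) ^ p ∂μ + ∫⁻ x in Ω, ‖u x‖ₑ ^ p ∂μ) ∧
        ∀ᵐ x ∂μ, lqN q (fun k => Γ k x) ≠ ∞ ∧ ‖extOp μ Ω α u x‖ₑ ≤ Γ 0 x ∧
          ∀ y, lqN q (fun k => Γ k y) ≠ ∞ → ∀ n : ℤ, dist x y ≤ rad α n / 4 →
            ‖extOp μ Ω α u x - extOp μ Ω α u y‖ₑ ≤
              ENNReal.ofReal (rad s n) * (Γ n x + Γ n y) := by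
  have hα : 0 < α := hs.trans_le (hsα.elim le_of_lt fun h => h.2)
  have hq : 0 < q := zero_le.trans_lt htq
  have hp : 0 < p := ht.trans htp
  obtain ⟨C₀, hC₀, hI⟩ := exists_extInit_estimates h hΩ hα ht ht1
  obtain ⟨C₁, hC₁, hS⟩ := exists_extStep_estimates h hΩ hα ht ht1
  obtain ⟨C₂, hC₂, hT⟩ := exists_extSum_estimates h hΩ hα ht ht1
  obtain ⟨C₃, hC₃, hM⟩ := exists_enorm_extSum_sub_le h hΩ hα ht ht1
  obtain ⟨C₄, hC₄, hN⟩ := exists_lintegral_lqN_modSum_le h hs hsα ht htp htq hδ hΩ.measurableSet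
  set A : ℝ≥0∞ := C₀ + C₁ + C₃ + 1 with hA
  have hAt : A ≠ ∞ := by finiteness
  have hA0 : A ≠ 0 := by simp [hA]
  refine ⟨A ^ p * C₄, by finiteness, fun E u P hE hu hP hPint huint => ?_⟩
  have hfin : ∀ k, 0 ≤ k → ∀ x, tailAvg μ α D t P k x ≠ ∞ := fun k _ x =>
    tailAvg_ne_top h hq ht htp.le hδ hPint k x
  have hU : ∀ x, unitAvg μ Ω α t u x ≠ ∞ := by
    refine powAvg_ne_top h ht htp.le (by linarith [rad_pos α 0]) ?_
    rw [← lintegral_indicator hΩ.measurableSet] at huint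
    convert huint using 3 with z
    by_cases hz : z ∈ Ω
    · simp [hz]
    · simp [hz, hp]
  set B : X → ℤ → ℝ≥0∞ := fun x k => extBound μ Ω α D t u P k x with hB
  set W : X → ℤ → ℝ≥0∞ := fun x n => modSum α (B x) n with hW
  have hBm : ∀ k, Measurable fun x => B x k := measurable_extBound hu hΩ.measurableSet hP.measurable α t
  have hWm : ∀ n, Measurable fun x => W x n := fun n =>
    (Measurable.iSup fun i => (hBm _).const_mul _).add (Measurable.tsum fun i => hBm _)
  have hRB : ∀ k x, tailAvg μ α D t P k x ≤ B x k := fun k x => tailAvg_le_extBound α t u P k x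
  set Γ : ℤ → X → ℝ≥0∞ := fun n x => A * (wt s n * W x n) with hΓ
  have hΓint : ∫⁻ x, lqN q (fun k => Γ k x) ^ p ∂μ ≤
      A ^ p * C₄ * (∫⁻ x, lqN q (fun k => wt s k * P k x) ^ p ∂μ + ∫⁻ x in Ω, ‖u x‖ₑ ^ p ∂μ) := by
    simp only [hΓ, lqN_const_mul hq, ENNReal.mul_rpow_of_nonneg _ _ hp.le]
    rw [lintegral_const_mul' _ _ (by finiteness), mul_assoc]
    exact mul_le_mul_right (hN u P hu hP.measurable) _
  have hΓm : ∀ k, Measurable (Γ k) := fun k => ((hWm k).const_mul _).const_mul _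
  have hΓfin : ∀ᵐ x ∂μ, lqN q (fun k => Γ k x) ≠ ∞ := by
    filter_upwards [ae_lt_top ((measurable_lqN hΓm).pow_const p)
      (hΓint.trans_lt (by finiteness)).ne] with x hx hx'
    rw [hx', ENNReal.top_rpow_of_pos hp] at hx
    exact lt_irrefl _ hx
  have hsumB : ∀ (x : X) (n : ℤ), ∑' i : ℕ, B x (n + i) ≤ W x n := fun x n => le_add_self
  have hsum0 : ∀ x, lqN q (fun k => Γ k x) ≠ ∞ → ∑' i : ℕ, B x i ≠ ∞ := by
    intro x hx hx'
    have h1 : Γ 0 x ≤ lqN q (fun k => Γ k x) := le_lqN hq (fun k => Γ k x) 0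
    have h2 := hsumB x 0
    simp only [zero_add, hx', top_le_iff] at h2
    simp only [hΓ, wt_zero, h2, one_mul, ENNReal.mul_top hA0, top_le_iff] at h1
    exact hx h1
  have hstep : ∀ k x, ‖extStep μ Ω α u k x‖ₑ ≤ C₁ * B x k := fun k x =>
    (hS E u P hE hu hP hfin k x).2.1.trans (mul_le_mul_right (hRB k x) _)
  have hinit : ∀ x, ‖extInit μ Ω α u x‖ₑ ≤ C₀ * B x 0 := fun x => by
    simpa [hB, extBound] using (hI E u P hE hu hP hfin x).2.1
  have htends : ∀ x, lqN q (fun k => Γ k x) ≠ ∞ → Filter.Tendsto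
      (fun K => extSum μ Ω α u K x) Filter.atTop (nhds (extOp μ Ω α u x)) := by
    intro x hx
    have h1 : ∑' k : ℕ, ‖extStep μ Ω α u k x‖ₑ ≠ ∞ := by
      refine ne_of_lt (lt_of_le_of_lt (ENNReal.tsum_le_tsum fun k => hstep k x) ?_)
      rw [ENNReal.tsum_mul_left]
      exact ENNReal.mul_lt_top hC₁.lt_top (hsum0 x hx).lt_top
    have h2 : Summable fun k => extStep μ Ω α u k x := by
      simp only [enorm_eq_nnnorm] at h1
      exact Summable.of_nnnorm (ENNReal.tsum_coe_ne_top_iff_summable.1 h1)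
    have h3 := (h2.hasSum.tendsto_sum_nat).const_add (extInit μ Ω α u x)
    have h4 : extOp μ Ω α u x = _ := limLin_eq h3
    rw [h4]
    exact h3
  have hbd : ∀ K x, ‖extSum μ Ω α u K x‖ₑ ≤ A * ∑' i : ℕ, B x i := by
    intro K x
    calc _ ≤ C₀ * B x 0 + ∑ k ∈ Finset.range K, C₁ * B x k :=
          (enorm_add_le _ _).trans (add_le_add (hinit x)
            ((enorm_sum_le _ _).trans (Finset.sum_le_sum fun k _ => hstep k x)))
      _ ≤ C₀ * ∑' i : ℕ, B x i + C₁ * ∑' i : ℕ, B x i := by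
          refine add_le_add (mul_le_mul_right ?_ _) ?_
          · exact ENNReal.le_tsum (f := fun i : ℕ => B x i) 0
          · rw [← ENNReal.tsum_mul_left]
            exact ENNReal.sum_le_tsum _
      _ = (C₀ + C₁) * ∑' i : ℕ, B x i := by rw [add_mul]
      _ ≤ _ := mul_le_mul_left (by rw [hA, add_assoc]; exact le_self_add) _
  have hopbd : ∀ x, lqN q (fun k => Γ k x) ≠ ∞ → ‖extOp μ Ω α u x‖ₑ ≤ A * ∑' i : ℕ, B x i :=
    fun x hx => le_of_tendsto' ((htends x hx).enorm) fun K => hbd K x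
  have hwt : ∀ n z, ENNReal.ofReal (rad s n) * Γ n z = A * W z n := by
    intro n z
    rw [ofReal_rad, hΓ, mul_left_comm, ← mul_assoc (wt s (-n)), wt_neg_mul_wt, one_mul]
  refine ⟨fun x => (hI E u P hE hu hP hfin x).1, fun k x => (hS E u P hE hu hP hfin k x).1,
    ?_, ?_, Γ, hΓm, hΓint, ?_⟩
  · have hc : ∀ K, Measurable (extSum μ Ω α u K) := by
      intro K
      refine Continuous.measurable (Continuous.add ?_ (continuous_finsetSum _ fun k _ => ?_))
      · refine continuous_of_enorm_sub_le (rad_pos α 0)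
          (A := fun x => C₀ * (tailAvg μ α D t P 0 x + unitAvg μ Ω α t u x)) (r := rad α 0)
          (fun x => ?_) fun x y hxy => ?_
        · exact ENNReal.mul_ne_top hC₀ (ENNReal.add_ne_top.2 ⟨hfin 0 le_rfl x, hU x⟩)
        · refine ((hI E u P hE hu hP hfin x).2.2 y hxy).trans_eq (by ring)
      · refine continuous_of_enorm_sub_le (rad_pos α (k + 1 : ℕ))
          (A := fun x => C₁ * tailAvg μ α D t P k x) (r := rad α k)
          (fun x => ?_) fun x y hxy => ?_
        · exact ENNReal.mul_ne_top hC₁ (hfin k (by positivity) x)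
        · refine ((hS E u P hE hu hP hfin k x).2.2 y hxy).trans_eq (by ring)
    refine aemeasurable_of_tendsto_metrizable_ae Filter.atTop (fun K => (hc K).aemeasurable) ?_
    filter_upwards [hΓfin] with x hx using htends x hx
  · have hE' : ∀ᵐ x ∂μ, x ∉ E := measure_eq_zero_iff_ae_notMem.1 hE
    filter_upwards [hΓfin, hE'] with x hx hxE hxΩ
    have hinf : ∀ m : ℕ, Metric.infDist x Ω ≤ rad α m := fun m => by
      rw [Metric.infDist_zero_of_mem hxΩ]
      exact (rad_pos α m).le
    have h1 : Filter.Tendsto (fun m : ℕ => C₂ * (P m x + tailAvg μ α D t P m x)) Filter.atTop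
        (nhds 0) := by
      have h2 : Filter.Tendsto (fun m : ℕ => P m x) Filter.atTop (nhds 0) := by
        simpa using hP.tendsto x ⟨hxΩ, hxE⟩ 0
      have h3 : Filter.Tendsto (fun m : ℕ => tailAvg μ α D t P m x) Filter.atTop (nhds 0) :=
        tendsto_of_tendsto_of_tendsto_of_le_of_le tendsto_const_nhds
          (ENNReal.tendsto_atTop_zero_of_tsum_ne_top (hsum0 x hx)) (fun m => zero_le)
          fun m => hRB m x
      simpa using ENNReal.Tendsto.const_mul (h2.add h3) (Or.inr hC₂)
    refine tendsto_nhds_unique (htends x hx) ?_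
    rw [tendsto_iff_edist_tendsto_0]
    refine tendsto_of_tendsto_of_tendsto_of_le_of_le tendsto_const_nhds h1 (fun m => zero_le)
      fun m => ?_
    rw [edist_eq_enorm_sub]
    exact (hT E u P hE hu hP hfin m x (hinf m)).1 ⟨hxΩ, hxE⟩
  · filter_upwards [hΓfin] with x hx
    refine ⟨hx, ?_, fun y hy n hxy => ?_⟩
    · refine (hopbd x hx).trans ?_
      simp only [hΓ, wt_zero, one_mul]
      exact mul_le_mul_right (by simpa using hsumB x 0) _
    · rw [mul_add, hwt, hwt]
      rcases le_or_gt 0 n with hn | hn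
      · lift n to ℕ using hn
        refine le_of_tendsto ((htends x hx).sub (htends y hy)).enorm ?_
        filter_upwards [Filter.eventually_ge_atTop n] with K hK
        refine (hM E u P hE hu hP hfin n x y hxy K hK).trans ?_
        rw [← mul_add]
        refine mul_le_mul' ((le_add_self : C₃ ≤ C₀ + C₁ + C₃).trans le_self_add) ?_
        rw [ENNReal.tsum_add, ← add_assoc]
        refine add_le_add (add_le_add le_rfl (ENNReal.tsum_le_tsum fun i => hRB _ x)) ?_
        exact (ENNReal.tsum_le_tsum fun i => hRB _ y).trans (hsumB y n)
      · obtain ⟨m, rfl⟩ : ∃ m : ℕ, n = -m := ⟨n.natAbs, by omega⟩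
        have h1 : ∀ z, ∑' i : ℕ, B z i ≤ W z (-m) := by
          intro z
          refine le_trans ?_ (hsumB z (-m))
          have := ENNReal.tsum_comp_le_tsum_of_injective (add_left_injective m)
            (fun i : ℕ => B z (-(m : ℤ) + i))
          refine le_trans (le_of_eq ?_) this
          congr 1
          ext i
          congr 1
          push_cast
          ring
        exact enorm_sub_le.trans (add_le_add
          ((hopbd x hx).trans (mul_le_mul_right (h1 x) _))
          ((hopbd y hy).trans (mul_le_mul_right (h1 y) _)))

end ExtensionOperator

section Metrization

/-- Frink's chain inequality. -/
theorem chain_le_sum {d : X → X → ℝ} (hd0 : ∀ x y, 0 ≤ d x y)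
    (hd : ∀ x y z, d x z ≤ 2 * max (d x y) (d y z)) (x : ℕ → X) (N : ℕ) :
    ∀ m l : ℕ, m + 2 ≤ l → l - m = N → d (x m) (x l) + 2 * d (x m) (x (m + 1)) +
      2 * d (x (l - 1)) (x l) ≤ 4 * ∑ j ∈ Finset.Ico m l, d (x j) (x (j + 1)) := by
  induction N using Nat.strong_induction_on with
  | _ N ih =>
  intro m l hml hN
  classical
  set p : ℕ → Prop := fun i => m ≤ i ∧ d (x m) (x l) ≤ 2 * d (x i) (x l)
  have hpm : p m := ⟨le_rfl, by linarith [hd0 (x m) (x l)]⟩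
  set i := Nat.findGreatest p (l - 1) with hi
  have hpi : p i := Nat.findGreatest_spec (by omega : m ≤ l - 1) hpm
  have hil : i ≤ l - 1 := Nat.findGreatest_le _
  have hsum : ∀ a b : ℕ, a + 2 ≤ b → d (x a) (x (a + 1)) + d (x (b - 1)) (x b) ≤
      ∑ j ∈ Finset.Ico a b, d (x j) (x (j + 1)) := by
    intro a b hab
    have h1 : ({a, b - 1} : Finset ℕ) ⊆ Finset.Ico a b := by
      intro j hj
      simp only [Finset.mem_insert, Finset.mem_singleton] at hj
      rw [Finset.mem_Ico]
      omega
    have h2 := Finset.sum_le_sum_of_subset_of_nonneg h1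
      (fun j _ _ => hd0 (x j) (x (j + 1)))
    rwa [Finset.sum_pair (by omega), show b - 1 + 1 = b by omega] at h2
  rcases hil.eq_or_lt with hil' | hil'
  · have h1 := hpi.2
    rw [hil'] at h1
    linarith [hsum m l hml, hd0 (x m) (x (m + 1))]
  have hnot : d (x m) (x l) ≤ 2 * d (x m) (x (i + 1)) := by
    have h1 : ¬ p (i + 1) := Nat.findGreatest_is_greatest (P := p) (n := l - 1)
      (Nat.lt_succ_self _) (by omega)
    have h2 : 2 * d (x (i + 1)) (x l) < d (x m) (x l) := by
      by_contra h3
      exact h1 ⟨by have := hpi.1; omega, not_lt.1 h3⟩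
    have h4 := hd (x m) (x (i + 1)) (x l)
    rcases max_cases (d (x m) (x (i + 1))) (d (x (i + 1)) (x l)) with h5 | h5 <;>
      rw [h5.1] at h4 <;> linarith
  rcases hpi.1.eq_or_lt with him | him
  · rw [← him] at hnot
    linarith [hsum m l hml, hd0 (x (l - 1)) (x l)]
  have h1 := ih (i + 1 - m) (by omega) m (i + 1) (by omega) rfl
  have h2 := ih (l - i) (by omega) i l (by omega) rfl
  have h3 := hpi.2
  have h4 : ∑ j ∈ Finset.Ico m (i + 1), d (x j) (x (j + 1)) +
      ∑ j ∈ Finset.Ico i l, d (x j) (x (j + 1)) =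
      ∑ j ∈ Finset.Ico m l, d (x j) (x (j + 1)) + d (x i) (x (i + 1)) := by
    rw [← Finset.sum_Ico_consecutive _ him.le (by omega : i ≤ l),
      Finset.sum_Ico_succ_top him.le]
    ring
  rw [Nat.add_sub_cancel] at h1
  linarith

theorem zipWith_sum_eq_chain (d : X → X → NNReal) (l : List X) : ∀ x y : X,
    ∃ (z : ℕ → X) (n : ℕ), z 0 = x ∧ z n = y ∧ 1 ≤ n ∧
      ((x :: l).zipWith d (l ++ [y])).sum = ∑ j ∈ Finset.range n, d (z j) (z (j + 1)) := by
  induction l with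
  | nil => exact fun x y => ⟨fun i => if i = 0 then x else y, 1, by simp⟩
  | cons a l ih =>
    intro x y
    obtain ⟨z, n, h0, hn, hn1, hs⟩ := ih a y
    refine ⟨fun i => Nat.casesOn i x z, n + 1, rfl, hn, by omega, ?_⟩
    rw [Finset.sum_range_succ', List.cons_append, List.zipWith_cons_cons, List.sum_cons, hs,
      add_comm, ← h0]
    rfl

theorem le_four_mul_dist_ofPreNNDist (d : X → X → NNReal) (dist_self : ∀ x, d x x = 0)
    (dist_comm : ∀ x y, d x y = d y x) (hd : ∀ x y z, d x z ≤ 2 * max (d x y) (d y z)) (x y : X) :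
    (d x y : ℝ) ≤ 4 * @dist X (@PseudoMetricSpace.toDist X
      (PseudoMetricSpace.ofPreNNDist d dist_self dist_comm)) x y := by
  rw [PseudoMetricSpace.dist_ofPreNNDist, ← NNReal.coe_ofNat, ← NNReal.coe_mul, NNReal.mul_iInf,
    NNReal.coe_le_coe]
  refine le_ciInf fun l => ?_
  obtain ⟨z, n, rfl, rfl, hn, hs⟩ := zipWith_sum_eq_chain d l x y
  rw [hs]
  rcases hn.eq_or_lt with rfl | hn
  · simp only [Finset.range_one, Finset.sum_singleton, zero_add]
    exact le_mul_of_one_le_left zero_le (by norm_num)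
  · have h1 := chain_le_sum (d := fun a b => (d a b : ℝ)) (fun _ _ => NNReal.coe_nonneg _)
      (fun a b c => by exact_mod_cast hd a b c) z n 0 n (by omega) rfl
    have h2 : (0 : ℝ) ≤ d (z 0) (z (0 + 1)) := NNReal.coe_nonneg _
    have h3 : (0 : ℝ) ≤ d (z (n - 1)) (z n) := NNReal.coe_nonneg _
    rw [← NNReal.coe_le_coe]
    push_cast
    rw [Finset.range_eq_Ico]
    linarith

theorem Crho_spec {ρ : X → X → ℝ} (hρ : IsQuasiDist ρ) :
    1 ≤ Crho ρ ∧ ∀ x y z, ρ x y ≤ Crho ρ * max (ρ x z) (ρ z y) := by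
  obtain ⟨-, -, -, C, hC, hCt⟩ := hρ
  have hcl : IsClosed {C : ℝ | 1 ≤ C ∧ ∀ x y z : X, ρ x y ≤ C * max (ρ x z) (ρ z y)} := by
    simp only [Set.ofPred_and, Set.ofPred_forall]
    refine isClosed_Ici.inter (isClosed_iInter fun x => isClosed_iInter fun y =>
      isClosed_iInter fun z => isClosed_le continuous_const (by fun_prop))
  exact hcl.csInf_mem ⟨C, hC, hCt⟩ ⟨1, fun _ h => h.1⟩

/-- A power of a quasi-metric is equivalent to a metric, with the sharp exponent. -/
theorem SPrecIndex.exists_metric {ρ : X → X → ℝ} {s : ℝ} {q : ℝ≥0∞}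
    (h : SPrecIndex ρ s q) (hs : 0 < s) :
    ∃ (α c : ℝ) (_ : PseudoMetricSpace X), (s < α ∨ (q = ∞ ∧ s ≤ α)) ∧ 1 ≤ c ∧
      ∀ x y : X, dist x y ≤ c * ρ x y ^ α ∧ ρ x y ^ α ≤ c * dist x y := by
  obtain ⟨ϱ, hϱ, ⟨c, hc, hcϱ⟩, hC⟩ := h
  obtain ⟨hC1, hCt⟩ := Crho_spec hϱ
  obtain ⟨α, hsα, hCα⟩ : ∃ α, (s < α ∨ (q = ∞ ∧ s ≤ α)) ∧ Crho ϱ ^ α ≤ 2 := by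
    rcases hC with hC | ⟨rfl, hC⟩
    · have h1 := (Real.continuous_const_rpow (by positivity : Crho ϱ ≠ 0)).tendsto s
      have h2 := (h1.eventually (gt_mem_nhds hC)).filter_mono
        (nhdsWithin_le_nhds : nhdsWithin s (Ioi s) ≤ nhds s)
      obtain ⟨α, h3, h4⟩ := (h2.and self_mem_nhdsWithin).exists
      exact ⟨α, Or.inl h4, h3.le⟩
    · exact ⟨s, Or.inr ⟨rfl, le_rfl⟩, hC⟩
  have hα : 0 < α := hs.trans_le (hsα.elim le_of_lt fun h => h.2)
  obtain ⟨h0, hz, ⟨C₀, hC₀, hsymm⟩, -⟩ := hϱ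
  set m : X → X → ℝ := fun x y => max (ϱ x y) (ϱ y x) with hm
  have hm0 : ∀ x y, 0 ≤ m x y := fun x y => le_max_of_le_left (h0 x y)
  have hmt : ∀ x y z, m x z ≤ Crho ϱ * max (m x y) (m y z) := by
    intro x y z
    have hC0 : 0 ≤ Crho ϱ := by linarith
    refine max_le ((hCt x z y).trans ?_) ((hCt z x y).trans ?_) <;>
      refine mul_le_mul_of_nonneg_left ?_ hC0
    · exact max_le_max (le_max_left _ _) (le_max_left _ _)
    · rw [max_comm]
      exact max_le_max (le_max_right _ _) (le_max_right _ _)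
  set d : X → X → NNReal := fun x y => ⟨m x y ^ α, Real.rpow_nonneg (hm0 x y) α⟩ with hd
  have hds : ∀ x, d x x = 0 := by
    intro x
    rw [← NNReal.coe_eq_zero]
    change m x x ^ α = 0
    simp [hm, (hz x x).2 rfl, hα.ne']
  have hdc : ∀ x y, d x y = d y x := by
    intro x y
    ext
    simp [hd, hm, max_comm]
  have hdt : ∀ x y z, d x z ≤ 2 * max (d x y) (d y z) := by
    intro x y z
    rw [← NNReal.coe_le_coe]
    push_cast
    change m x z ^ α ≤ 2 * max (m x y ^ α) (m y z ^ α)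
    have h1 : max (m x y ^ α) (m y z ^ α) = max (m x y) (m y z) ^ α :=
      ((Real.monotoneOn_rpow_Ici_of_exponent_nonneg hα.le).map_max (hm0 x y) (hm0 y z)).symm
    rw [h1]
    calc m x z ^ α ≤ (Crho ϱ * max (m x y) (m y z)) ^ α :=
          Real.rpow_le_rpow (hm0 x z) (hmt x y z) hα.le
      _ = Crho ϱ ^ α * max (m x y) (m y z) ^ α :=
          Real.mul_rpow (by linarith) (le_max_of_le_left (hm0 x y))
      _ ≤ _ := by
          gcongr
          exact Real.rpow_nonneg (le_max_of_le_left (hm0 x y)) _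
  have hρ0 : ∀ x y, 0 ≤ ρ x y := fun x y =>
    le_trans (by have := h0 x y; positivity) (hcϱ x y).1
  have hmρ : ∀ x y, m x y ≤ C₀ * c * ρ x y := by
    intro x y
    have h1 : ϱ x y ≤ c * ρ x y := by
      have := (hcϱ x y).1
      rwa [inv_mul_le_iff₀ (by linarith)] at this
    have h2 : ϱ x y ≤ C₀ * ϱ x y := le_mul_of_one_le_left (h0 x y) hC₀
    have h3 : C₀ * ϱ x y ≤ C₀ * (c * ρ x y) := by gcongr
    rw [mul_assoc]
    exact max_le (h2.trans h3) ((hsymm x y).trans h3)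
  have hρm : ∀ x y, ρ x y ≤ c * m x y := fun x y =>
    (hcϱ x y).2.trans (by gcongr; exact le_max_left _ _)
  refine ⟨α, (C₀ * c) ^ α + 4 * c ^ α, PseudoMetricSpace.ofPreNNDist d hds hdc, hsα, ?_, ?_⟩
  · have h1 : 1 ≤ (C₀ * c) ^ α := Real.one_le_rpow (one_le_mul_of_one_le_of_one_le hC₀ hc) hα.le
    have h2 : 0 ≤ c ^ α := Real.rpow_nonneg (by linarith) _
    linarith
  · intro x y
    have h1 : 0 ≤ (C₀ * c) ^ α := Real.rpow_nonneg (by positivity) _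
    have h2 : 0 ≤ c ^ α := Real.rpow_nonneg (by linarith) _
    have h3 : 0 ≤ ρ x y ^ α := Real.rpow_nonneg (hρ0 x y) _
    constructor
    · refine (PseudoMetricSpace.dist_ofPreNNDist_le d hds hdc x y).trans ?_
      change m x y ^ α ≤ _
      calc m x y ^ α ≤ (C₀ * c * ρ x y) ^ α := Real.rpow_le_rpow (hm0 x y) (hmρ x y) hα.le
        _ = (C₀ * c) ^ α * ρ x y ^ α := Real.mul_rpow (by positivity) (hρ0 x y)
        _ ≤ _ := by gcongr; linarith
    · have h4 : m x y ^ α ≤ 4 * _ := le_four_mul_dist_ofPreNNDist d hds hdc hdt x y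
      calc ρ x y ^ α ≤ (c * m x y) ^ α := Real.rpow_le_rpow (hρ0 x y) (hρm x y) hα.le
        _ = c ^ α * m x y ^ α := Real.mul_rpow (by linarith) (hm0 x y)
        _ ≤ _ := (mul_le_mul_of_nonneg_left h4 h2).trans (by
          rw [← mul_assoc, mul_comm _ (4 : ℝ)]
          refine mul_le_mul_of_nonneg_right (by linarith) ?_
          exact @dist_nonneg X (PseudoMetricSpace.ofPreNNDist d hds hdc) x y)

end Metrization

section Snowflake

theorem IsQMMS.sigmaFinite {ρ : X → X → ℝ} {μ : Measure X} (h : IsQMMS ρ μ) : SigmaFinite μ := by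
  obtain ⟨x, -, -⟩ := h.nontrivial
  refine ⟨⟨⟨fun n : ℕ => qball ρ x (n + 1), fun _ => trivial,
    fun n => h.ball_lt_top x _ (by positivity), ?_⟩⟩⟩
  refine Set.eq_univ_of_forall fun y => Set.mem_iUnion.2 ?_
  obtain ⟨n, hn⟩ := exists_nat_gt (ρ x y)
  exact ⟨n, show ρ x y < n + 1 by linarith⟩

/-- The metric is comparable with the power `α` of `ρ`. -/
structure IsSnowflake [PseudoMetricSpace X] (ρ : X → X → ℝ) (α c : ℝ) : Prop where
  exponent_pos : 0 < α
  one_le : 1 ≤ c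
  nonneg : ∀ x y, 0 ≤ ρ x y
  dist_le : ∀ x y, dist x y ≤ c * ρ x y ^ α
  rpow_le : ∀ x y, ρ x y ^ α ≤ c * dist x y

variable [PseudoMetricSpace X] {ρ : X → X → ℝ} {α c : ℝ} {μ : Measure X} {Ω : Set X}

theorem IsSnowflake.ball_subset_qball (h : IsSnowflake ρ α c) {r : ℝ} (hr : 0 < r) (x : X) :
    Metric.ball x r ⊆ qball ρ x ((c * r) ^ (1 / α)) := by
  intro y hy
  rw [Metric.mem_ball, dist_comm] at hy
  have hc : 0 < c := one_pos.trans_le h.one_le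
  change ρ x y < _
  rw [one_div, Real.lt_rpow_inv_iff_of_pos (h.nonneg x y) (by positivity) h.exponent_pos]
  exact (h.rpow_le x y).trans_lt (by gcongr)

theorem IsSnowflake.qball_subset_ball (h : IsSnowflake ρ α c) {r : ℝ} (hr : 0 < r) (x : X) :
    qball ρ x ((r / c) ^ (1 / α)) ⊆ Metric.ball x r := by
  intro y hy
  have hc : 0 < c := one_pos.trans_le h.one_le
  change ρ x y < _ at hy
  rw [one_div, Real.lt_rpow_inv_iff_of_pos (h.nonneg x y) (by positivity) h.exponent_pos,
    lt_div_iff₀' hc] at hy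
  rw [Metric.mem_ball, dist_comm]
  exact (h.dist_le x y).trans_lt hy

theorem IsSnowflake.inner_pos (h : IsSnowflake ρ α c) {r : ℝ} (hr : 0 < r) :
    0 < (r / c) ^ (1 / α) := Real.rpow_pos_of_pos (div_pos hr (one_pos.trans_le h.one_le)) _

theorem IsSnowflake.outer_pos (h : IsSnowflake ρ α c) {r : ℝ} (hr : 0 < r) :
    0 < (c * r) ^ (1 / α) := Real.rpow_pos_of_pos (mul_pos (one_pos.trans_le h.one_le) hr) _

theorem exists_separated_net (ε : ℝ) :
    ∃ s : Set X, s.Pairwise (fun x y => ε < dist x y) ∧ ∀ x, ∃ y ∈ s, dist x y ≤ max ε 0 := by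
  obtain ⟨s, hs⟩ := zorn_subset {s : Set X | s.Pairwise fun x y => ε < dist x y}
    fun C hC hchain => ⟨⋃₀ C, (Set.pairwise_sUnion hchain.directedOn).2 fun _ ht => hC ht,
      fun t ht => Set.subset_sUnion_of_mem ht⟩
  refine ⟨s, hs.prop, fun x => ?_⟩
  by_contra! hx
  have h1 : insert x s ∈ {s : Set X | s.Pairwise fun x y => ε < dist x y} := by
    refine hs.prop.insert fun y hy _ => ?_
    have := (le_max_left _ _).trans_lt (hx y hy)
    exact ⟨this, by rwa [dist_comm]⟩
  have h2 : x ∈ s := hs.le_of_ge h1 (Set.subset_insert _ _) (Set.mem_insert _ _)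
  simpa using hx x h2

theorem IsSnowflake.secondCountable (h : IsSnowflake ρ α c) (hX : IsQMMS ρ μ) :
    SecondCountableTopology X := by
  have := hX.sigmaFinite
  refine Metric.secondCountable_of_almost_dense_set fun ε hε => ?_
  obtain ⟨s, hs, hcov⟩ := exists_separated_net (X := X) ε
  refine ⟨s, ?_, fun x => by simpa [hε.le] using hcov x⟩
  have hε2 : 0 < ε / 2 := by positivity
  have hcount := Measure.countable_meas_pos_of_disjoint_iUnion (μ := μ)
    (As := fun x : s => qball ρ (x : X) ((ε / 2 / c) ^ (1 / α)))
    (fun x => hX.measurableSet_ball _ _ (h.inner_pos hε2)) (by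
      intro x y hxy
      refine Disjoint.mono (h.qball_subset_ball hε2 x) (h.qball_subset_ball hε2 y) ?_
      refine Metric.ball_disjoint_ball ?_
      have := hs x.2 y.2 (fun e => hxy (Subtype.ext e))
      linarith)
  have huniv : {x : s | 0 < μ (qball ρ (x : X) ((ε / 2 / c) ^ (1 / α)))} = univ :=
    Set.eq_univ_of_forall fun x => hX.ball_pos _ _ (h.inner_pos hε2)
  rw [huniv, Set.countable_univ_iff] at hcount
  exact Set.countable_coe_iff.1 hcount

theorem IsSnowflake.opensMeasurableSpace (h : IsSnowflake ρ α c) (hX : IsQMMS ρ μ) :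
    OpensMeasurableSpace X := by
  have := h.secondCountable hX
  refine ⟨MeasurableSpace.generateFrom_le fun U hU => ?_⟩
  have h1 : ∀ x ∈ U, ∃ r, 0 < r ∧ Metric.ball x r ⊆ U := fun x hx => Metric.isOpen_iff.1 hU x hx
  choose! r hr hrU using h1
  obtain ⟨t, htU, htc, ht⟩ := TopologicalSpace.countable_cover_nhdsWithin
    (s := U) (f := fun x => qball ρ x ((r x / c) ^ (1 / α))) (fun x hx => by
      refine mem_nhdsWithin_of_mem_nhds ?_
      have hc : 0 < c := one_pos.trans_le h.one_le
      have h2 := hr x hx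
      refine Filter.mem_of_superset (Metric.ball_mem_nhds x
        (show 0 < r x / c / c by positivity)) ?_
      refine (h.ball_subset_qball (by positivity) x).trans ?_
      rw [mul_div_cancel₀ _ hc.ne'])
  have h2 : U = ⋃ x ∈ t, qball ρ x ((r x / c) ^ (1 / α)) :=
    ht.antisymm (Set.iUnion₂_subset fun x hx =>
      (h.qball_subset_ball (hr x (htU hx)) x).trans (hrU x (htU hx)))
  rw [h2]
  exact MeasurableSet.biUnion htc fun x hx => hX.measurableSet_ball _ _ (h.inner_pos (hr x (htU hx)))

theorem IsSnowflake.measure_outer_le (h : IsSnowflake ρ α c) {Q : ℝ} (hdoub : QDoubling ρ μ Q) :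
    ∃ C : ℝ≥0∞, C ≠ ∞ ∧ ∀ (x : X) (r R : ℝ), 0 < r → r ≤ R →
      μ (qball ρ x ((c * R) ^ (1 / α))) ≤
        C * ENNReal.ofReal ((R / r) ^ (Q / α)) * μ (qball ρ x ((r / c) ^ (1 / α))) := by
  obtain ⟨κ, hκ, hd⟩ := hdoub
  have hc : 0 < c := one_pos.trans_le h.one_le
  refine ⟨ENNReal.ofReal (κ⁻¹ * (c * c) ^ (Q / α)), by finiteness, fun x r R hr hrR => ?_⟩
  have hR : 0 < R := hr.trans_le hrR
  have hle : (r / c) ^ (1 / α) ≤ (c * R) ^ (1 / α) := by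
    refine Real.rpow_le_rpow (by positivity) ?_ (by have := h.exponent_pos; positivity)
    calc r / c ≤ r := div_le_self hr.le h.one_le
      _ ≤ R := hrR
      _ ≤ c * R := le_mul_of_one_le_left hR.le h.one_le
  have h1 := hd x x _ _ (h.inner_pos hr) hle fun y hy => lt_of_lt_of_le hy hle
  have h2 : ((r / c) ^ (1 / α) / (c * R) ^ (1 / α)) ^ Q = ((c * c) ^ (Q / α) * (R / r) ^ (Q / α))⁻¹ := by
    rw [← Real.div_rpow (by positivity) (by positivity), ← Real.rpow_mul (by positivity),
      ← Real.mul_rpow (by positivity) (by positivity), ← Real.inv_rpow (by positivity)]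
    congr 1
    · field_simp
    · ring
  have hpos : 0 < (c * c) ^ (Q / α) * (R / r) ^ (Q / α) := by positivity
  rw [h2] at h1
  calc μ (qball ρ x ((c * R) ^ (1 / α)))
      = ENNReal.ofReal (κ⁻¹ * (c * c) ^ (Q / α)) * ENNReal.ofReal ((R / r) ^ (Q / α)) *
        (ENNReal.ofReal (κ * ((c * c) ^ (Q / α) * (R / r) ^ (Q / α))⁻¹) *
          μ (qball ρ x ((c * R) ^ (1 / α)))) := by
        rw [← mul_assoc, ← ENNReal.ofReal_mul (by positivity), ← ENNReal.ofReal_mul (by positivity)]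
        have : κ⁻¹ * (c * c) ^ (Q / α) * (R / r) ^ (Q / α) *
            (κ * ((c * c) ^ (Q / α) * (R / r) ^ (Q / α))⁻¹) = 1 := by
          rw [mul_assoc κ⁻¹, mul_mul_mul_comm, inv_mul_cancel₀ hκ.ne', mul_inv_cancel₀ hpos.ne',
            one_mul]
        rw [this, ENNReal.ofReal_one, one_mul]
    _ ≤ _ := mul_le_mul_right h1 _

theorem IsSnowflake.doublingOn (h : IsSnowflake ρ α c) (hX : IsQMMS ρ μ) {Q : ℝ} (hQ : 0 < Q)
    (hdoub : QDoubling ρ μ Q) : ∃ Cd, DoublingOn μ Cd (Q / α) := by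
  obtain ⟨C, hC, hle⟩ := h.measure_outer_le hdoub
  refine ⟨C, hC, div_pos hQ h.exponent_pos, fun x r hr => ?_, fun x r hr => ?_,
    fun x r R hr hrR => ?_⟩
  · exact (hX.ball_pos x _ (h.inner_pos hr)).trans_le (measure_mono (h.qball_subset_ball hr x))
  · exact (measure_mono (h.ball_subset_qball hr x)).trans_lt (hX.ball_lt_top x _ (h.outer_pos hr))
  · refine (measure_mono (h.ball_subset_qball (hr.trans_le hrR) x)).trans ((hle x r R hr hrR).trans ?_)
    exact mul_le_mul_right (measure_mono (h.qball_subset_ball hr x)) _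

theorem IsSnowflake.densityOn (h : IsSnowflake ρ α c) {Q : ℝ}
    (hdoub : QDoubling ρ μ Q) (hΩ : MeasurableSet Ω) (hne : Ω.Nonempty)
    (hdens : MeasDensity ρ μ Ω) : ∃ C, DensityOn μ Ω C := by
  obtain ⟨C, hC, hle⟩ := h.measure_outer_le hdoub
  obtain ⟨c', hc', hd⟩ := hdens
  refine ⟨C * ENNReal.ofReal c', hΩ, hne, by finiteness, fun x hx r hr hr1 => ?_⟩
  have h1 := hle x r r hr le_rfl
  rw [div_self hr.ne', Real.one_rpow, ENNReal.ofReal_one, mul_one] at h1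
  have hc : 0 < c := one_pos.trans_le h.one_le
  have h2 := hd x hx _ (h.inner_pos hr) (Real.rpow_le_one (by positivity)
    ((div_le_self hr.le h.one_le).trans hr1) (by have := h.exponent_pos; positivity))
  refine (measure_mono (h.ball_subset_qball hr x)).trans (h1.trans ?_)
  rw [mul_assoc]
  refine mul_le_mul_right (h2.trans (mul_le_mul_right (measure_mono ?_) _)) _
  exact Set.inter_subset_inter_left _ (h.qball_subset_ball hr x)

end Snowflake

section Gradients

theorem exists_le_rad_neg {α : ℝ} (hα : 0 < α) (A : ℝ) : ∃ m : ℕ, A ≤ rad α (-m) := by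
  obtain ⟨m, hm⟩ := pow_unbounded_of_one_lt A (Real.one_lt_rpow one_lt_two hα)
  refine ⟨m, hm.le.trans_eq ?_⟩
  rw [← Real.rpow_natCast, ← Real.rpow_mul two_pos.le, rad]
  push_cast
  ring_nf

theorem zpow_rpow_eq_rad (s : ℝ) (k : ℤ) : ((2 : ℝ) ^ (-k)) ^ s = rad s k := by
  rw [← Real.rpow_intCast, ← Real.rpow_mul two_pos.le, rad]
  push_cast
  ring_nf

theorem exists_dyadic_shell {r : ℝ} (hr : 0 < r) :
    ∃ k : ℤ, (2 : ℝ) ^ (-k - 1) ≤ r ∧ r < (2 : ℝ) ^ (-k) := by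
  obtain ⟨n, hn⟩ := exists_mem_Ico_zpow hr one_lt_two
  refine ⟨-n - 1, ?_, ?_⟩
  · rw [show -(-n - 1) - 1 = n by ring]
    exact hn.1
  · rw [show -(-n - 1) = n + 1 by ring]
    exact hn.2

theorem wt_eq_pow_of_neg (s : ℝ) (i : ℕ) : wt s (-i) = wt (-s) 1 ^ i := by
  rw [← wt_natCast, wt, wt, rad, rad]
  congr 2
  push_cast
  ring

variable [PseudoMetricSpace X] {ρ : X → X → ℝ} {α c s : ℝ} {μ : Measure X} {Ω : Set X} {q : ℝ≥0∞}

/-- Fractional gradients control the oscillation at dyadic scales. -/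
theorem IsSnowflake.exists_isOscBound (h : IsSnowflake ρ α c) (hρ : ∀ x y, ρ x y = 0 → x = y)
    (hq : 0 < q) (hs : 0 < s) : ∃ C : ℝ≥0∞, C ≠ ∞ ∧
      ∀ (Ω E : Set X) (u : X → ℝ) (a : ℤ → X → ℝ≥0∞), (∀ k, Measurable (a k)) →
      (∀ x ∈ Ω \ E, lqN q (fun k => a k x) ≠ ∞) →
      (∀ k : ℤ, ∀ x ∈ Ω \ E, ∀ y ∈ Ω \ E, (2 : ℝ) ^ (-k - 1) ≤ ρ x y → ρ x y < (2 : ℝ) ^ (-k) →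
        ‖u x - u y‖ₑ ≤ ENNReal.ofReal (ρ x y ^ s) * (a k x + a k y)) →
      ∃ P, IsOscBound Ω E α u P ∧
        ∀ x, lqN q (fun k => wt s k * P k x) ≤ C * lqN q (fun k => a k x) := by
  obtain ⟨m, hm⟩ := exists_le_rad_neg h.exponent_pos (c * (20 * rad α (-1)))
  have hη : wt (-s) 1 < 1 := wt_one_lt_one (by linarith)
  obtain ⟨C, hC, hconv⟩ := lqN_geometric_conv_le hq hη (fun i => (i : ℤ) - m)
  have hc : 0 < c := one_pos.trans_le h.one_le
  refine ⟨wt s m * C, ENNReal.mul_ne_top (wt_ne_top _ _) hC, fun Ω E u a ha hfin hgrad => ?_⟩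
  set F : X → ℤ → ℝ≥0∞ := fun x j => wt s (-j) * a j x with hF
  have hle : ∀ x (j k : ℤ), k - m ≤ j → F x j ≤ ∑' i : ℕ, F x (k - m + i) := by
    intro x j k hj
    obtain ⟨i, hi⟩ := Int.eq_ofNat_of_zero_le (sub_nonneg.2 hj)
    have : j = k - m + i := by omega
    rw [this]
    exact ENNReal.le_tsum i
  have heq : ∀ x k, wt s k * ∑' i : ℕ, F x (k - m + i) =
      wt s m * ∑' i : ℕ, wt (-s) 1 ^ i * a (k + ((i : ℤ) - m)) x := by
    intro x k
    rw [← ENNReal.tsum_mul_left, ← ENNReal.tsum_mul_left]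
    refine tsum_congr fun i => ?_
    rw [← wt_eq_pow_of_neg, hF, ← mul_assoc, ← mul_assoc, ← wt_add, ← wt_add,
      show k + -(k - m + i) = m + -(i : ℤ) by ring, show k - m + i = k + ((i : ℤ) - m) by ring]
  refine ⟨fun k x => ∑' i : ℕ, F x (k - m + i), ⟨fun k => ?_, fun x k l hkl => ?_,
    fun x hx k => ?_, fun k _ x hx y hy hxy => ?_⟩, fun x => ?_⟩
  · exact Measurable.tsum fun i => (ha _).const_mul _
  · obtain ⟨n, hn⟩ := Int.eq_ofNat_of_zero_le (sub_nonneg.2 hkl)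
    have h1 : ∀ i : ℕ, F x (l - m + i) = F x (k - m + ((i + n : ℕ) : ℤ)) := by
      intro i
      congr 1
      push_cast
      omega
    simp only [h1]
    exact ENNReal.tsum_comp_le_tsum_of_injective (f := fun i : ℕ => i + n)
      (add_left_injective n) (fun i : ℕ => F x (k - m + (i : ℤ)))
  · have h1 : ∀ n i : ℕ, F x (k + n - m + i) = F x (k - m + ((i + n : ℕ) : ℤ)) := by
      intro n i
      congr 1
      push_cast
      ring
    simp only [h1]
    refine ENNReal.tendsto_sum_nat_add (fun i : ℕ => F x (k - m + (i : ℤ))) ?_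
    have h2 : wt s k * ∑' i : ℕ, F x (k - m + i) ≠ ∞ := by
      rw [heq]
      refine ENNReal.mul_ne_top (wt_ne_top _ _) (ne_top_of_le_ne_top
        (ENNReal.mul_ne_top (tsum_geometric_ne_top hη) (hfin x hx)) ?_)
      rw [← ENNReal.tsum_mul_right]
      exact ENNReal.tsum_le_tsum fun i => mul_le_mul_right (le_lqN hq (fun k => a k x) _) _
    intro h3
    rw [h3, ENNReal.mul_top (wt_ne_zero _ _)] at h2
    exact h2 rfl
  · rcases (h.nonneg x y).eq_or_lt with h0 | h0
    · simp [hρ x y h0.symm]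
    obtain ⟨j, hj1, hj2⟩ := exists_dyadic_shell h0
    have h1 : ρ x y < (2 : ℝ) ^ (-(k - m)) := by
      rw [← Real.rpow_lt_rpow_iff (h.nonneg x y) (by positivity) h.exponent_pos, zpow_rpow_eq_rad]
      calc ρ x y ^ α ≤ c * dist x y := h.rpow_le x y
        _ < c * (20 * rad α (k - 1)) := by gcongr
        _ = c * (20 * rad α (-1)) * rad α k := by rw [sub_eq_add_neg, rad_add]; ring
        _ ≤ rad α (-m) * rad α k := mul_le_mul_of_nonneg_right hm (rad_pos _ _).le
        _ = rad α (k - m) := by rw [← rad_add]; congr 1; ring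
    have h2 : k - m ≤ j := by
      have := (zpow_lt_zpow_iff_right₀ (one_lt_two : (1 : ℝ) < 2)).1 (hj1.trans_lt h1)
      omega
    refine (hgrad j x hx y hy hj1 hj2).trans (le_trans ?_ (add_le_add (hle x j k h2) (hle y j k h2)))
    rw [hF, ← mul_add]
    refine mul_le_mul_left ?_ _
    rw [← ofReal_rad, ← zpow_rpow_eq_rad]
    exact ENNReal.ofReal_le_ofReal (Real.rpow_le_rpow (h.nonneg x y) hj2.le hs.le)
  · simp only [heq]
    rw [lqN_const_mul hq, mul_assoc]
    exact mul_le_mul_right (hconv fun k => a k x) _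

/-- A family controlling the oscillation at dyadic scales yields a fractional gradient. -/
theorem IsSnowflake.exists_fracGrad (h : IsSnowflake ρ α c) (hq : 0 < q) (hs : 0 < s) :
    ∃ C : ℝ≥0∞, C ≠ ∞ ∧ ∀ (f : X → ℝ) (Γ : ℤ → X → ℝ≥0∞), (∀ k, Measurable (Γ k)) →
      (∀ᵐ x ∂μ, lqN q (fun k => Γ k x) ≠ ∞ ∧ ∀ y, lqN q (fun k => Γ k y) ≠ ∞ → ∀ n : ℤ,
        dist x y ≤ rad α n / 4 →
        ‖f x - f y‖ₑ ≤ ENNReal.ofReal (rad s n) * (Γ n x + Γ n y)) →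
      ∃ g ∈ fracGrad ρ μ univ s f, ∀ x,
        lqN q (fun k => ENNReal.ofReal (g k x)) ≤ C * lqN q (fun k => Γ k x) := by
  obtain ⟨l, hl⟩ := exists_le_rad_neg h.exponent_pos (4 * c)
  have hc : 0 < c := one_pos.trans_le h.one_le
  refine ⟨wt s (l + 1), wt_ne_top _ _, fun f Γ hΓ hf => ?_⟩
  refine ⟨fun k x => (wt s (l + 1) * Γ (k - l) x).toReal, ⟨fun k x => ENNReal.toReal_nonneg,
    fun k => ((hΓ _).const_mul _).ennreal_toReal.aemeasurable, _, hf, ?_⟩, fun x => ?_⟩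
  · intro k x hx y hy hk1 hk2
    simp only [Set.mem_sdiff, Set.mem_univ, true_and, Set.mem_compl_iff, not_not] at hx hy
    obtain ⟨hx1, hx2⟩ := hx
    have hfin : ∀ z, lqN q (fun k => Γ k z) ≠ ∞ → wt s (l + 1) * Γ (k - l) z ≠ ∞ := fun z hz =>
      ENNReal.mul_ne_top (wt_ne_top _ _) (ne_top_of_le_ne_top hz (le_lqN hq (fun k => Γ k z) _))
    have h1 : dist x y ≤ rad α (k - l) / 4 := by
      have h2 : ρ x y ^ α ≤ rad α k := by
        rw [← zpow_rpow_eq_rad]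
        exact Real.rpow_le_rpow (h.nonneg x y) hk2.le h.exponent_pos.le
      have h3 := (h.dist_le x y).trans (mul_le_mul_of_nonneg_left h2 hc.le)
      have h4 := mul_le_mul_of_nonneg_right hl (rad_pos α k).le
      rw [← rad_add, neg_add_eq_sub] at h4
      linarith
    have h5 : rad s (k - l) ≤ ρ x y ^ s * rad s (-(l + 1)) := by
      have h6 : rad s (k + 1) ≤ ρ x y ^ s := by
        rw [← zpow_rpow_eq_rad]
        exact Real.rpow_le_rpow (by positivity) (by rwa [neg_add']) hs.le
      calc rad s (k - l) = rad s (k + 1) * rad s (-(l + 1)) := by rw [← rad_add]; congr 1; ring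
        _ ≤ _ := mul_le_mul_of_nonneg_right h6 (rad_pos _ _).le
    have h7 := hx2 y hy.1 (k - l) h1
    rw [Real.enorm_eq_ofReal_abs] at h7
    rw [← ENNReal.toReal_add (hfin x hx1) (hfin y hy.1),
      ← ENNReal.ofReal_le_ofReal_iff (mul_nonneg (Real.rpow_nonneg (h.nonneg x y) s)
        ENNReal.toReal_nonneg), ENNReal.ofReal_mul (Real.rpow_nonneg (h.nonneg x y) s),
      ENNReal.ofReal_toReal (ENNReal.add_ne_top.2 ⟨hfin x hx1, hfin y hy.1⟩), ← mul_add, ← mul_assoc]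
    refine h7.trans (mul_le_mul_left ?_ _)
    rw [wt, ← ENNReal.ofReal_mul (Real.rpow_nonneg (h.nonneg x y) s)]
    exact ENNReal.ofReal_le_ofReal h5
  · calc lqN q (fun k => ENNReal.ofReal (wt s (l + 1) * Γ (k - l) x).toReal)
        ≤ lqN q (fun k => wt s (l + 1) * Γ (k - l) x) :=
          lqN_mono fun k => ENNReal.ofReal_toReal_le
      _ = wt s (l + 1) * lqN q (fun k => Γ (k - l) x) := lqN_const_mul hq _ _
      _ = wt s (l + 1) * lqN q (fun k => Γ k x) := by
          simp only [sub_eq_add_neg, lqN_shift (fun k => Γ k x)]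

end Gradients

section Extension

theorem exists_exponent {Q s p : ℝ} {q : ℝ≥0∞} (hQ : 0 < Q) (hs : 0 < s) (hpQ : Q / (Q + s) < p)
    (hqQ : ENNReal.ofReal (Q / (Q + s)) < q) :
    ∃ t : ℝ, 0 < t ∧ t < 1 ∧ t < p ∧ ENNReal.ofReal t < q ∧ Q * (1 / t - 1) < s := by
  obtain ⟨r, -, hr, hrq⟩ := ENNReal.lt_iff_exists_real_btwn.1 hqQ
  have hr' : Q / (Q + s) < r := (ENNReal.ofReal_lt_ofReal_iff_of_nonneg (by positivity)).1 hr
  have h1 : Q / (Q + s) < 1 := by rw [div_lt_one (by positivity)]; linarith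
  obtain ⟨t, ht, ht'⟩ := exists_between (lt_min h1 (lt_min hpQ hr'))
  rw [lt_min_iff, lt_min_iff] at ht'
  have ht0 : 0 < t := lt_trans (by positivity) ht
  refine ⟨t, ht0, ht'.1, ht'.2.1, (ENNReal.ofReal_le_ofReal ht'.2.2.le).trans_lt hrq, ?_⟩
  rw [div_lt_iff₀ (by positivity)] at ht
  have h2 : Q * (1 / t - 1) = (Q - Q * t) / t := by field_simp
  rw [h2, div_lt_iff₀ ht0]
  linarith

theorem exists_rpow_add_le (p : ℝ) (hp : 0 < p) {K : ℝ≥0∞} (hK : K ≠ ∞) : ∃ C : ℝ≥0∞, C ≠ ∞ ∧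
    ∀ a b c : ℝ≥0∞, a ≤ K * (b + c) → a ^ (1 / p) ≤ C * (b ^ (1 / p) + c ^ (1 / p)) := by
  have hp' : 0 < 1 / p := by positivity
  refine ⟨K ^ (1 / p) * 2 ^ (1 / p), by finiteness, fun a b c h => ?_⟩
  refine (ENNReal.rpow_le_rpow h hp'.le).trans ?_
  rw [ENNReal.mul_rpow_of_nonneg _ _ hp'.le, mul_assoc]
  exact mul_le_mul_right (ennreal_add_rpow_le _ _ hp'.le) _

variable {ρ : X → X → ℝ} {α c s : ℝ} {μ : Measure X} {Ω : Set X} {q : ℝ≥0∞}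

theorem lqN_zero (hq : 0 < q) : lqN q (fun _ => 0) = 0 := by
  simpa using lqN_const_mul hq 0 (fun _ => 0)

theorem lpN_ne_top_iff {p : ℝ} (hp : 0 < p) {f : X → ℝ≥0∞} :
    lpN μ p f ≠ ∞ ↔ ∫⁻ x, f x ^ p ∂μ ≠ ∞ := by
  rw [lpN, Ne, ENNReal.rpow_eq_top_iff_of_pos (by positivity)]

/-- Replacing a function with a fractional gradient by measurable versions. -/
theorem exists_measurable_gradient (hΩ : MeasurableSet Ω) {p : ℝ} (hp : 0 < p) (hq : 0 < q)
    {u : X → ℝ} (hu : AEMeasurable u (μ.restrict Ω)) {g : ℤ → X → ℝ} (hg : g ∈ fracGrad ρ μ Ω s u)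
    (hgfin : lpN (μ.restrict Ω) p (fun x => lqN q fun k => ENNReal.ofReal (g k x)) ≠ ∞) :
    ∃ (v : X → ℝ) (a : ℤ → X → ℝ≥0∞) (E : Set X), Measurable v ∧ (∀ k, Measurable (a k)) ∧
      μ E = 0 ∧ u =ᵐ[μ.restrict Ω] v ∧ (∀ x ∈ Ω \ E, lqN q (fun k => a k x) ≠ ∞) ∧
      (∫⁻ x, lqN q (fun k => a k x) ^ p ∂μ =
        ∫⁻ x in Ω, lqN q (fun k => ENNReal.ofReal (g k x)) ^ p ∂μ) ∧
      ∀ k : ℤ, ∀ x ∈ Ω \ E, ∀ y ∈ Ω \ E, (2 : ℝ) ^ (-k - 1) ≤ ρ x y → ρ x y < (2 : ℝ) ^ (-k) →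
        ‖v x - v y‖ₑ ≤ ENNReal.ofReal (ρ x y ^ s) * (a k x + a k y) := by
  obtain ⟨hg0, hgm, E, hE, hgrad⟩ := hg
  set b : ℤ → X → ℝ≥0∞ := fun k x => ENNReal.ofReal ((hgm k).mk (g k) x) with hb
  have hbm : ∀ k, Measurable (b k) := fun k => (hgm k).measurable_mk.ennreal_ofReal
  have hbg : ∀ᵐ x ∂μ.restrict Ω, ∀ k, b k x = ENNReal.ofReal (g k x) := by
    refine ae_all_iff.2 fun k => ?_
    filter_upwards [(hgm k).ae_eq_mk] with x hx
    rw [hb, hx]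
  have hint : ∫⁻ x in Ω, lqN q (fun k => b k x) ^ p ∂μ =
      ∫⁻ x in Ω, lqN q (fun k => ENNReal.ofReal (g k x)) ^ p ∂μ := by
    refine lintegral_congr_ae ?_
    filter_upwards [hbg] with x hx
    simp only [hx]
  have hfin : ∀ᵐ x ∂μ.restrict Ω, lqN q (fun k => b k x) ≠ ∞ := by
    rw [lpN_ne_top_iff hp, ← hint] at hgfin
    filter_upwards [ae_lt_top ((measurable_lqN hbm).pow_const p) hgfin] with x hx h1
    rw [h1, ENNReal.top_rpow_of_pos hp] at hx
    exact hx.ne rfl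
  have hall := ((hbg.and hfin).and hu.ae_eq_mk)
  rw [ae_restrict_iff' hΩ] at hall
  refine ⟨hu.mk u, fun k => Ω.indicator (b k), E ∪ _, hu.measurable_mk,
    fun k => (hbm k).indicator hΩ, measure_union_null hE hall, hu.ae_eq_mk, ?_, ?_, ?_⟩
  · intro x hx
    simp only [Set.mem_sdiff, Set.mem_union, not_or, Set.mem_compl_iff, not_not] at hx
    simpa [hx.1] using (hx.2.2 hx.1).1.2
  · rw [← hint, ← lintegral_indicator hΩ]
    refine lintegral_congr fun x => ?_
    by_cases hx : x ∈ Ω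
    · simp [hx]
    · simp [hx, lqN_zero hq, hp]
  · intro k x hx y hy hk1 hk2
    simp only [Set.mem_sdiff, Set.mem_union, not_or, Set.mem_compl_iff, not_not] at hx hy
    obtain ⟨⟨hx1, -⟩, hx2⟩ := hx.2.2 hx.1
    obtain ⟨⟨hy1, -⟩, hy2⟩ := hy.2.2 hy.1
    have h1 := hgrad k x ⟨hx.1, hx.2.1⟩ y ⟨hy.1, hy.2.1⟩ hk1 hk2
    beta_reduce
    rw [Set.indicator_of_mem hx.1, Set.indicator_of_mem hy.1, hx1, hy1,
      ← ENNReal.ofReal_add (hg0 _ _) (hg0 _ _), ← ENNReal.ofReal_mul' (add_nonneg (hg0 _ _) (hg0 _ _)),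
      ← hx2, ← hy2, Real.enorm_eq_ofReal_abs]
    exact ENNReal.ofReal_le_ofReal h1

theorem extOp_congr [PseudoMetricSpace X] {u v : X → ℝ} (h : u =ᵐ[μ.restrict Ω] v) :
    extOp μ Ω α u = extOp μ Ω α v := by
  have h1 : ∀ K : X → ℝ, ∫ z in Ω, K z * u z ∂μ = ∫ z in Ω, K z * v z ∂μ := fun K => by
    refine integral_congr_ae ?_
    filter_upwards [h] with z hz
    rw [hz]
  funext x
  simp only [extOp, extSum, extInit, extStep, h1]

variable [PseudoMetricSpace X]

theorem IsSnowflake.exists_extension_bound (h : IsSnowflake ρ α c) (hX : IsQMMS ρ μ) {Q : ℝ}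
    (hQ : 0 < Q) (hdoub : QDoubling ρ μ Q) {p : ℝ} (hs : 0 < s) (hp : 0 < p) (hq : 0 < q)
    (hsα : s < α ∨ (q = ∞ ∧ s ≤ α)) (hpQ : Q / (Q + s) < p)
    (hqQ : ENNReal.ofReal (Q / (Q + s)) < q) (hΩ : MeasurableSet Ω) (hne : Ω.Nonempty)
    (hdens : MeasDensity ρ μ Ω) :
    ∃ C : ℝ≥0∞, C ≠ ∞ ∧ ∀ (u : X → ℝ) (g : ℤ → X → ℝ), AEMeasurable u (μ.restrict Ω) →
      lpOn μ Ω p u ≠ ∞ → g ∈ fracGrad ρ μ Ω s u →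
      lpN (μ.restrict Ω) p (fun x => lqN q fun k => ENNReal.ofReal (g k x)) ≠ ∞ →
      (∀ x, IntegrableOn (fun z => initKer μ Ω α x z * u z) Ω μ) ∧
      (∀ (k : ℕ) x, IntegrableOn (fun z => stepKer μ Ω α k x z * u z) Ω μ) ∧
      AEMeasurable (extOp μ Ω α u) μ ∧ (∀ᵐ x ∂μ.restrict Ω, extOp μ Ω α u x = u x) ∧
      MNorm ρ μ univ s p q (extOp μ Ω α u) ≤
        C * (lpN (μ.restrict Ω) p (fun x => lqN q fun k => ENNReal.ofReal (g k x)) +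
          lpOn μ Ω p u) := by
  obtain ⟨Cd, hd⟩ := h.doublingOn hX hQ hdoub
  obtain ⟨c', hdΩ⟩ := h.densityOn hdoub hΩ hne hdens
  have := h.secondCountable hX
  have := h.opensMeasurableSpace hX
  have := hX.sigmaFinite
  obtain ⟨t, ht0, ht1, htp, htq, htQ⟩ := exists_exponent hQ hs hpQ hqQ
  have hα := h.exponent_pos
  obtain ⟨C₁, hC₁, hop⟩ := exists_extOp_bound hd hdΩ hs hsα ht0 ht1 htp htq
    (by rwa [mul_div_cancel₀ _ hα.ne'])
  obtain ⟨C₀, hC₀, hosc⟩ := h.exists_isOscBound (fun x y => (hX.quasi.2.1 x y).1) hq hs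
  obtain ⟨C₂, hC₂, hfrac⟩ := h.exists_fracGrad (μ := μ) hq hs
  have hC₀p : C₀ ^ p ≠ ∞ := by finiteness
  have hC₂p : C₂ ^ p ≠ ∞ := by finiteness
  have hK₁ : C₁ * (C₀ ^ p + 1) ≠ ∞ := by finiteness
  have hK₂ : C₂ ^ p * (C₁ * (C₀ ^ p + 1)) ≠ ∞ := by finiteness
  obtain ⟨C₃, hC₃, h₃⟩ := exists_rpow_add_le p hp hK₁
  obtain ⟨C₄, hC₄, h₄⟩ := exists_rpow_add_le p hp hK₂
  refine ⟨C₄ + C₃, by finiteness, fun u g hu hup hg hgp => ?_⟩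
  obtain ⟨v, a, E, hv, ha, hE, huv, hafin, haint, hav⟩ :=
    exists_measurable_gradient hΩ hp hq hu hg hgp
  obtain ⟨P, hP, hPa⟩ := hosc Ω E v a ha hafin hav
  have hPint : ∫⁻ x, lqN q (fun k => wt s k * P k x) ^ p ∂μ ≤
      C₀ ^ p * ∫⁻ x in Ω, lqN q (fun k => ENNReal.ofReal (g k x)) ^ p ∂μ := by
    rw [← haint, ← lintegral_const_mul' _ _ hC₀p]
    refine lintegral_mono fun x => ?_
    rw [← ENNReal.mul_rpow_of_nonneg _ _ hp.le]
    exact ENNReal.rpow_le_rpow (hPa x) hp.le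
  have hvint : ∫⁻ x in Ω, ‖v x‖ₑ ^ p ∂μ = ∫⁻ x in Ω, ENNReal.ofReal |u x| ^ p ∂μ := by
    refine lintegral_congr_ae ?_
    filter_upwards [huv] with x hx
    rw [hx, Real.enorm_eq_ofReal_abs]
  have hgp' := (lpN_ne_top_iff hp).1 hgp
  have hup' := (lpN_ne_top_iff hp).1 hup
  obtain ⟨hI, hS, hm, heq, Γ, hΓm, hΓint, hΓ⟩ := hop E v P hE hv hP
    (ne_top_of_le_ne_top (by finiteness) hPint) (by rwa [hvint])
  rw [← extOp_congr huv] at hm heq hΓ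
  obtain ⟨G, hG, hGΓ⟩ := hfrac (extOp μ Ω α u) Γ hΓm (hΓ.mono fun x hx => ⟨hx.1, hx.2.2⟩)
  have hcongr : ∀ K : X → ℝ, IntegrableOn (fun z => K z * v z) Ω μ →
      IntegrableOn (fun z => K z * u z) Ω μ := fun K hK => by
    refine hK.congr ?_
    filter_upwards [huv] with z hz
    rw [hz]
  set A := ∫⁻ x in Ω, lqN q (fun k => ENNReal.ofReal (g k x)) ^ p ∂μ with hA
  set B := ∫⁻ x in Ω, ENNReal.ofReal |u x| ^ p ∂μ with hB
  have hΓAB : ∫⁻ x, lqN q (fun k => Γ k x) ^ p ∂μ ≤ C₁ * (C₀ ^ p + 1) * (A + B) := by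
    rw [hvint] at hΓint
    refine hΓint.trans ?_
    rw [mul_assoc]
    refine mul_le_mul_right ((add_le_add_left hPint _).trans ?_) _
    rw [add_mul, mul_add, one_mul]
    exact add_le_add le_self_add le_add_self
  refine ⟨fun x => hcongr _ (hI x), fun k x => hcongr _ (hS k x), hm, ?_, ?_⟩
  · rw [ae_restrict_iff' hΩ]
    have huv' := (ae_restrict_iff' hΩ).1 huv
    filter_upwards [heq, huv'] with x hx1 hx2 hx
    rw [hx1 hx, hx2 hx]
  · rw [MNorm, add_mul]
    refine add_le_add ((iInf₂_le G hG).trans (h₄ _ _ _ ?_)) (h₃ _ _ _ ?_)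
    · rw [Measure.restrict_univ, mul_assoc (C₂ ^ p)]
      refine le_trans ?_ (mul_le_mul_right hΓAB _)
      rw [← lintegral_const_mul' _ _ hC₂p]
      refine lintegral_mono fun x => ?_
      rw [← ENNReal.mul_rpow_of_nonneg _ _ hp.le]
      exact ENNReal.rpow_le_rpow (hGΓ x) hp.le
    · rw [Measure.restrict_univ]
      refine le_trans (lintegral_mono_ae ?_) hΓAB
      filter_upwards [hΓ] with x hx
      rw [← Real.enorm_eq_ofReal_abs]
      exact ENNReal.rpow_le_rpow (hx.2.1.trans (le_lqN hq (fun k => Γ k x) 0)) hp.le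

theorem extOp_add {u v : X → ℝ} (hu : ∀ x, IntegrableOn (fun z => initKer μ Ω α x z * u z) Ω μ)
    (hu' : ∀ (k : ℕ) x, IntegrableOn (fun z => stepKer μ Ω α k x z * u z) Ω μ)
    (hv : ∀ x, IntegrableOn (fun z => initKer μ Ω α x z * v z) Ω μ)
    (hv' : ∀ (k : ℕ) x, IntegrableOn (fun z => stepKer μ Ω α k x z * v z) Ω μ) :
    extOp μ Ω α (fun x => u x + v x) = fun x => extOp μ Ω α u x + extOp μ Ω α v x := by
  funext x
  rw [extOp, extOp, extOp, ← map_add]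
  congr 1
  funext K
  simp only [extSum, extInit, extStep, mul_add, Pi.add_apply]
  rw [integral_add (hu x) (hv x), Finset.sum_congr rfl fun k _ => integral_add (hu' k x) (hv' k x),
    Finset.sum_add_distrib]
  ring

theorem extOp_const_mul (a : ℝ) (u : X → ℝ) :
    extOp μ Ω α (fun x => a * u x) = fun x => a * extOp μ Ω α u x := by
  funext x
  rw [extOp, extOp, ← smul_eq_mul, ← map_smul]
  congr 1
  funext K
  simp only [extSum, extInit, extStep, mul_left_comm _ a, integral_const_mul, Pi.smul_apply,
    smul_eq_mul, mul_add, Finset.mul_sum]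

end Extension

/-- Theorem 1.1 (linear extension part): if moreover `p, q > Q/(Q+s)`, there is a bounded
linear extension operator `𝓔 : M^s_{p,q}(Ω) → M^s_{p,q}(X)`. -/
theorem measure_density_implies_linear_M_extension
    {X : Type*} [MeasurableSpace X] (ρ : X → X → ℝ) (μ : Measure X)
    (hX : IsQMMS ρ μ) (hreg : BorelRegular μ)
    (Q : ℝ) (hQ : 0 < Q) (hdoub : QDoubling ρ μ Q)
    (s p : ℝ) (q : ℝ≥0∞) (hs : 0 < s) (hp : 0 < p) (hq : 0 < q)
    (hind : SPrecIndex ρ s q)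
    (hpQ : Q / (Q + s) < p) (hqQ : ENNReal.ofReal (Q / (Q + s)) < q)
    (Ω : Set X) (hΩmeas : MeasurableSet Ω) (hΩne : Ω.Nonempty)
    (hdens : MeasDensity ρ μ Ω) :
    ∃ E : (X → ℝ) → (X → ℝ), ∃ C : ℝ, 0 < C ∧
      (∀ u : X → ℝ, MemMspq ρ μ Ω s p q u →
        MemMspq ρ μ Set.univ s p q (E u) ∧
        (∀ᵐ x ∂μ.restrict Ω, E u x = u x) ∧
        MNorm ρ μ Set.univ s p q (E u) ≤ ENNReal.ofReal C * MNorm ρ μ Ω s p q u) ∧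
      (∀ u v : X → ℝ, MemMspq ρ μ Ω s p q u → MemMspq ρ μ Ω s p q v →
        E (fun x => u x + v x) = fun x => E u x + E v x) ∧
      (∀ (a : ℝ) (u : X → ℝ), MemMspq ρ μ Ω s p q u →
        E (fun x => a * u x) = fun x => a * E u x) := by
  obtain ⟨α, c, _, hsα, hc, hdist⟩ := hind.exists_metric hs
  have h : IsSnowflake ρ α c := ⟨hs.trans_le (hsα.elim le_of_lt fun h => h.2), hc, hX.quasi.1,
    fun x y => (hdist x y).1, fun x y => (hdist x y).2⟩
  obtain ⟨C, hC, hE⟩ := h.exists_extension_bound hX hQ hdoub hs hp hq hsα hpQ hqQ hΩmeas hΩne hdens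
  have hex : ∀ u, MemMspq ρ μ Ω s p q u → ∃ g ∈ fracGrad ρ μ Ω s u,
      lpN (μ.restrict Ω) p (fun x => lqN q fun k => ENNReal.ofReal (g k x)) ≠ ∞ := by
    intro u hu
    by_contra! hg
    exact hu.2.2 (iInf₂_eq_top.2 hg)
  refine ⟨extOp μ Ω α, C.toReal + 1, by positivity, fun u hu => ?_, fun u v hu hv => ?_,
    fun a u _ => extOp_const_mul a u⟩
  · obtain ⟨g, hg, hgfin⟩ := hex u hu
    obtain ⟨-, -, hm, heq, hle⟩ := hE u g hu.1 hu.2.1 hg hgfin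
    have hfin : MNorm ρ μ univ s p q (extOp μ Ω α u) ≠ ∞ :=
      ne_top_of_le_ne_top (ENNReal.mul_ne_top hC (ENNReal.add_ne_top.2 ⟨hgfin, hu.2.1⟩)) hle
    rw [MNorm, ENNReal.add_ne_top] at hfin
    refine ⟨⟨by rwa [Measure.restrict_univ], hfin.2, hfin.1⟩, heq, ?_⟩
    have hC0 : ENNReal.ofReal (C.toReal + 1) ≠ 0 := by
      rw [Ne, ENNReal.ofReal_eq_zero, not_le]
      positivity
    have hCC : C ≤ ENNReal.ofReal (C.toReal + 1) :=
      ENNReal.le_ofReal_iff_toReal_le hC (by positivity) |>.2 (by linarith)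
    conv_rhs => rw [MNorm, MdotNorm]
    simp only [ENNReal.iInf_add, ENNReal.mul_iInf_of_ne hC0 ENNReal.ofReal_ne_top]
    refine le_iInf₂ fun g' hg' => ?_
    by_cases hgfin' : lpN (μ.restrict Ω) p
        (fun x => lqN q fun k => ENNReal.ofReal (g' k x)) = ∞
    · rw [hgfin', top_add, ENNReal.mul_top hC0]
      exact le_top
    · exact (hE u g' hu.1 hu.2.1 hg' hgfin').2.2.2.2.trans (mul_le_mul_left hCC _)
  · obtain ⟨g, hg, hgfin⟩ := hex u hu
    obtain ⟨g', hg', hgfin'⟩ := hex v hv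
    obtain ⟨hu1, hu2, -⟩ := hE u g hu.1 hu.2.1 hg hgfin
    obtain ⟨hv1, hv2, -⟩ := hE v g' hv.1 hv.2.1 hg' hgfin'
    exact extOp_add hu1 hu2 hv1 hv2

end HajlaszPaper
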